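/- arXiv:1806.00638 — 9 statements merged into one kernel-verified Lean document; each statement's English description precedes it below -/
import Mathlib

section
/- There exist constants c₁, c₂ > 0 such that for every integer n ≥ 2 and every finite field F: (i) there exists a graph G on n vertices whose complement is triangle-free with minrk_F(G) ≥ c₁ · √n / log(n · |F|), and (ii) every graph G on n vertices whose complement is triangle-free satisfies minrk_F(G) ≤ c₂ · √(n / log n). -/
open Matrix

/-- `M` represents the graph `G` over a field: nonzero diagonal entries, and zero entries at
off-diagonal non-adjacent pairs. -/
def Represents {F V : Type*} [Field F] (M : Matrix V V F) (G : SimpleGraph V) : Prop :=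
  (∀ v, M v v ≠ 0) ∧ ∀ u v, u ≠ v → ¬ G.Adj u v → M u v = 0

/-- The minrank of a graph `G` over a field `F`: the minimum possible rank of a matrix
representing `G`. -/
noncomputable def minrk (F : Type*) [Field F] {V : Type*} [Fintype V]
    (G : SimpleGraph V) : ℕ :=
  sInf { r : ℕ | ∃ M : Matrix V V F, Represents M G ∧ M.rank = r }

/-- `G` contains a copy of `H` as a (not necessarily induced) subgraph, i.e. there is an
injective graph homomorphism from `H` to `G`. -/
def ContainsCopy {V W : Type*} (H : SimpleGraph W) (G : SimpleGraph V) : Prop :=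
  ∃ f : W → V, Function.Injective f ∧ ∀ a b, H.Adj a b → G.Adj (f a) (f b)

/-- Twice the sum of the sizes of all subsets of `X` is `#X * 2 ^ #X`. -/
lemma two_mul_sum_card_powerset {α : Type*} [DecidableEq α] (X : Finset α) :
    2 * ∑ T ∈ X.powerset, T.card = X.card * 2 ^ X.card := by
  have h : ∑ T ∈ X.powerset, T.card = ∑ T ∈ X.powerset, (X \ T).card := by
    refine Finset.sum_nbij' (fun T => X \ T) (fun T => X \ T) ?_ ?_ ?_ ?_ ?_
    · intro T _; simp
    · intro T _; simp
    · intro T hT; simpa using Finset.mem_powerset.1 hT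
    · intro T hT; simpa using Finset.mem_powerset.1 hT
    · intro T hT
      rw [Finset.sdiff_sdiff_eq_self (Finset.mem_powerset.1 hT)]
  calc 2 * ∑ T ∈ X.powerset, T.card
      = ∑ T ∈ X.powerset, (T.card + (X \ T).card) := by
        rw [Finset.sum_add_distrib, ← h]; ring
    _ = ∑ T ∈ X.powerset, X.card := by
        refine Finset.sum_congr rfl fun T hT => ?_
        rw [add_comm]
        exact Finset.card_sdiff_add_card_eq_card (Finset.mem_powerset.1 hT)
    _ = _ := by simp [mul_comm]

lemma log_le_two_mul_sqrt {x : ℝ} (hx : 0 ≤ x) : Real.log x ≤ 2 * √x := by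
  have h := Real.log_le_self (Real.sqrt_nonneg x)
  rw [Real.log_sqrt hx] at h
  linarith

lemma log_div_mul_two_pow_add_one_le {D : ℝ} (hD : 1 ≤ D) (x : ℕ) :
    Real.log D / 8 * (2 ^ x + 1) ≤ D + x * 2 ^ x / 2 := by
  have hl : 0 ≤ Real.log D := Real.log_nonneg hD
  have h2 : (1 : ℝ) ≤ 2 ^ x := one_le_pow₀ (by norm_num)
  have hx0 : (0 : ℝ) ≤ x := x.cast_nonneg
  rcases le_total (Real.log D / 2) x with h | h
  · nlinarith [mul_le_mul_of_nonneg_right h (by linarith : (0 : ℝ) ≤ 2 ^ x),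
      mul_le_mul_of_nonneg_left h2 hl]
  · have h3 : (2 : ℝ) ^ x ≤ √D := by
      calc (2 : ℝ) ^ x ≤ Real.exp 1 ^ x := by
            gcongr; linarith [Real.add_one_le_exp (1 : ℝ)]
        _ = Real.exp x := by rw [← Real.exp_nat_mul]; simp
        _ ≤ Real.exp (Real.log D / 2) := Real.exp_le_exp.2 h
        _ = √D := by
          rw [← Real.log_sqrt (by linarith), Real.exp_log (Real.sqrt_pos.2 (by linarith))]
    have h4 := log_le_two_mul_sqrt (by linarith : 0 ≤ D)
    have h5 := Real.mul_self_sqrt (by linarith : 0 ≤ D)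
    have : Real.log D * 2 ^ x ≤ 2 * √D * √D := mul_le_mul h4 h3 (by positivity) (by positivity)
    have : 0 ≤ x * (2:ℝ) ^ x / 2 := by positivity
    nlinarith

/-- Triangle-freeness of a graph, spelled out on vertices. -/
def TriangleFree {V : Type*} (H : SimpleGraph V) : Prop :=
  ∀ a b c, H.Adj a b → H.Adj a c → ¬ H.Adj b c

open Classical in
/-- The independent sets whose trace outside the closed neighbourhood of `v` is `U`, in a
triangle-free graph. -/
lemma filter_indep_sdiff_eq {V : Type*} [Fintype V] (H : SimpleGraph V) (hH : TriangleFree H)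
    (v : V) (U : Finset V) (hU : H.IsIndepSet (U : Set V))
    (hUv : Disjoint U (insert v (H.neighborFinset v))) :
    (Finset.univ.filter fun W : Finset V => H.IsIndepSet (W : Set V) ∧
      W \ insert v (H.neighborFinset v) = U) =
    insert (insert v U) (((H.neighborFinset v).filter fun x => ∀ u ∈ U, ¬ H.Adj x u).powerset.image
      fun T => U ∪ T) := by
  have hUv' : ∀ u ∈ U, u ≠ v ∧ ¬ H.Adj v u := by
    intro u hu
    have := Finset.disjoint_left.1 hUv hu
    simpa using this
  ext W
  simp only [Finset.mem_filter, Finset.mem_univ, true_and, Finset.mem_insert, Finset.mem_image,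
    Finset.mem_powerset]
  constructor
  · rintro ⟨hW, rfl⟩
    by_cases hv : v ∈ W
    · left
      ext x
      simp only [Finset.mem_insert, Finset.mem_sdiff, SimpleGraph.mem_neighborFinset]
      constructor
      · intro hx
        by_cases hxv : x = v
        · exact Or.inl hxv
        · refine Or.inr ⟨hx, ?_⟩
          rintro (h | h)
          · exact hxv h
          · exact hW hv hx (Ne.symm hxv) h
      · rintro (rfl | h)
        · exact hv
        · exact h.1
    · right
      refine ⟨W ∩ H.neighborFinset v, ?_, ?_⟩
      · intro x hx
        rw [Finset.mem_inter] at hx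
        rw [Finset.mem_filter]
        refine ⟨hx.2, fun u hu hxu => ?_⟩
        exact hW hx.1 (Finset.mem_sdiff.1 hu).1 hxu.ne hxu
      · ext x
        simp only [Finset.mem_union, Finset.mem_inter, Finset.mem_insert, Finset.mem_sdiff,
          SimpleGraph.mem_neighborFinset]
        constructor
        · tauto
        · intro hx
          have : x ≠ v := fun h => hv (h ▸ hx)
          tauto
  · rintro (rfl | ⟨T, hT, rfl⟩)
    · constructor
      · intro x hx y hy hxy hadj
        simp only [Finset.coe_insert, Set.mem_insert_iff, Finset.mem_coe] at hx hy
        rcases hx with rfl | hx <;> rcases hy with rfl | hy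
        · exact hxy rfl
        · exact (hUv' _ hy).2 hadj
        · exact (hUv' _ hx).2 hadj.symm
        · exact hU hx hy hxy hadj
      · ext x
        simp only [Finset.mem_insert, Finset.mem_sdiff, SimpleGraph.mem_neighborFinset]
        constructor
        · tauto
        · intro hx
          have := hUv' x hx
          tauto
    · constructor
      · intro x hx y hy hxy hadj
        simp only [Finset.coe_union, Set.mem_union, Finset.mem_coe] at hx hy
        rcases hx with hx | hx <;> rcases hy with hy | hy
        · exact hU hx hy hxy hadj
        · exact (Finset.mem_filter.1 (hT hy)).2 _ hx hadj.symm
        · exact (Finset.mem_filter.1 (hT hx)).2 _ hy hadj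
        · have h1 := (Finset.mem_filter.1 (hT hx)).1
          have h2 := (Finset.mem_filter.1 (hT hy)).1
          rw [SimpleGraph.mem_neighborFinset] at h1 h2
          exact hH _ _ _ h1 h2 hadj
      · ext x
        simp only [Finset.mem_insert, Finset.mem_sdiff, SimpleGraph.mem_neighborFinset,
          Finset.mem_union]
        constructor
        · rintro ⟨h | h, h'⟩
          · exact h
          · have h1 := (Finset.mem_filter.1 (hT h)).1
            rw [SimpleGraph.mem_neighborFinset] at h1
            tauto
        · intro hx
          have := hUv' x hx
          tauto

open Classical in
/-- Local occupancy bound: over a uniformly random independent set `W` of a triangle-free graph,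
`D * ℙ(v ∈ W) + 𝔼 |N(v) ∩ W|` is at least `log D / 8`. -/
lemma log_mul_card_indep_le {V : Type*} [Fintype V] (H : SimpleGraph V) (hH : TriangleFree H)
    (v : V) {D : ℝ} (hD : 1 ≤ D) :
    Real.log D / 8 * (Finset.univ.filter fun W : Finset V => H.IsIndepSet (W : Set V)).card ≤
      ∑ W ∈ Finset.univ.filter fun W : Finset V => H.IsIndepSet (W : Set V),
        ((if v ∈ W then D else 0) + ((H.neighborFinset v ∩ W).card : ℝ)) := by
  set I := Finset.univ.filter fun W : Finset V => H.IsIndepSet (W : Set V) with hI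
  set φ : Finset V → Finset V := fun W => W \ insert v (H.neighborFinset v) with hφ
  have hmap : ∀ W ∈ I, φ W ∈ I.image φ := fun W hW => Finset.mem_image_of_mem _ hW
  have key : ∀ U ∈ I.image φ, Real.log D / 8 * ((I.filter fun W => φ W = U).card : ℝ) ≤
      ∑ W ∈ I.filter fun W => φ W = U,
        ((if v ∈ W then D else 0) + ((H.neighborFinset v ∩ W).card : ℝ)) := by
    intro U hU
    obtain ⟨W₀, hW₀, rfl⟩ := Finset.mem_image.1 hU
    have hind : H.IsIndepSet (φ W₀ : Set V) := by
      have h0 : H.IsIndepSet (W₀ : Set V) := (Finset.mem_filter.1 hW₀).2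
      exact h0.mono (by simp [hφ])
    have hdisj : Disjoint (φ W₀) (insert v (H.neighborFinset v)) := Finset.sdiff_disjoint
    generalize φ W₀ = U at hind hdisj
    have hUv' : ∀ u ∈ U, u ≠ v ∧ ¬ H.Adj v u := by
      intro u hu
      have := Finset.disjoint_left.1 hdisj hu
      simpa using this
    rw [hI, Finset.filter_filter, filter_indep_sdiff_eq H hH v U hind hdisj]
    set X := (H.neighborFinset v).filter fun x => ∀ u ∈ U, ¬ H.Adj x u with hX
    have hXv : ∀ x ∈ X, H.Adj v x := by
      intro x hx
      simpa using (Finset.mem_filter.1 hx).1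
    have hnot : insert v U ∉ X.powerset.image fun T => U ∪ T := by
      intro h
      obtain ⟨T, hT, hTU⟩ := Finset.mem_image.1 h
      have : v ∈ U ∪ T := by rw [hTU]; simp
      rcases Finset.mem_union.1 this with h | h
      · exact (hUv' _ h).1 rfl
      · exact (hXv _ (Finset.mem_powerset.1 hT h)).ne rfl
    have hUT : ∀ T ⊆ X, H.neighborFinset v ∩ (U ∪ T) = T := by
      intro T hT
      ext x
      simp only [Finset.mem_inter, SimpleGraph.mem_neighborFinset, Finset.mem_union]
      constructor
      · rintro ⟨h1, h2 | h2⟩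
        · exact absurd h1 (hUv' _ h2).2
        · exact h2
      · intro h; exact ⟨hXv _ (hT h), Or.inr h⟩
    have hinj : Set.InjOn (fun T => U ∪ T) (X.powerset : Set (Finset V)) := by
      intro T hT T' hT' h
      rw [← hUT T (by simpa using hT), ← hUT T' (by simpa using hT')]
      exact congrArg _ h
    rw [Finset.sum_insert hnot, Finset.card_insert_of_notMem hnot, Finset.sum_image hinj,
      Finset.card_image_of_injOn hinj, Finset.card_powerset]
    have h1 : ∑ T ∈ X.powerset, ((if v ∈ U ∪ T then D else 0) +
        ((H.neighborFinset v ∩ (U ∪ T)).card : ℝ)) = X.card * 2 ^ X.card / 2 := by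
      rw [eq_div_iff (by norm_num), mul_comm]
      have h2 := two_mul_sum_card_powerset X
      have h3 : (2 : ℝ) * ∑ T ∈ X.powerset, (T.card : ℝ) = X.card * 2 ^ X.card := by
        exact_mod_cast h2
      rw [← h3]
      congr 1
      refine Finset.sum_congr rfl fun T hT => ?_
      rw [hUT T (Finset.mem_powerset.1 hT), if_neg, zero_add]
      intro h
      rcases Finset.mem_union.1 h with h | h
      · exact (hUv' _ h).1 rfl
      · exact (hXv _ (Finset.mem_powerset.1 hT h)).ne rfl
    rw [h1, if_pos (Finset.mem_insert_self _ _)]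
    have h4 := log_div_mul_two_pow_add_one_le hD X.card
    have h5 : (0 : ℝ) ≤ (H.neighborFinset v ∩ insert v U).card := Nat.cast_nonneg _
    push_cast
    linarith
  calc Real.log D / 8 * (I.card : ℝ)
      = ∑ U ∈ I.image φ, Real.log D / 8 * ((I.filter fun W => φ W = U).card : ℝ) := by
        rw [← Finset.mul_sum, Finset.card_eq_sum_card_fiberwise (t := I.image φ) hmap]
        push_cast; rfl
    _ ≤ _ := Finset.sum_le_sum key
    _ = _ := Finset.sum_fiberwise_of_maps_to hmap _

open Classical in
/-- A triangle-free graph with maximum degree at most `D` has an independent set of size at least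
`n log D / (16 D)`. -/
lemma exists_indep_of_degree_le {V : Type*} [Fintype V] (H : SimpleGraph V) (hH : TriangleFree H)
    {D : ℝ} (hD : 1 ≤ D) (hdeg : ∀ v, (H.degree v : ℝ) ≤ D) :
    ∃ W : Finset V, H.IsIndepSet (W : Set V) ∧
      Fintype.card V * (Real.log D / 8) ≤ 2 * D * W.card := by
  set I := Finset.univ.filter fun W : Finset V => H.IsIndepSet (W : Set V) with hI
  have hne : I.Nonempty := ⟨∅, by simp [hI]⟩
  have key : ∑ W ∈ I, Fintype.card V * (Real.log D / 8) ≤ ∑ W ∈ I, 2 * D * (W.card : ℝ) := by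
    calc ∑ W ∈ I, Fintype.card V * (Real.log D / 8)
        = ∑ v : V, Real.log D / 8 * I.card := by
          simp only [Finset.sum_const, Finset.card_univ, nsmul_eq_mul]; ring
      _ ≤ ∑ v : V, ∑ W ∈ I, ((if v ∈ W then D else 0) + ((H.neighborFinset v ∩ W).card : ℝ)) :=
          Finset.sum_le_sum fun v _ => log_mul_card_indep_le H hH v hD
      _ = ∑ W ∈ I, ∑ v : V, ((if v ∈ W then D else 0) + ((H.neighborFinset v ∩ W).card : ℝ)) :=
          Finset.sum_comm
      _ ≤ _ := by
          refine Finset.sum_le_sum fun W _ => ?_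
          rw [Finset.sum_add_distrib]
          have h1 : ∑ v : V, (if v ∈ W then D else 0) = W.card * D := by simp
          have h2 : ∑ v : V, ((H.neighborFinset v ∩ W).card : ℝ) = ∑ w ∈ W, (H.degree w : ℝ) := by
            norm_cast
            have : ∀ v, (H.neighborFinset v ∩ W).card = ∑ w ∈ W, if H.Adj v w then 1 else 0 := by
              intro v
              rw [← Finset.card_filter]
              congr 1
              ext x; simp [and_comm]
            simp only [this]
            rw [Finset.sum_comm]
            refine Finset.sum_congr rfl fun w _ => ?_
            rw [← Finset.card_filter, ← SimpleGraph.card_neighborFinset_eq_degree]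
            congr 1
            ext x; simp [SimpleGraph.adj_comm]
          rw [h1, h2]
          have h3 : ∑ w ∈ W, (H.degree w : ℝ) ≤ ∑ w ∈ W, D := Finset.sum_le_sum fun w _ => hdeg w
          simp only [Finset.sum_const, nsmul_eq_mul] at h3
          linarith
  obtain ⟨W, hW, h⟩ := Finset.exists_le_of_sum_le hne key
  exact ⟨W, (Finset.mem_filter.1 hW).2, h⟩

open Classical in
/-- A triangle-free graph on `m ≥ 3` vertices has an independent set of size at least
`√(m log m) / 64`. -/
lemma exists_indep_of_triangleFree {V : Type*} [Fintype V] (H : SimpleGraph V)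
    (hH : TriangleFree H) (hm : 3 ≤ Fintype.card V) :
    ∃ W : Finset V, H.IsIndepSet (W : Set V) ∧
      √(Fintype.card V * Real.log (Fintype.card V)) / 64 ≤ W.card := by
  set m : ℝ := (Fintype.card V : ℝ) with hmdef
  have hm3 : (3 : ℝ) ≤ m := by rw [hmdef]; exact_mod_cast hm
  have hlog : 1 ≤ Real.log m := by
    rw [Real.le_log_iff_exp_le (by linarith)]
    linarith [Real.exp_one_lt_d9]
  set D := √(m * Real.log m) with hD
  have hDD : D * D = m * Real.log m := Real.mul_self_sqrt (by positivity)
  have hmD : √m ≤ D := Real.sqrt_le_sqrt (by nlinarith)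
  have hD1 : 1 ≤ D := by
    refine le_trans ?_ hmD
    rw [Real.one_le_sqrt]; linarith
  by_cases hdeg : ∀ v, (H.degree v : ℝ) ≤ D
  · obtain ⟨W, hW, h⟩ := exists_indep_of_degree_le H hH hD1 hdeg
    refine ⟨W, hW, ?_⟩
    have h1 : Real.log m / 2 ≤ Real.log D := by
      rw [← Real.log_sqrt (by linarith)]
      exact Real.log_le_log (Real.sqrt_pos.2 (by linarith)) hmD
    have h2 : m * (Real.log m / 2 / 8) ≤ 2 * D * W.card := by
      refine le_trans ?_ h
      gcongr
    have h3 : D * D ≤ 32 * W.card * D := by rw [hDD]; linarith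
    have h4 : D ≤ 32 * W.card := le_of_mul_le_mul_right h3 (by linarith)
    linarith [(Nat.cast_nonneg W.card : (0 : ℝ) ≤ W.card)]
  · push Not at hdeg
    obtain ⟨v, hv⟩ := hdeg
    refine ⟨H.neighborFinset v, ?_, ?_⟩
    · intro x hx y hy _ hadj
      simp only [SimpleGraph.coe_neighborFinset, SimpleGraph.mem_neighborSet] at hx hy
      exact hH _ _ _ hx hy hadj
    · rw [SimpleGraph.card_neighborFinset_eq_degree]
      linarith

open Classical in
/-- An independent set can be given one new colour. -/
lemma colorable_succ_of_indep {V : Type*} (H : SimpleGraph V) (W : Set V) (hW : H.IsIndepSet W)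
    (r : ℕ) (h : (H.induce Wᶜ).Colorable r) : H.Colorable (r + 1) := by
  obtain ⟨C⟩ := h
  refine ⟨SimpleGraph.Coloring.mk
    (fun v => if hv : v ∈ W then Fin.last r else (C ⟨v, hv⟩).castSucc) ?_⟩
  intro u v huv
  by_cases hu : u ∈ W <;> by_cases hv : v ∈ W
  · exact absurd huv (hW hu hv huv.ne)
  · simpa [hu, hv] using (Fin.castSucc_lt_last _).ne'
  · simp [hu, hv]
  · have : C ⟨u, hu⟩ ≠ C ⟨v, hv⟩ := C.valid (by simpa using huv)
    simpa [hu, hv] using this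

open Classical in
lemma colorable_of_triangleFree_aux (n : ℕ) (hn : 2 ≤ n) : ∀ (m : ℕ) (V : Type) [Fintype V]
    (H : SimpleGraph V), TriangleFree H → Fintype.card V = m → ∃ r : ℕ, H.Colorable r ∧
      (r : ℝ) ≤ √√n + 2 + 2 * (128 / √(Real.log n)) * √m := by
  intro m
  induction m using Nat.strong_induction_on with
  | _ m ih =>
  intro V _ H hH hcard
  have hn2 : (2 : ℝ) ≤ n := by exact_mod_cast hn
  have hL : 0 < Real.log n := Real.log_pos (by linarith)
  set a := √(Real.log n) / 128 with ha
  have ha0 : 0 < a := by positivity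
  have hinv : 128 / √(Real.log n) = a⁻¹ := by rw [ha, inv_div]
  rw [hinv] at ih ⊢
  have hpos : 0 ≤ 2 * a⁻¹ * √m := by positivity
  rcases le_or_gt (m : ℝ) (√√n + 2) with hsmall | hbig
  · refine ⟨m, ?_, by linarith⟩
    rw [← hcard]
    exact H.colorable_of_fintype
  · have hs0 : 0 ≤ √√(n : ℝ) := Real.sqrt_nonneg _
    have hm3 : 3 ≤ m := by
      have : (2 : ℝ) < m := by linarith
      exact_mod_cast this
    obtain ⟨W, hW, hcW⟩ := exists_indep_of_triangleFree H hH (hcard ▸ hm3)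
    rw [hcard] at hcW
    have hlogm : Real.log n / 4 ≤ Real.log m := by
      have h1 : Real.log (√√(n : ℝ)) = Real.log n / 4 := by
        rw [Real.log_sqrt (Real.sqrt_nonneg _), Real.log_sqrt (by linarith)]; ring
      rw [← h1]
      exact Real.log_le_log (Real.sqrt_pos.2 (Real.sqrt_pos.2 (by linarith))) (by linarith)
    have haW : a * √m ≤ W.card := by
      refine le_trans ?_ hcW
      have h2 : √((m : ℝ) * (Real.log n / 4)) ≤ √(m * Real.log m) := by
        apply Real.sqrt_le_sqrt; gcongr
      have h3 : √((m : ℝ) * (Real.log n / 4)) = √m * (√(Real.log n) / 2) := by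
        rw [Real.sqrt_mul (by positivity), Real.sqrt_div (by positivity)]
        congr 2
        rw [show (4 : ℝ) = 2 ^ 2 by norm_num]; exact Real.sqrt_sq (by norm_num)
      rw [h3] at h2
      rw [ha]; linarith
    have hmpos : (0 : ℝ) < m := by linarith
    have hsm : 0 < √(m : ℝ) := Real.sqrt_pos.2 hmpos
    have hmm : √(m : ℝ) * √m = m := Real.mul_self_sqrt hmpos.le
    have hWpos : 0 < W.card := by
      have : (0 : ℝ) < W.card := lt_of_lt_of_le (by positivity) haW
      exact_mod_cast this
    have hWm : W.card ≤ m := hcard ▸ W.card_le_univ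
    have hcompl : Fintype.card ((W : Set V)ᶜ : Set V) = m - W.card := by
      rw [Fintype.card_compl_set, hcard]; simp
    obtain ⟨r, hr, hrle⟩ := ih (m - W.card) (by omega) ((W : Set V)ᶜ : Set V)
      (H.induce (W : Set V)ᶜ) (fun x y z hxy hxz hyz => hH x y z hxy hxz hyz) hcompl
    refine ⟨r + 1, colorable_succ_of_indep H W hW r hr, ?_⟩
    have hWm' : (W.card : ℝ) ≤ m := by exact_mod_cast hWm
    have ham : a ≤ √m := by nlinarith
    have hsq : √((m - W.card : ℕ) : ℝ) ≤ √m - a / 2 := by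
      rw [Real.sqrt_le_left (by linarith)]
      rw [Nat.cast_sub hWm]
      nlinarith
    have h5 : 2 * a⁻¹ * √((m - W.card : ℕ) : ℝ) ≤ 2 * a⁻¹ * (√m - a / 2) := by gcongr
    have h6 : 2 * a⁻¹ * (√m - a / 2) = 2 * a⁻¹ * √m - 1 := by field_simp
    push_cast
    linarith

/-- The chromatic number of a triangle-free graph on `n ≥ 2` vertices is `O(√(n / log n))`. -/
lemma colorable_of_triangleFree {n : ℕ} (hn : 2 ≤ n) (H : SimpleGraph (Fin n))
    (hH : TriangleFree H) : ∃ r : ℕ, H.Colorable r ∧ (r : ℝ) ≤ 260 * √(n / Real.log n) := by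
  obtain ⟨r, hr, hle⟩ := colorable_of_triangleFree_aux n hn n (Fin n) H hH (by simp)
  refine ⟨r, hr, hle.trans ?_⟩
  have hn2 : (2 : ℝ) ≤ n := by exact_mod_cast hn
  have hL : 0 < Real.log n := Real.log_pos (by linarith)
  have h1 : 1 ≤ √(n / Real.log n) := by
    rw [Real.one_le_sqrt, le_div_iff₀ hL]
    linarith [Real.log_le_self (by linarith : (0 : ℝ) ≤ n)]
  have h2 : √√(n : ℝ) ≤ 2 * √(n / Real.log n) := by
    have h3 : √(n : ℝ) ≤ 4 * (n / Real.log n) := by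
      rw [← mul_div_assoc, le_div_iff₀ hL]
      have := log_le_two_mul_sqrt (by linarith : (0 : ℝ) ≤ n)
      have hs := Real.mul_self_sqrt (by linarith : (0 : ℝ) ≤ n)
      nlinarith [Real.sqrt_nonneg (n : ℝ)]
    have h4 : (2 : ℝ) = √4 := by
      rw [show (4 : ℝ) = 2 ^ 2 by norm_num]; exact (Real.sqrt_sq (by norm_num)).symm
    rw [h4, ← Real.sqrt_mul (by norm_num)]
    exact Real.sqrt_le_sqrt h3
  have h5 : 2 * (128 / √(Real.log n)) * √n = 256 * √(n / Real.log n) := by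
    rw [Real.sqrt_div (by positivity)]; ring
  linarith

open Classical in
/-- The minrank is at most the chromatic number of the complement. -/
lemma minrk_le_of_colorable_compl (F : Type*) [Field F] {V : Type*} [Fintype V]
    (G : SimpleGraph V) {r : ℕ} (h : Gᶜ.Colorable r) : minrk F G ≤ r := by
  obtain ⟨C⟩ := h
  let P : Matrix V (Fin r) F := Matrix.of fun v c => if C v = c then 1 else 0
  have hP : ∀ u v, (P * Pᵀ) u v = if C u = C v then 1 else 0 := by
    intro u v
    simp [P, Matrix.mul_apply, eq_comm]
  have hrep : Represents (P * Pᵀ) G := by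
    refine ⟨fun v => by simp [hP], fun u v huv hadj => ?_⟩
    have : C u ≠ C v := C.valid (by simp [huv, hadj])
    simp [hP, this]
  calc minrk F G ≤ (P * Pᵀ).rank := Nat.sInf_le ⟨_, hrep, rfl⟩
    _ ≤ P.rank := Matrix.rank_mul_le_left _ _
    _ ≤ r := by simpa using P.rank_le_card_width

open Classical in
lemma sum_eq_sum_range_card {ι : Type*} (J : Finset ι) (w : ι → ℕ) (T : ℕ)
    (hT : ∀ j ∈ J, w j ≤ T) :
    ∑ j ∈ J, w j = ∑ t ∈ Finset.range T, (J.filter fun j => t < w j).card := by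
  simp only [Finset.card_filter]
  rw [Finset.sum_comm]
  refine Finset.sum_congr rfl fun j hj => ?_
  rw [← Finset.card_filter]
  have : (Finset.range T).filter (fun t => t < w j) = Finset.range (w j) := by
    ext t
    simp only [Finset.mem_filter, Finset.mem_range]
    exact ⟨fun h => h.2, fun h => ⟨h.trans_le (hT j hj), h⟩⟩
  rw [this, Finset.card_range]

open Classical in
/-- A greedily chosen basis contains a basis of every lower level set of the weight. -/
lemma exists_greedy_basis {ι K E : Type*} [Field K] [AddCommGroup E] [Module K E]
    (v : ι → E) (A : Finset ι) (w : ι → ℕ) (T : ℕ) :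
    ∃ J : Finset ι, J ⊆ A.filter (fun j => w j < T) ∧ LinearIndepOn K v J ∧
      (v '' (A.filter fun j => w j < T : Finset ι) ⊆ Submodule.span K (v '' J)) ∧
      ∀ t ≤ T, Module.finrank K (Submodule.span K (v '' (A.filter fun j => w j < t : Finset ι))) ≤
        (J.filter fun j => w j < t).card := by
  induction T with
  | zero =>
    refine ⟨∅, by simp, by simp, by simp, ?_⟩
    intro t ht
    obtain rfl : t = 0 := by omega
    have : A.filter (fun j => w j < 0) = ∅ := by simp
    rw [this, Finset.coe_empty, Set.image_empty, Submodule.span_empty, finrank_bot]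
    exact Nat.zero_le _
  | succ T ih =>
    obtain ⟨J, hJ, hli, -, hcard⟩ := ih
    have hsub : (J : Set ι) ⊆ (A.filter fun j => w j < T + 1 : Finset ι) := by
      intro j hj
      have := Finset.mem_filter.1 (hJ hj)
      simp only [Finset.coe_filter, Set.mem_ofPred_eq]
      exact ⟨this.1, by omega⟩
    obtain ⟨b, hb, hJb, hspan, hbli⟩ := exists_linearIndepOn_extension hli hsub
    have hbfin : b.Finite := (Finset.finite_toSet _).subset hb
    lift b to Finset ι using hbfin
    have hbA : b ⊆ A.filter fun j => w j < T + 1 := by exact_mod_cast hb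
    refine ⟨b, hbA, hbli, hspan, ?_⟩
    intro t ht
    rcases Nat.lt_or_ge T t with h | h
    · obtain rfl : t = T + 1 := by omega
      have h1 : b.filter (fun j => w j < T + 1) = b :=
        Finset.filter_true_of_mem fun j hj => (Finset.mem_filter.1 (hbA hj)).2
      rw [h1]
      have h2 : Submodule.span K (v '' (A.filter fun j => w j < T + 1 : Finset ι)) ≤
          Submodule.span K (b.image v : Finset E) := by
        rw [Submodule.span_le, Finset.coe_image]; exact hspan
      calc _ ≤ Module.finrank K (Submodule.span K (b.image v : Finset E) : Submodule K E) :=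
            Submodule.finrank_mono h2
        _ ≤ (b.image v).card := finrank_span_finset_le_card _
        _ ≤ _ := Finset.card_image_le
    · refine (hcard t h).trans (Finset.card_le_card ?_)
      exact Finset.filter_subset_filter _ (by exact_mod_cast hJb)

open Classical in
/-- If every set `B` of vectors has rank at least `(k / #A) * #B`, then some basis has total weight
at most `k / #A` times the total weight of all vectors. -/
lemma exists_light_basis {ι K E : Type*} [Field K] [AddCommGroup E] [Module K E]
    (v : ι → E) (A : Finset ι) (w : ι → ℕ) (k : ℕ)
    (hk : Module.finrank K (Submodule.span K (v '' A)) ≤ k)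
    (h : ∀ B ⊆ A, k * B.card ≤ A.card * Module.finrank K (Submodule.span K (v '' B))) :
    ∃ J ⊆ A, v '' A ⊆ Submodule.span K (v '' J) ∧ A.card * ∑ j ∈ J, w j ≤ k * ∑ j ∈ A, w j := by
  set T := A.sup w + 1 with hT
  have hwT : ∀ j ∈ A, w j < T := fun j hj => Nat.lt_succ_of_le (Finset.le_sup hj)
  have hA : A.filter (fun j => w j < T) = A := Finset.filter_true_of_mem hwT
  obtain ⟨J, hJ, hli, hspan, hcard⟩ := exists_greedy_basis (K := K) v A w T
  rw [hA] at hJ hspan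
  refine ⟨J, hJ, hspan, ?_⟩
  have hJk : J.card ≤ k := by
    have : FiniteDimensional K (Submodule.span K (v '' A)) :=
      FiniteDimensional.span_of_finite K ((Finset.finite_toSet A).image v)
    refine le_trans (le_of_eq ?_) ((Submodule.finrank_mono (Submodule.span_mono
      (Set.image_mono (f := v) (by exact_mod_cast hJ : (J : Set ι) ⊆ A)))).trans hk)
    have := finrank_span_eq_card (R := K) (b := fun j : (J : Set ι) => v j) hli
    rw [← Set.image_eq_range] at this
    rw [this]; simp
  rw [sum_eq_sum_range_card J w T fun j hj => (hwT j (hJ hj)).le,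
    sum_eq_sum_range_card A w T fun j hj => (hwT j hj).le, Finset.mul_sum, Finset.mul_sum]
  refine Finset.sum_le_sum fun t ht => ?_
  have ht' : t + 1 ≤ T := Finset.mem_range.1 ht
  have h1 := hcard (t + 1) ht'
  have h2 := h (A.filter fun j => w j < t + 1) (Finset.filter_subset _ _)
  have split : ∀ s : Finset ι, (s.filter fun j => w j < t + 1).card +
      (s.filter fun j => t < w j).card = s.card := by
    intro s
    rw [← Finset.card_filter_add_card_filter_not (s := s) (fun j => w j < t + 1)]
    congr 2
    ext j; simp only [Finset.mem_filter]; constructor <;> rintro ⟨h, h'⟩ <;> exact ⟨h, by omega⟩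
  refine Nat.le_of_add_le_add_left (a := A.card * (J.filter fun j => w j < t + 1).card) ?_
  calc _ = A.card * J.card := by rw [← mul_add, split J]
    _ ≤ A.card * k := Nat.mul_le_mul_left _ hJk
    _ = k * (A.filter fun j => w j < t + 1).card + k * (A.filter fun j => t < w j).card := by
      rw [← mul_add, split A, mul_comm]
    _ ≤ _ := Nat.add_le_add_right (h2.trans (Nat.mul_le_mul_left _ h1)) _

open Classical in
/-- The matrix `M` with all entries outside the principal block `A × A` replaced by zero. -/
noncomputable def mask {V F : Type*} [Field F] (A : Finset V) (M : Matrix V V F) : Matrix V V F :=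
  Matrix.of fun i j => if i ∈ A ∧ j ∈ A then M i j else 0

open Classical in
/-- The number of nonzero entries of a vector. -/
noncomputable def nnz {V F : Type*} [Fintype V] [Field F] (x : V → F) : ℕ :=
  (Finset.univ.filter fun j => x j ≠ 0).card

lemma mask_mask {V F : Type*} [Field F] {A B : Finset V} (h : B ⊆ A) (M : Matrix V V F) :
    mask B (mask A M) = mask B M := by
  ext i j
  by_cases hi : i ∈ B <;> by_cases hj : j ∈ B <;> simp [mask, hi, hj]
  intro h1
  exact absurd (h hj) (h1 (h hi))

lemma transpose_mask {V F : Type*} [Field F] (A : Finset V) (M : Matrix V V F) : (mask A M)ᵀ = mask A Mᵀ := by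
  ext i j
  simp only [mask, Matrix.transpose_apply, Matrix.of_apply]
  congr 1
  exact propext and_comm

section Mask

variable {V F : Type*} [Fintype V] [Field F]

open Classical in
lemma mask_eq_diagonal_mul (A : Finset V) (M : Matrix V V F) :
    mask A M = diagonal (fun i => if i ∈ A then 1 else 0) * M *
      diagonal (fun i => if i ∈ A then 1 else 0) := by
  ext i j
  rw [Matrix.mul_diagonal, Matrix.diagonal_mul]
  by_cases hi : i ∈ A <;> by_cases hj : j ∈ A <;> simp [mask, hi, hj]

lemma rank_mask_le (A : Finset V) (M : Matrix V V F) : (mask A M).rank ≤ M.rank := by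
  classical
  rw [mask_eq_diagonal_mul]
  exact (Matrix.rank_mul_le_left _ _).trans (Matrix.rank_mul_le_right _ _)

open Classical in
/-- The rank of a principal block is at most the rank of the corresponding rows. -/
lemma rank_mask_le_finrank_span (B : Finset V) (N : Matrix V V F) :
    (mask B N).rank ≤ Module.finrank F (Submodule.span F (N.row '' B)) := by
  set P : Matrix V V F := diagonal (fun i => if i ∈ B then 1 else 0) * N with hP
  have h1 : (mask B N).rank ≤ P.rank := by
    rw [mask_eq_diagonal_mul]; exact Matrix.rank_mul_le_left _ _
  refine h1.trans ?_
  rw [Matrix.rank_eq_finrank_span_row]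
  apply Submodule.finrank_mono
  rw [Submodule.span_le]
  rintro _ ⟨i, rfl⟩
  by_cases hi : i ∈ B
  · have : P.row i = N.row i := by
      ext j; simp [hP, Matrix.diagonal_mul, hi]
    rw [this]
    exact Submodule.subset_span ⟨i, hi, rfl⟩
  · have : P.row i = 0 := by
      ext j; simp [hP, Matrix.diagonal_mul, hi]
    rw [this]
    exact Submodule.zero_mem _

open Classical in
/-- If row `i` of `N` vanishes on `B` but has nonzero diagonal entry, then the rank of `N` exceeds
that of its principal block on `B`. -/
lemma rank_mask_lt (B : Finset V) (N : Matrix V V F) (i : V) (hi : N i i ≠ 0)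
    (hB : ∀ j ∈ B, N i j = 0) : (mask B N).rank < N.rank := by
  have hiB : i ∉ B := fun h => hi (hB i h)
  set P := mask (insert i B) N with hP
  refine lt_of_lt_of_le ?_ (rank_mask_le (insert i B) N)
  rw [Matrix.rank_eq_finrank_span_row, Matrix.rank_eq_finrank_span_row]
  apply Submodule.finrank_lt_finrank_of_lt
  refine lt_of_le_of_ne ?_ ?_
  · rw [Submodule.span_le]
    rintro _ ⟨b, rfl⟩
    by_cases hb : b ∈ B
    · have : (mask B N).row b = (mask (insert i B) N).row b -
          (N b i / N i i) • (mask (insert i B) N).row i := by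
        ext j
        by_cases hj : j ∈ B
        · simp [mask, hb, hj, hB j hj]
        · by_cases hji : j = i
          · subst hji
            simp [mask, hb, hj, hi]
          · simp [mask, hj, hji]
      rw [this]
      exact Submodule.sub_mem _ (Submodule.subset_span ⟨b, rfl⟩)
        (Submodule.smul_mem _ _ (Submodule.subset_span ⟨i, rfl⟩))
    · have : (mask B N).row b = 0 := by
        ext j; simp [mask, hb]
      rw [this]
      exact Submodule.zero_mem _
  · intro heq
    have h1 : P.row i ∈ Submodule.span F (Set.range (mask B N).row) := by
      rw [heq]; exact Submodule.subset_span ⟨i, rfl⟩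
    have h2 : Submodule.span F (Set.range (mask B N).row) ≤
        LinearMap.ker (LinearMap.proj i : (V → F) →ₗ[F] F) := by
      rw [Submodule.span_le]
      rintro _ ⟨b, rfl⟩
      simp [mask, hiB]
    have h3 := h2 h1
    simp [hP, mask, hi] at h3

/-- A nonempty index set minimizing the ratio of the rank of the principal block to its size. -/
lemma exists_min_ratio [Nonempty V] (M : Matrix V V F) :
    ∃ A : Finset V, A.Nonempty ∧ (mask A M).rank * Fintype.card V ≤ M.rank * A.card ∧
      ∀ B ⊆ A, (mask A M).rank * B.card ≤ A.card * (mask B (mask A M)).rank := by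
  classical
  obtain ⟨A, hA, hmin⟩ := Finset.exists_min_image
    (Finset.univ.filter fun A : Finset V => A.Nonempty)
    (fun A => ((mask A M).rank : ℚ) / A.card)
    ⟨Finset.univ, by simp⟩
  have hA' : A.Nonempty := (Finset.mem_filter.1 hA).2
  have hpos : (0 : ℚ) < A.card := by exact_mod_cast hA'.card_pos
  have key : ∀ B : Finset V, (mask A M).rank * B.card ≤ A.card * (mask B M).rank := by
    intro B
    rcases B.eq_empty_or_nonempty with rfl | hB
    · simp
    · have h := hmin B (by simpa using hB)
      have hposB : (0 : ℚ) < B.card := by exact_mod_cast hB.card_pos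
      rw [div_le_div_iff₀ hpos hposB] at h
      rw [mul_comm A.card]
      exact_mod_cast h
  refine ⟨A, hA', ?_, fun B hB => ?_⟩
  · have h1 := key Finset.univ
    rw [Finset.card_univ] at h1
    refine h1.trans ?_
    rw [mul_comm]
    exact Nat.mul_le_mul_right _ (rank_mask_le _ _)
  · rw [mask_mask hB]; exact key B

open Classical in
lemma exists_light_rows (A : Finset V) (N : Matrix V V F)
    (hN : mask A N = N) (h : ∀ B ⊆ A, N.rank * B.card ≤ A.card * (mask B N).rank) :
    ∃ J : Finset V, (∀ i, N.row i ∈ Submodule.span F (N.row '' J)) ∧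
      A.card * ∑ i ∈ J, nnz (N i) ≤ N.rank * ∑ i, nnz (N i) := by
  obtain ⟨J, -, hspan, hle⟩ := exists_light_basis (K := F) N.row A (fun i => nnz (N i)) N.rank
    (by
      rw [Matrix.rank_eq_finrank_span_row]
      exact Submodule.finrank_mono (Submodule.span_mono (Set.image_subset_range _ _)))
    (fun B hB => (h B hB).trans (Nat.mul_le_mul_left _ (rank_mask_le_finrank_span B N)))
  refine ⟨J, fun i => ?_, hle.trans (Nat.mul_le_mul_left _ ?_)⟩
  · by_cases hi : i ∈ A
    · exact hspan ⟨i, hi, rfl⟩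
    · have : N.row i = 0 := by
        rw [← hN]; ext j; simp [mask, hi]
      rw [this]
      exact Submodule.zero_mem _
  · exact Finset.sum_le_sum_of_subset (Finset.subset_univ _)

open Classical in
lemma card_le_rank_mul_nnz (A : Finset V) (N : Matrix V V F)
    (hdiag : ∀ i ∈ A, N i i ≠ 0)
    (h : ∀ B ⊆ A, N.rank * B.card ≤ A.card * (mask B N).rank) (i : V) (hi : i ∈ A) :
    A.card ≤ N.rank * nnz (N i) := by
  set B := A.filter fun j => N i j = 0 with hB
  have h1 := h B (Finset.filter_subset _ _)
  have h2 : (mask B N).rank + 1 ≤ N.rank :=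
    rank_mask_lt B N i (hdiag i hi) fun j hj => (Finset.mem_filter.1 hj).2
  have h3 : A.card ≤ B.card + nnz (N i) := by
    rw [← Finset.card_filter_add_card_filter_not (s := A) fun j => N i j = 0]
    refine Nat.add_le_add_left (Finset.card_le_card ?_) _
    exact Finset.filter_subset_filter _ (Finset.subset_univ _)
  have h4 := Nat.mul_le_mul_left A.card h2
  have h5 := Nat.mul_le_mul_left N.rank h3
  nlinarith

end Mask

open Classical in
/-- The rows of `N` with index in `I`, with all other rows replaced by zero. -/
noncomputable def keepRows {V F : Type*} [Field F] (I : Finset V) (N : Matrix V V F) : V × V → F :=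
  fun p => if p.1 ∈ I then N p.1 p.2 else 0

lemma keepRows_apply_of_ne {V F : Type*} [Field F] {I : Finset V} {N : Matrix V V F} {p : V × V}
    (h : keepRows I N p ≠ 0) : p.1 ∈ I ∧ keepRows I N p = N p.1 p.2 := by
  classical
  by_cases hp : p.1 ∈ I
  · exact ⟨hp, by simp [keepRows, hp]⟩
  · exact absurd (by simp [keepRows, hp]) h

/-- If two matrices have the same kept rows, they agree on the nonzero kept rows. -/
lemma row_eq_of_keepRows_eq {V F : Type*} [Field F] {I I' : Finset V} {N N' : Matrix V V F}
    (h : keepRows I N = keepRows I' N') {i : V} (hi : i ∈ I) (hne : N.row i ≠ 0) :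
    i ∈ I' ∧ N.row i = N'.row i := by
  classical
  obtain ⟨j, hj⟩ := Function.ne_iff.1 hne
  have h1 : keepRows I N (i, j) ≠ 0 := by
    simpa [keepRows, hi] using hj
  have hi' : i ∈ I' := (keepRows_apply_of_ne (h ▸ h1)).1
  refine ⟨hi', ?_⟩
  ext l
  have := congrFun h (i, l)
  simpa [keepRows, hi, hi'] using this

section Light

variable {V F : Type*} [Fintype V] [Field F]

/-- The number of nonzero entries of a matrix. -/
noncomputable def totalNnz (N : Matrix V V F) : ℕ := ∑ i, nnz (N i)

/-- Some set of rows spans the row space and has at most a `k / #V` fraction of all nonzero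
entries. -/
def HasLightRows (k : ℕ) (N : Matrix V V F) : Prop :=
  ∃ J : Finset V, (∀ i, N.row i ∈ Submodule.span F (N.row '' J)) ∧
    Fintype.card V * ∑ i ∈ J, nnz (N i) ≤ k * totalNnz N

lemma totalNnz_transpose (N : Matrix V V F) : totalNnz Nᵀ = totalNnz N := by
  classical
  have h : ∀ M : Matrix V V F, totalNnz M = ∑ i, ∑ j, if M i j ≠ 0 then 1 else 0 := fun M =>
    Finset.sum_congr rfl fun i _ => Finset.card_filter _ _
  rw [h, h, Finset.sum_comm]
  rfl

open Classical in
/-- Every matrix of rank at most `k` with nonzero diagonal has a dense principal block whose row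
and column spaces both have light bases. -/
lemma exists_light_block [Nonempty V] (M : Matrix V V F) (hM : ∀ i, M i i ≠ 0) {k : ℕ}
    (hk : M.rank ≤ k) : ∃ N : Matrix V V F, (∀ i j, N i j ≠ 0 → M i j ≠ 0) ∧
      HasLightRows k N ∧ HasLightRows k Nᵀ ∧ Fintype.card V ≤ k * totalNnz N ∧
      Fintype.card V * (Finset.univ.filter fun i => N i i ≠ 0).card ≤ k * totalNnz N := by
  obtain ⟨A, hA, hratio, hmin⟩ := exists_min_ratio M
  set N := mask A M with hN
  have hNN : mask A N = N := mask_mask subset_rfl M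
  have hNA : ∀ i j, N i j ≠ 0 → i ∈ A ∧ j ∈ A := by
    intro i j h
    by_contra hc
    exact h (by simp only [hN, mask, Matrix.of_apply, if_neg hc])
  have hdiag : ∀ i ∈ A, N i i ≠ 0 := by
    intro i hi
    simpa [hN, mask, hi] using hM i
  have hApos : 0 < A.card := hA.card_pos
  have hratio' : N.rank * Fintype.card V ≤ k * A.card :=
    hratio.trans (Nat.mul_le_mul_right _ hk)
  have scale : ∀ x y : ℕ, A.card * x ≤ N.rank * y → Fintype.card V * x ≤ k * y := by
    intro x y h
    refine le_of_mul_le_mul_left ?_ hApos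
    calc A.card * (Fintype.card V * x) = Fintype.card V * (A.card * x) := by ring
      _ ≤ Fintype.card V * (N.rank * y) := Nat.mul_le_mul_left _ h
      _ = (N.rank * Fintype.card V) * y := by ring
      _ ≤ (k * A.card) * y := Nat.mul_le_mul_right _ hratio'
      _ = A.card * (k * y) := by ring
  have hsq : A.card * A.card ≤ N.rank * totalNnz N := by
    calc A.card * A.card = ∑ i ∈ A, A.card := by simp
      _ ≤ ∑ i ∈ A, N.rank * nnz (N i) :=
        Finset.sum_le_sum fun i hi => card_le_rank_mul_nnz A N hdiag hmin i hi
      _ = N.rank * ∑ i ∈ A, nnz (N i) := by rw [Finset.mul_sum]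
      _ ≤ _ := Nat.mul_le_mul_left _ (Finset.sum_le_sum_of_subset (Finset.subset_univ _))
  have hcardA := scale _ _ hsq
  refine ⟨N, fun i j h => ?_, ?_, ?_, ?_, ?_⟩
  · have := hNA i j h
    simpa [hN, mask, this] using h
  · obtain ⟨J, hJ, hle⟩ := exists_light_rows A N hNN hmin
    exact ⟨J, hJ, scale _ _ hle⟩
  · obtain ⟨J, hJ, hle⟩ := exists_light_rows A Nᵀ (by rw [← transpose_mask, hNN]) (by
      intro B hB
      rw [← transpose_mask, Matrix.rank_transpose, Matrix.rank_transpose]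
      exact hmin B hB)
    rw [Matrix.rank_transpose] at hle
    exact ⟨J, hJ, scale _ _ hle⟩
  · exact le_trans (Nat.le_mul_of_pos_right _ hApos) hcardA
  · refine le_trans (Nat.mul_le_mul_left _ (Finset.card_le_card ?_)) hcardA
    intro i hi
    exact (hNA i i (Finset.mem_filter.1 hi).2).1

open Classical in
lemma card_nnz_le [Fintype F] [Nonempty V] (l : ℕ) :
    (Finset.univ.filter fun f : V → F => nnz f ≤ l).card ≤
      (Fintype.card V * Fintype.card F) ^ l := by
  induction l with
  | zero =>
    rw [pow_zero, Finset.card_le_one]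
    have hz : ∀ f ∈ Finset.univ.filter (fun f : V → F => nnz f ≤ 0), f = 0 := by
      intro f hf
      have h : nnz f ≤ 0 := (Finset.mem_filter.1 hf).2
      rw [nonpos_iff_eq_zero, nnz, Finset.card_eq_zero, Finset.filter_eq_empty_iff] at h
      ext x
      simpa using h (Finset.mem_univ x)
    intro f hf g hg
    rw [hz f hf, hz g hg]
  | succ l ih =>
    have hsub : (Finset.univ.filter fun f : V → F => nnz f ≤ l + 1) ⊆
        ((Finset.univ.filter fun f : V → F => nnz f ≤ l) ×ˢ (Finset.univ : Finset (V × F))).image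
          fun p => Function.update p.1 p.2.1 p.2.2 := by
      intro f hf
      have hf' : nnz f ≤ l + 1 := (Finset.mem_filter.1 hf).2
      have key : ∃ x, nnz (Function.update f x 0) ≤ l := by
        by_cases h0 : ∃ x, f x ≠ 0
        · obtain ⟨x, hx⟩ := h0
          refine ⟨x, Nat.le_of_lt_succ (lt_of_lt_of_le (Finset.card_lt_card ?_) hf')⟩
          refine Finset.ssubset_iff_of_subset ?_ |>.2 ⟨x, by simpa using hx, by simp⟩
          intro y hy
          have hy' := (Finset.mem_filter.1 hy).2
          by_cases hyx : y = x
          · subst hyx; simp at hy'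
          · simpa [hyx] using hy'
        · push Not at h0
          refine ⟨Classical.arbitrary V, ?_⟩
          have : Function.update f (Classical.arbitrary V) 0 = f := by
            ext y; by_cases hy : y = Classical.arbitrary V <;> simp [Function.update_apply, h0]
          rw [this]
          simp [nnz, h0]
      obtain ⟨x, hx⟩ := key
      exact Finset.mem_image.2 ⟨(Function.update f x 0, x, f x), by simpa using hx, by simp⟩
    calc _ ≤ _ := Finset.card_le_card hsub
      _ ≤ _ := Finset.card_image_le
      _ = (Finset.univ.filter fun f : V → F => nnz f ≤ l).card *
          (Fintype.card V * Fintype.card F) := by simp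
      _ ≤ _ := by rw [pow_succ]; exact Nat.mul_le_mul_right _ ih

/-- A matrix is determined by spanning sets of rows and columns. -/
lemma eq_of_span_rows_cols {N N' : Matrix V V F} {I J : Finset V}
    (hI : ∀ i, N.row i ∈ Submodule.span F (N.row '' I))
    (hJ : ∀ j, N'ᵀ.row j ∈ Submodule.span F (N'ᵀ.row '' J))
    (hrow : ∀ i ∈ I, N.row i = N'.row i) (hcol : ∀ j ∈ J, Nᵀ.row j = N'ᵀ.row j) : N = N' := by
  classical
  have himg : N.row '' I = N'.row '' I := Set.image_congr hrow
  have hvanish : ∀ z ∈ Submodule.span F (Set.range N'.row), (∀ j ∈ J, z j = 0) → z = 0 := by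
    intro z hz hzJ
    obtain ⟨y, rfl⟩ := (Submodule.mem_span_range_iff_exists_fun F).1 hz
    have hval : ∀ j, (∑ i, y i • N'.row i) j = y ⬝ᵥ N'ᵀ.row j := by
      intro j
      simp [dotProduct, Finset.sum_apply]
    have hle : Submodule.span F (N'ᵀ.row '' J) ≤ LinearMap.ker (dotProductBilin F F y) := by
      rw [Submodule.span_le]
      rintro _ ⟨j, hj, rfl⟩
      have := hzJ j hj
      rw [hval] at this
      simpa using this
    ext j
    have := hle (hJ j)
    rw [hval]
    simpa using this
  ext i j
  have h1 : N.row i ∈ Submodule.span F (Set.range N'.row) := by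
    have := hI i
    rw [himg] at this
    exact Submodule.span_mono (Set.image_subset_range _ _) this
  have h2 := hvanish (N.row i - N'.row i)
    (Submodule.sub_mem _ h1 (Submodule.subset_span ⟨i, rfl⟩)) (by
      intro j hj
      have := congrFun (hcol j hj) i
      simpa [sub_eq_zero] using this)
  exact congrFun (sub_eq_zero.1 h2) j

lemma nnz_keepRows (I : Finset V) (N : Matrix V V F) :
    nnz (keepRows I N) = ∑ i ∈ I, nnz (N i) := by
  classical
  simp only [nnz, Finset.card_filter]
  rw [Fintype.sum_prod_type, ← Finset.sum_subset (Finset.subset_univ I)]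
  · refine Finset.sum_congr rfl fun i hi => ?_
    simp [keepRows, hi]
  · intro i _ hi
    simp [keepRows, hi]

lemma span_filter_ne_zero (I : Finset V) (N : Matrix V V F) [DecidablePred fun i => N.row i ≠ 0] :
    Submodule.span F (N.row '' I) =
      Submodule.span F (N.row '' (I.filter fun i => N.row i ≠ 0 : Finset V)) := by
  apply le_antisymm
  · rw [Submodule.span_le]
    rintro _ ⟨i, hi, rfl⟩
    by_cases h : N.row i = 0
    · rw [h]; exact Submodule.zero_mem _
    · exact Submodule.subset_span ⟨i, by simpa [h] using hi, rfl⟩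
  · exact Submodule.span_mono (Set.image_mono (Finset.coe_subset.2 (Finset.filter_subset _ _)))

open Classical in
/-- There are few matrices with `s` nonzero entries and light row and column bases. -/
lemma card_light_le [Fintype F] [Nonempty V] (k s : ℕ) :
    (Finset.univ.filter fun N : Matrix V V F =>
      (HasLightRows k N ∧ HasLightRows k Nᵀ) ∧ totalNnz N = s).card ≤
      ((Fintype.card V * Fintype.card V * Fintype.card F) ^ (k * s / Fintype.card V)) ^ 2 := by
  set l := k * s / Fintype.card V with hl
  set S := Finset.univ.filter fun f : V × V → F => nnz f ≤ l with hS
  have hcardS : S.card ≤ (Fintype.card V * Fintype.card V * Fintype.card F) ^ l := by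
    have := card_nnz_le (V := V × V) (F := F) l
    rw [Fintype.card_prod] at this
    convert this
  let c : Matrix V V F → V × V → F := fun N =>
    if h : HasLightRows k N then keepRows h.choose N else 0
  have hc : ∀ N, HasLightRows k N → totalNnz N = s → c N ∈ S := by
    intro N h hs
    rw [hS, Finset.mem_filter]
    refine ⟨Finset.mem_univ _, ?_⟩
    simp only [c, dif_pos h]
    rw [nnz_keepRows, hl, Nat.le_div_iff_mul_le Fintype.card_pos, ← hs, mul_comm]
    exact h.choose_spec.2
  calc _ ≤ (S ×ˢ S).card := by
        refine Finset.card_le_card_of_injOn (fun N => (c N, c Nᵀ)) ?_ ?_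
        · intro N hN
          obtain ⟨-, ⟨h1, h2⟩, h3⟩ := Finset.mem_filter.1 hN
          exact Finset.mem_product.2 ⟨hc N h1 h3, hc Nᵀ h2 (by rw [totalNnz_transpose, h3])⟩
        · intro N hN N' hN' heq
          obtain ⟨-, ⟨h1, h2⟩, -⟩ := Finset.mem_filter.1 hN
          obtain ⟨-, ⟨h1', h2'⟩, -⟩ := Finset.mem_filter.1 hN'
          obtain ⟨e1, e2⟩ := Prod.mk.inj heq
          simp only [c, dif_pos h1, dif_pos h1'] at e1
          simp only [c, dif_pos h2, dif_pos h2'] at e2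
          have hI := h1.choose_spec.1
          have hJ := h2'.choose_spec.1
          rw [span_filter_ne_zero] at hI hJ
          refine eq_of_span_rows_cols hI hJ ?_ ?_
          · intro i hi
            obtain ⟨hi1, hi2⟩ := Finset.mem_filter.1 hi
            exact (row_eq_of_keepRows_eq e1 hi1 hi2).2
          · intro j hj
            obtain ⟨hj1, hj2⟩ := Finset.mem_filter.1 hj
            exact (row_eq_of_keepRows_eq e2.symm hj1 hj2).2.symm
    _ = S.card ^ 2 := by rw [Finset.card_product, sq]
    _ ≤ _ := Nat.pow_le_pow_left hcardS 2

end Light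

section RandomFunctions

variable {α : Type*} [Fintype α] [DecidableEq α]

/-- The number of functions to `Fin (M + 1)` vanishing on `U` and nowhere zero on `R`. -/
lemma card_vanish_on (M : ℕ) (U R : Finset α) (hUR : Disjoint U R) :
    ((Finset.univ.filter fun ω : α → Fin (M + 1) =>
      (∀ e ∈ U, ω e = 0) ∧ ∀ e ∈ R, ω e ≠ 0).card : ℝ) =
    ((M : ℝ) + 1) ^ Fintype.card α * (1 / ((M : ℝ) + 1)) ^ U.card *
      ((M : ℝ) / ((M : ℝ) + 1)) ^ R.card := by
  have hset : (Finset.univ.filter fun ω : α → Fin (M + 1) =>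
      (∀ e ∈ U, ω e = 0) ∧ ∀ e ∈ R, ω e ≠ 0) =
      Fintype.piFinset fun e => if e ∈ U then {0} else if e ∈ R then {0}ᶜ else Finset.univ := by
    ext ω
    simp only [Finset.mem_filter, Finset.mem_univ, true_and, Fintype.mem_piFinset]
    constructor
    · rintro ⟨h1, h2⟩ e
      by_cases hU : e ∈ U
      · simp [hU, h1 e hU]
      · by_cases hR : e ∈ R
        · simp [hU, hR, h2 e hR]
        · simp [hU, hR]
    · intro h
      refine ⟨fun e he => ?_, fun e he => ?_⟩
      · simpa [he] using h e
      · simpa [he, Finset.disjoint_right.1 hUR he] using h e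
  have hterm : ∀ e : α, (((if e ∈ U then {0} else if e ∈ R then {0}ᶜ else
      Finset.univ : Finset (Fin (M + 1))).card : ℕ) : ℝ) =
      ((M : ℝ) + 1) * (if e ∈ U then 1 / ((M : ℝ) + 1) else 1) *
        (if e ∈ R then (M : ℝ) / ((M : ℝ) + 1) else 1) := by
    intro e
    have hM : (M : ℝ) + 1 ≠ 0 := by positivity
    by_cases hU : e ∈ U
    · simp [hU, Finset.disjoint_left.1 hUR hU, hM]
    · by_cases hR : e ∈ R
      · simp [hU, hR, Finset.card_compl]
        field_simp
      · simp [hU, hR]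
  rw [hset, Fintype.card_piFinset, Nat.cast_prod, Finset.prod_congr rfl fun e _ => hterm e,
    Finset.prod_mul_distrib, Finset.prod_mul_distrib]
  simp [div_pow]

/-- The functions whose zeros inside `S` are covered by a disjoint family of sets of zeros. -/
def CoveredBy {M : ℕ} (T : Finset (Finset α)) (S : Finset α) (ω : α → Fin (M + 1)) : Prop :=
  ∃ P ⊆ T, (P : Set (Finset α)).PairwiseDisjoint id ∧ (∀ t ∈ P, ∀ e ∈ t, ω e = 0) ∧
    ∀ e ∈ S, ω e = 0 → ∃ t ∈ P, e ∈ t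

open Classical in
lemma card_coveredBy_le (M : ℕ) (hM : 1 ≤ M) (T : Finset (Finset α)) (hT : ∀ t ∈ T, t.card = 3)
    (S : Finset α) :
    ((Finset.univ.filter fun ω : α → Fin (M + 1) => CoveredBy T S ω).card : ℝ) ≤
      ((M : ℝ) + 1) ^ Fintype.card α * ((M : ℝ) / ((M : ℝ) + 1)) ^ S.card *
        ((1 / (M : ℝ)) ^ 3 + 1) ^ (T.filter fun t => ¬ Disjoint t S).card := by
  have hM0 : (0 : ℝ) < M := by exact_mod_cast hM
  set TS := T.filter fun t => ¬ Disjoint t S with hTS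
  set Q := TS.powerset.filter fun P : Finset (Finset α) => (P : Set (Finset α)).PairwiseDisjoint id with hQ
  let B : Finset (Finset α) → Finset (α → Fin (M + 1)) := fun P =>
    Finset.univ.filter fun ω : α → Fin (M + 1) =>
      (∀ e ∈ P.biUnion id, ω e = 0) ∧ ∀ e ∈ S \ P.biUnion id, ω e ≠ 0
  have hsub : (Finset.univ.filter fun ω : α → Fin (M + 1) => CoveredBy T S ω) ⊆ Q.biUnion B := by
    intro ω hω
    obtain ⟨P, hPT, hPd, hP0, hPS⟩ := (Finset.mem_filter.1 hω).2
    refine Finset.mem_biUnion.2 ⟨P.filter fun t => ¬ Disjoint t S, ?_, ?_⟩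
    · rw [hQ, Finset.mem_filter, Finset.mem_powerset]
      exact ⟨Finset.filter_subset_filter _ hPT, hPd.subset (by
        exact_mod_cast Finset.filter_subset _ _)⟩
    · simp only [B, Finset.mem_filter, Finset.mem_univ, true_and]
      constructor
      · intro e he
        obtain ⟨t, ht, het⟩ := Finset.mem_biUnion.1 he
        exact hP0 t (Finset.mem_filter.1 ht).1 e het
      · intro e he h0
        obtain ⟨heS, hne⟩ := Finset.mem_sdiff.1 he
        obtain ⟨t, ht, het⟩ := hPS e heS h0
        exact hne (Finset.mem_biUnion.2 ⟨t, Finset.mem_filter.2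
          ⟨ht, Finset.not_disjoint_iff.2 ⟨e, het, heS⟩⟩, het⟩)
  set q : ℝ := (M : ℝ) / ((M : ℝ) + 1) with hq
  have hq0 : 0 < q := by positivity
  have hq1 : q ≤ 1 := by rw [hq, div_le_one (by positivity)]; linarith
  have hB : ∀ P ∈ Q, ((B P).card : ℝ) ≤
      ((M : ℝ) + 1) ^ Fintype.card α * q ^ S.card * ((1 / (M : ℝ)) ^ 3) ^ P.card := by
    intro P hP
    obtain ⟨hPT, hPd⟩ := Finset.mem_filter.1 hP
    rw [Finset.mem_powerset] at hPT
    have hU : (P.biUnion id).card = 3 * P.card := by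
      rw [Finset.card_biUnion hPd]
      exact (Finset.sum_const_nat fun t ht =>
        hT t (Finset.mem_filter.1 (hPT ht)).1).trans (mul_comm _ _)
    have hS : S.card ≤ (S \ P.biUnion id).card + 3 * P.card := by
      rw [← hU]
      have := Finset.le_card_sdiff (P.biUnion id) S
      omega
    simp only [B]
    rw [card_vanish_on M _ _ Finset.disjoint_sdiff, hU]
    have h1 : (1 / ((M : ℝ) + 1)) = q * (1 / M) := by rw [hq]; field_simp
    rw [h1, mul_pow, ← pow_mul]
    have h2 : q ^ (3 * P.card) * q ^ (S \ P.biUnion id).card ≤ q ^ S.card := by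
      rw [← pow_add, add_comm]
      exact pow_le_pow_of_le_one hq0.le hq1 hS
    calc _ = ((M : ℝ) + 1) ^ Fintype.card α *
          (q ^ (3 * P.card) * q ^ (S \ P.biUnion id).card) * (1 / (M : ℝ)) ^ (3 * P.card) := by ring
      _ ≤ _ := by gcongr
  calc _ ≤ ((Q.biUnion B).card : ℝ) := by exact_mod_cast Finset.card_le_card hsub
    _ ≤ ∑ P ∈ Q, ((B P).card : ℝ) := by exact_mod_cast Finset.card_biUnion_le
    _ ≤ ∑ P ∈ Q, ((M : ℝ) + 1) ^ Fintype.card α * q ^ S.card * ((1 / (M : ℝ)) ^ 3) ^ P.card :=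
      Finset.sum_le_sum hB
    _ ≤ ∑ P ∈ TS.powerset,
        ((M : ℝ) + 1) ^ Fintype.card α * q ^ S.card * ((1 / (M : ℝ)) ^ 3) ^ P.card :=
      Finset.sum_le_sum_of_subset_of_nonneg (Finset.filter_subset _ _) fun _ _ _ => by positivity
    _ = _ := by
      rw [← Finset.mul_sum, ← Finset.sum_pow_mul_eq_add_pow]
      simp

open Classical in
lemma card_coveredBy_le_exp {M n : ℕ} (hM : 1 ≤ M) (T : Finset (Finset α))
    (hT : ∀ t ∈ T, t.card = 3) (S : Finset α)
    (hTS : (T.filter fun t => ¬ Disjoint t S).card ≤ S.card * n)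
    (hMn : (n : ℝ) * (1 / (M : ℝ)) ^ 3 ≤ 1 / (2 * ((M : ℝ) + 1))) :
    ((Finset.univ.filter fun ω : α → Fin (M + 1) => CoveredBy T S ω).card : ℝ) ≤
      ((M : ℝ) + 1) ^ Fintype.card α * Real.exp (-(S.card / (2 * ((M : ℝ) + 1)))) := by
  refine (card_coveredBy_le M hM T hT S).trans ?_
  rw [mul_assoc]
  refine mul_le_mul_of_nonneg_left ?_ (by positivity)
  have hM1 : (0 : ℝ) < (M : ℝ) + 1 := by positivity
  have h1 : ((M : ℝ) / ((M : ℝ) + 1)) ^ S.card ≤ Real.exp (-(S.card / ((M : ℝ) + 1))) := by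
    have : (M : ℝ) / ((M : ℝ) + 1) ≤ Real.exp (-(1 / ((M : ℝ) + 1))) := by
      refine le_trans (le_of_eq ?_) (Real.add_one_le_exp _)
      field_simp; ring
    refine (pow_le_pow_left₀ (by positivity) this _).trans (le_of_eq ?_)
    rw [← Real.exp_nat_mul]; congr 1; ring
  have h2 : ((1 / (M : ℝ)) ^ 3 + 1) ^ (T.filter fun t => ¬ Disjoint t S).card ≤
      Real.exp (S.card / (2 * ((M : ℝ) + 1))) := by
    calc _ ≤ Real.exp ((1 / (M : ℝ)) ^ 3) ^ (T.filter fun t => ¬ Disjoint t S).card :=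
          pow_le_pow_left₀ (by positivity) (Real.add_one_le_exp _) _
      _ = Real.exp ((T.filter fun t => ¬ Disjoint t S).card * (1 / (M : ℝ)) ^ 3) := by
          rw [← Real.exp_nat_mul]
      _ ≤ Real.exp (S.card * n * (1 / (M : ℝ)) ^ 3) := by
          gcongr; exact_mod_cast hTS
      _ ≤ _ := by
          rw [Real.exp_le_exp, mul_assoc]
          refine (mul_le_mul_of_nonneg_left hMn (by positivity)).trans (le_of_eq ?_)
          ring
  refine (mul_le_mul h1 h2 (by positivity) (by positivity)).trans (le_of_eq ?_)
  rw [← Real.exp_add]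
  congr 1
  field_simp; ring

end RandomFunctions

open Classical in
/-- The edge sets of triangles on `V`. -/
noncomputable def triangles (V : Type*) [Fintype V] : Finset (Finset (Sym2 V)) :=
  Finset.univ.filter fun t => ∃ a b c, a ≠ b ∧ a ≠ c ∧ b ≠ c ∧ t = {s(a, b), s(a, c), s(b, c)}

open Classical in
lemma card_of_mem_triangles {V : Type*} [Fintype V] {t : Finset (Sym2 V)} (ht : t ∈ triangles V) :
    t.card = 3 := by
  obtain ⟨a, b, c, hab, hac, hbc, rfl⟩ := (Finset.mem_filter.1 ht).2
  rw [Finset.card_eq_three]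
  refine ⟨_, _, _, ?_, ?_, ?_, rfl⟩ <;> simp <;> tauto

open Classical in
lemma card_triangles_meeting_le {V : Type*} [Fintype V] (S : Finset (Sym2 V)) :
    ((triangles V).filter fun t => ¬ Disjoint t S).card ≤ S.card * Fintype.card V := by
  have hsub : ((triangles V).filter fun t => ¬ Disjoint t S) ⊆
      (S ×ˢ (Finset.univ : Finset V)).image fun p =>
        insert p.1 (Finset.univ.filter fun f : Sym2 V => ∃ x ∈ p.1, f = s(x, p.2)) := by
    intro t ht
    obtain ⟨ht1, ht2⟩ := Finset.mem_filter.1 ht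
    obtain ⟨a, b, c, hab, hac, hbc, rfl⟩ := (Finset.mem_filter.1 ht1).2
    obtain ⟨e, he, heS⟩ := Finset.not_disjoint_iff.1 ht2
    simp only [Finset.mem_insert, Finset.mem_singleton] at he
    rcases he with rfl | rfl | rfl
    · refine Finset.mem_image.2 ⟨(_, c), Finset.mem_product.2 ⟨heS, Finset.mem_univ _⟩, ?_⟩
      ext f
      simp
    · refine Finset.mem_image.2 ⟨(_, b), Finset.mem_product.2 ⟨heS, Finset.mem_univ _⟩, ?_⟩
      ext f
      simp only [Finset.mem_insert, Finset.mem_filter, Finset.mem_univ, true_and, Sym2.mem_iff,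
        exists_eq_or_imp, exists_eq_left, Finset.mem_singleton]
      rw [Sym2.eq_swap (a := c)]
      tauto
    · refine Finset.mem_image.2 ⟨(_, a), Finset.mem_product.2 ⟨heS, Finset.mem_univ _⟩, ?_⟩
      ext f
      simp only [Finset.mem_insert, Finset.mem_filter, Finset.mem_univ, true_and, Sym2.mem_iff,
        exists_eq_or_imp, exists_eq_left, Finset.mem_singleton]
      rw [Sym2.eq_swap (a := b) (b := a), Sym2.eq_swap (a := c) (b := a)]
      tauto
  refine (Finset.card_le_card hsub).trans (Finset.card_image_le.trans (le_of_eq ?_))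
  simp

open Classical in
/-- Deleting the edges of a maximal edge-disjoint family of triangles from the graph of zeros of
`ω` leaves a triangle-free graph. -/
lemma exists_triangleFree_of_not_coveredBy {V : Type*} [Fintype V] {M : ℕ}
    (ω : Sym2 V → Fin (M + 1)) : ∃ H : SimpleGraph V, TriangleFree H ∧
      ∀ S : Finset (Sym2 V), (∀ e ∈ S, ¬ e.IsDiag) → ¬ CoveredBy (triangles V) S ω →
        ∃ u v, s(u, v) ∈ S ∧ H.Adj u v := by
  obtain ⟨P, hP, hmax⟩ := Finset.exists_max_image
    ((triangles V).powerset.filter fun P : Finset (Finset (Sym2 V)) =>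
      (P : Set (Finset (Sym2 V))).PairwiseDisjoint id ∧
      ∀ t ∈ P, ∀ e ∈ t, ω e = 0) Finset.card ⟨∅, by simp⟩
  obtain ⟨hPT, hPd, hP0⟩ := Finset.mem_filter.1 hP
  rw [Finset.mem_powerset] at hPT
  let H : SimpleGraph V :=
    { Adj := fun u v => u ≠ v ∧ ω s(u, v) = 0 ∧ ∀ t ∈ P, s(u, v) ∉ t
      symm := ⟨fun u v h => by rw [Sym2.eq_swap]; exact ⟨h.1.symm, h.2⟩⟩
      loopless := ⟨fun u h => h.1 rfl⟩ }
  refine ⟨H, ?_, ?_⟩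
  · intro a b c hab hac hbc
    set t : Finset (Sym2 V) := {s(a, b), s(a, c), s(b, c)} with ht
    have hmem : ∀ e ∈ t, ω e = 0 ∧ ∀ t' ∈ P, e ∉ t' := by
      intro e he
      simp only [ht, Finset.mem_insert, Finset.mem_singleton] at he
      rcases he with rfl | rfl | rfl
      · exact hab.2
      · exact hac.2
      · exact hbc.2
    have htP : t ∉ P := fun h =>
      (hmem s(a, b) (by simp [ht])).2 t h (by simp [ht])
    have h1 := hmax (insert t P) (by
      rw [Finset.mem_filter, Finset.mem_powerset]
      refine ⟨?_, ?_, ?_⟩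
      · intro t' ht'
        rcases Finset.mem_insert.1 ht' with rfl | h
        · exact Finset.mem_filter.2 ⟨Finset.mem_univ _, a, b, c, hab.1, hac.1, hbc.1, rfl⟩
        · exact hPT h
      · rw [Finset.coe_insert]
        refine hPd.insert fun t' ht' _ => ?_
        exact Finset.disjoint_left.2 fun e he he' => (hmem e he).2 t' ht' he'
      · intro t' ht' e he
        rcases Finset.mem_insert.1 ht' with rfl | h
        · exact (hmem e he).1
        · exact hP0 t' h e he)
    rw [Finset.card_insert_of_notMem htP] at h1
    omega
  · intro S hS hcov
    by_contra hcon
    push Not at hcon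
    refine hcov ⟨P, hPT, hPd, hP0, fun e he h0 => ?_⟩
    induction e using Sym2.ind with
    | _ u v =>
      by_contra hne
      push Not at hne
      exact hcon u v he ⟨by simpa using hS _ he, h0, hne⟩

section OffDiagonal

variable {V F : Type*} [Fintype V] [Field F]

open Classical in
/-- The pairs of distinct indices carrying a nonzero entry of `N`. -/
noncomputable def offSupport (N : Matrix V V F) : Finset (Sym2 V) :=
  (Finset.univ.filter fun p : V × V => p.1 ≠ p.2 ∧ N p.1 p.2 ≠ 0).image fun p => s(p.1, p.2)

lemma not_isDiag_of_mem_offSupport {N : Matrix V V F} {e : Sym2 V} (he : e ∈ offSupport N) :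
    ¬ e.IsDiag := by
  classical
  obtain ⟨p, hp, rfl⟩ := Finset.mem_image.1 he
  simpa using (Finset.mem_filter.1 hp).2.1

lemma ne_zero_of_mem_offSupport {N : Matrix V V F} {u v : V} (h : s(u, v) ∈ offSupport N) :
    N u v ≠ 0 ∨ N v u ≠ 0 := by
  classical
  obtain ⟨p, hp, hpe⟩ := Finset.mem_image.1 h
  have hne := (Finset.mem_filter.1 hp).2.2
  rcases Sym2.eq_iff.1 hpe with ⟨h1, h2⟩ | ⟨h1, h2⟩
  · exact Or.inl (h1 ▸ h2 ▸ hne)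
  · exact Or.inr (h1 ▸ h2 ▸ hne)

open Classical in
lemma totalNnz_eq_card (N : Matrix V V F) :
    totalNnz N = (Finset.univ.filter fun p : V × V => N p.1 p.2 ≠ 0).card := by
  rw [Finset.card_filter, ← Finset.univ_product_univ, Finset.sum_product]
  exact Finset.sum_congr rfl fun i _ => Finset.card_filter _ _

lemma totalNnz_le_card_sq (N : Matrix V V F) :
    totalNnz N ≤ Fintype.card V * Fintype.card V := by
  classical
  rw [totalNnz_eq_card, ← Fintype.card_prod]
  exact Finset.card_le_univ _

open Classical in
lemma totalNnz_le_diag_add_offSupport (N : Matrix V V F) :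
    totalNnz N ≤ (Finset.univ.filter fun i => N i i ≠ 0).card + 2 * (offSupport N).card := by
  rw [totalNnz_eq_card]
  set O := Finset.univ.filter fun p : V × V => p.1 ≠ p.2 ∧ N p.1 p.2 ≠ 0 with hO
  have hsub : (Finset.univ.filter fun p : V × V => N p.1 p.2 ≠ 0) ⊆
      ((Finset.univ.filter fun i => N i i ≠ 0).image fun i => (i, i)) ∪ O := by
    rintro ⟨i, j⟩ hp
    have hp' : N i j ≠ 0 := (Finset.mem_filter.1 hp).2
    by_cases hij : i = j
    · subst hij
      exact Finset.mem_union_left _ (Finset.mem_image_of_mem _ (by simpa using hp'))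
    · exact Finset.mem_union_right _ (by simp [hO, hij, hp'])
  have hOle : O.card ≤ 2 * (offSupport N).card := by
    refine Finset.card_le_mul_card_image O 2 fun e _ => ?_
    induction e using Sym2.ind with
    | _ a b =>
      refine (Finset.card_le_card (t := {(a, b), (b, a)}) ?_).trans Finset.card_le_two
      rintro ⟨i, j⟩ hp
      have := (Finset.mem_filter.1 hp).2
      rcases Sym2.eq_iff.1 this with ⟨rfl, rfl⟩ | ⟨rfl, rfl⟩ <;> simp
  refine (Finset.card_le_card hsub).trans ((Finset.card_union_le _ _).trans ?_)
  exact add_le_add Finset.card_image_le hOle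

open Classical in
/-- If the diagonal carries at most a `k / #V` fraction of the nonzero entries, a quarter of the
nonzero entries is seen by the off-diagonal support. -/
lemma totalNnz_le_four_mul_offSupport {N : Matrix V V F} {k : ℕ} (hk : 1 ≤ k)
    (hkV : 2 * k ≤ Fintype.card V)
    (hN : Fintype.card V * (Finset.univ.filter fun i => N i i ≠ 0).card ≤ k * totalNnz N) :
    totalNnz N ≤ 4 * (offSupport N).card := by
  have h1 := totalNnz_le_diag_add_offSupport N
  have h2 : k * (2 * (Finset.univ.filter fun i => N i i ≠ 0).card) ≤ k * totalNnz N := by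
    refine le_trans ?_ hN
    rw [← mul_assoc, mul_comm k 2]
    exact Nat.mul_le_mul_right _ hkV
  have h3 := Nat.le_of_mul_le_mul_left h2 hk
  omega

end OffDiagonal

open Classical in
/-- There is a triangle-free graph whose edges meet the off-diagonal support of every matrix of
rank at most `k` with nonzero diagonal. -/
lemma exists_triangleFree_meeting_low_rank {V F : Type*} [Fintype V] [Field F] [Fintype F]
    {k M : ℕ} (hk : 1 ≤ k) (hM : 1 ≤ M) (hkV : 2 * k ≤ Fintype.card V)
    (hlog : 32 * k * ((M : ℝ) + 1) *
      Real.log ((Fintype.card V * Fintype.card V * Fintype.card F : ℕ) : ℝ) ≤ Fintype.card V)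
    (hMn : (Fintype.card V : ℝ) * (1 / (M : ℝ)) ^ 3 ≤ 1 / (2 * ((M : ℝ) + 1))) :
    ∃ H : SimpleGraph V, TriangleFree H ∧ ∀ A : Matrix V V F, (∀ i, A i i ≠ 0) → A.rank ≤ k →
      ∃ u v, H.Adj u v ∧ A u v ≠ 0 := by
  set n := Fintype.card V with hn
  have hn1 : 2 ≤ n := by omega
  have : Nonempty V := Fintype.card_pos_iff.1 (by omega)
  set W := n * n * Fintype.card F with hW
  have hF : 2 ≤ Fintype.card F := Fintype.one_lt_card
  have hWn : 2 * (n * n) ≤ W := by rw [hW, mul_comm 2]; exact Nat.mul_le_mul_left _ hF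
  have hn0 : (0 : ℝ) < n := by exact_mod_cast (by omega : 0 < n)
  have hk0 : (0 : ℝ) < k := by exact_mod_cast hk
  have hW0 : (0 : ℝ) < W := by
    have : 0 < n * n := by positivity
    exact_mod_cast (by omega : 0 < W)
  have hm0 : (0 : ℝ) < (M : ℝ) + 1 := by positivity
  let L : Finset (Matrix V V F) := Finset.univ.filter fun N =>
    (HasLightRows k N ∧ HasLightRows k Nᵀ) ∧ n ≤ k * totalNnz N ∧
      n * (Finset.univ.filter fun i => N i i ≠ 0).card ≤ k * totalNnz N
  let bad : Matrix V V F → Finset (Sym2 V → Fin (M + 1)) := fun N =>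
    Finset.univ.filter fun ω => CoveredBy (triangles V) (offSupport N) ω
  set E : ℝ := ((M : ℝ) + 1) ^ Fintype.card (Sym2 V) with hE
  have hE0 : 0 < E := by positivity
  have hbad : ∀ N ∈ L, ((bad N).card : ℝ) ≤
      E * Real.exp (-(totalNnz N / (8 * ((M : ℝ) + 1)))) := by
    intro N hN
    have h4 := totalNnz_le_four_mul_offSupport hk hkV (Finset.mem_filter.1 hN).2.2.2
    have h4' : (totalNnz N : ℝ) ≤ 4 * (offSupport N).card := by exact_mod_cast h4
    have h := card_coveredBy_le_exp hM (triangles V) (fun t => card_of_mem_triangles)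
      (offSupport N) (card_triangles_meeting_le _) hMn
    refine le_trans (by convert h) (mul_le_mul_of_nonneg_left (Real.exp_le_exp.2 ?_) hE0.le)
    rw [neg_le_neg_iff, div_le_div_iff₀ (by positivity) (by positivity)]
    nlinarith
  have hfib : ∀ s ∈ Finset.range (n * n + 1),
      ∑ N ∈ L with totalNnz N = s, ((bad N).card : ℝ) ≤ E * (1 / (W : ℝ) ^ 2) := by
    intro s _
    rcases Finset.eq_empty_or_nonempty (L.filter fun N => totalNnz N = s) with h0 | ⟨N₀, hN₀⟩
    · rw [h0, Finset.sum_empty]; positivity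
    obtain ⟨hN₀L, hN₀s⟩ := Finset.mem_filter.1 hN₀
    have hns : n ≤ k * s := hN₀s ▸ (Finset.mem_filter.1 hN₀L).2.2.1
    have hns' : (n : ℝ) ≤ k * s := by exact_mod_cast hns
    have hcard : ((L.filter fun N => totalNnz N = s).card : ℝ) ≤
        Real.exp (s / (16 * ((M : ℝ) + 1))) := by
      have h1 : (L.filter fun N => totalNnz N = s).card ≤ (W ^ (k * s / n)) ^ 2 := by
        refine le_trans (Finset.card_le_card ?_) (card_light_le (V := V) (F := F) k s)
        intro N hN
        obtain ⟨hNL, hNs⟩ := Finset.mem_filter.1 hN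
        exact Finset.mem_filter.2 ⟨Finset.mem_univ _, (Finset.mem_filter.1 hNL).2.1, hNs⟩
      have h2 : (((W ^ (k * s / n)) ^ 2 : ℕ) : ℝ) =
          Real.exp (((k * s / n : ℕ) : ℝ) * 2 * Real.log W) := by
        rw [← pow_mul, Nat.cast_pow, ← Real.exp_log hW0, ← Real.exp_nat_mul, Real.log_exp]
        push_cast
        rfl
      have hl0 : 0 ≤ Real.log W := Real.log_natCast_nonneg W
      have h3 : ((k * s / n : ℕ) : ℝ) ≤ k * s / n := by
        have := @Nat.cast_div_le ℝ _ _ _ (k * s) n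
        push_cast at this
        exact this
      calc _ ≤ (((W ^ (k * s / n)) ^ 2 : ℕ) : ℝ) := by exact_mod_cast h1
        _ = _ := h2
        _ ≤ _ := by
          rw [Real.exp_le_exp]
          calc _ ≤ (k * s / n : ℝ) * 2 * Real.log W := by gcongr
            _ = s / (16 * ((M : ℝ) + 1)) * (32 * k * ((M : ℝ) + 1) * Real.log W / n) := by
              field_simp; ring
            _ ≤ s / (16 * ((M : ℝ) + 1)) * 1 := by
              gcongr
              rw [div_le_one hn0]
              exact hlog
            _ = _ := mul_one _
    calc _ ≤ ∑ N ∈ L with totalNnz N = s, E * Real.exp (-(s / (8 * ((M : ℝ) + 1)))) := by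
          refine Finset.sum_le_sum fun N hN => ?_
          obtain ⟨hNL, hNs⟩ := Finset.mem_filter.1 hN
          exact hNs ▸ hbad N hNL
      _ = ((L.filter fun N => totalNnz N = s).card : ℝ) *
            (E * Real.exp (-(s / (8 * ((M : ℝ) + 1))))) := by
          rw [Finset.sum_const, nsmul_eq_mul]
      _ ≤ Real.exp (s / (16 * ((M : ℝ) + 1))) *
            (E * Real.exp (-(s / (8 * ((M : ℝ) + 1))))) := by gcongr
      _ = E * Real.exp (-(s / (16 * ((M : ℝ) + 1)))) := by
          rw [mul_left_comm, ← Real.exp_add]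
          congr 2
          field_simp; ring
      _ ≤ E * Real.exp (-((2 : ℕ) * Real.log W)) := by
          gcongr
          rw [le_div_iff₀ (by positivity)]
          push_cast
          refine le_of_mul_le_mul_left ?_ hk0
          calc _ = 32 * k * ((M : ℝ) + 1) * Real.log W := by ring
            _ ≤ _ := hlog.trans hns'
      _ = _ := by rw [Real.exp_neg, Real.exp_nat_mul, Real.exp_log hW0, one_div]
  have htotal : ((L.biUnion bad).card : ℝ) < E := by
    calc _ ≤ ∑ N ∈ L, ((bad N).card : ℝ) := by exact_mod_cast Finset.card_biUnion_le
      _ = ∑ s ∈ Finset.range (n * n + 1), ∑ N ∈ L with totalNnz N = s, ((bad N).card : ℝ) :=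
        (Finset.sum_fiberwise_of_maps_to (fun N _ => Finset.mem_range.2
          (Nat.lt_succ_of_le (totalNnz_le_card_sq N))) _).symm
      _ ≤ ∑ s ∈ Finset.range (n * n + 1), E * (1 / (W : ℝ) ^ 2) := Finset.sum_le_sum hfib
      _ = E * (((n : ℝ) * n + 1) / (W : ℝ) ^ 2) := by
        rw [Finset.sum_const, Finset.card_range, nsmul_eq_mul]
        push_cast
        ring
      _ < E * 1 := by
        refine mul_lt_mul_of_pos_left ?_ hE0
        rw [div_lt_one (by positivity)]
        have : n * n + 1 < W ^ 2 :=
          lt_of_lt_of_le (by nlinarith) (Nat.le_self_pow two_ne_zero W)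
        exact_mod_cast this
      _ = E := mul_one E
  obtain ⟨ω, hω⟩ : ∃ ω, ω ∉ L.biUnion bad := by
    by_contra hcon
    push Not at hcon
    rw [Finset.eq_univ_iff_forall.2 hcon, Finset.card_univ, Fintype.card_fun,
      Fintype.card_fin, hE] at htotal
    push_cast at htotal
    exact lt_irrefl _ htotal
  obtain ⟨H, hH, hHS⟩ := exists_triangleFree_of_not_coveredBy ω
  refine ⟨H, hH, fun A hA hrank => ?_⟩
  obtain ⟨N, hNA, hN1, hN2, hN3, hN4⟩ := exists_light_block A hA hrank
  have hNL : N ∈ L := Finset.mem_filter.2 ⟨Finset.mem_univ _, ⟨hN1, hN2⟩, hN3, hN4⟩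
  obtain ⟨u, v, huv, hadj⟩ := hHS (offSupport N) (fun e => not_isDiag_of_mem_offSupport)
    fun h => hω (Finset.mem_biUnion.2 ⟨N, hNL, Finset.mem_filter.2 ⟨Finset.mem_univ _, h⟩⟩)
  rcases ne_zero_of_mem_offSupport huv with h | h
  · exact ⟨u, v, hadj, hNA _ _ h⟩
  · exact ⟨v, u, hadj.symm, hNA _ _ h⟩

lemma lt_minrk {F V : Type*} [Field F] [Fintype V] {G : SimpleGraph V} {k : ℕ}
    (h : ∀ A : Matrix V V F, Represents A G → k < A.rank) : k < minrk F G := by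
  classical
  have hne : {r : ℕ | ∃ M : Matrix V V F, Represents M G ∧ M.rank = r}.Nonempty :=
    ⟨_, 1, ⟨fun v => by simp, fun u v huv _ => Matrix.one_apply_ne huv⟩, rfl⟩
  obtain ⟨A, hA, hr⟩ := Nat.sInf_mem hne
  exact (h A hA).trans_eq hr

lemma not_containsCopy_triangle_iff {V : Type*} {H : SimpleGraph V} :
    ¬ ContainsCopy (⊤ : SimpleGraph (Fin 3)) H ↔ TriangleFree H := by
  constructor
  · intro h a b c hab hac hbc
    refine h ⟨![a, b, c], ?_, ?_⟩
    · intro i j hij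
      fin_cases i <;> fin_cases j <;>
        simp_all [hab.ne, hac.ne, hbc.ne, hab.ne', hac.ne', hbc.ne']
    · intro i j hij
      fin_cases i <;> fin_cases j <;> simp_all [hab.symm, hac.symm, hbc.symm]
  · rintro h ⟨f, -, hf⟩
    exact h (f 0) (f 1) (f 2) (hf _ _ (by simp)) (hf _ _ (by simp)) (hf _ _ (by simp))

lemma one_le_log_mul {n q : ℕ} (hn : 2 ≤ n) (hq : 2 ≤ q) : 1 ≤ Real.log ((n : ℝ) * q) := by
  have h : (4 : ℝ) ≤ (n : ℝ) * q := by exact_mod_cast Nat.mul_le_mul hn hq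
  rw [Real.le_log_iff_exp_le (by linarith)]
  linarith [Real.exp_one_lt_d9]

/-- A triangle-free graph whose complement has minrank of order `√n / log (n * #F)`. -/
lemma exists_triangleFree_minrk_compl_ge (F : Type*) [Field F] [Fintype F] {n : ℕ} (hn : 2 ≤ n) :
    ∃ H : SimpleGraph (Fin n), TriangleFree H ∧
      1 / 320 * √n / Real.log ((n : ℝ) * Fintype.card F) ≤ (minrk F Hᶜ : ℝ) := by
  have hF : 2 ≤ Fintype.card F := Fintype.one_lt_card
  set l := Real.log ((n : ℝ) * Fintype.card F) with hl
  have hl1 : 1 ≤ l := one_le_log_mul hn hF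
  set x := 1 / 320 * √n / l with hx
  have hx0 : 0 ≤ x := by positivity
  have hn0 : (0 : ℝ) < n := by exact_mod_cast (by omega : 0 < n)
  suffices h : ∃ H : SimpleGraph (Fin n), TriangleFree H ∧ ⌊x⌋₊ < minrk F Hᶜ by
    obtain ⟨H, hH, hlt⟩ := h
    refine ⟨H, hH, (Nat.lt_floor_add_one x).le.trans ?_⟩
    exact_mod_cast hlt
  rcases Nat.eq_zero_or_pos ⌊x⌋₊ with h0 | hk
  · refine ⟨⊥, fun a b c h => h.elim, ?_⟩
    rw [h0]
    refine lt_minrk fun A hA => Nat.pos_of_ne_zero fun hr => ?_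
    rw [Matrix.rank, Submodule.finrank_eq_zero, LinearMap.range_eq_bot] at hr
    refine hA.1 ⟨0, by omega⟩ ?_
    simpa using congrFun (LinearMap.congr_fun hr (Pi.single ⟨0, by omega⟩ 1)) ⟨0, by omega⟩
  · set k := ⌊x⌋₊ with hkdef
    have hkx : (k : ℝ) ≤ x := Nat.floor_le hx0
    have hk1 : (1 : ℝ) ≤ k := by exact_mod_cast hk
    have hkl : 320 * (k * l) ≤ √n := by
      rw [hx, le_div_iff₀ (by linarith)] at hkx
      linarith
    have hkk : (k : ℝ) ≤ k * l := le_mul_of_one_le_right (by linarith) hl1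
    have hsq : √n * √n = (n : ℝ) := Real.mul_self_sqrt hn0.le
    set M := ⌈4 * √n⌉₊ with hM
    have hM1 : 4 * √n ≤ M := Nat.le_ceil _
    have hM2 : (M : ℝ) < 4 * √n + 1 := Nat.ceil_lt_add_one (by positivity)
    have hM0 : (1 : ℝ) ≤ M := by linarith
    obtain ⟨H, hH, hmeet⟩ := exists_triangleFree_meeting_low_rank (V := Fin n) (F := F) (k := k)
      (M := M) hk (by exact_mod_cast hM0)
      (by
        rw [Fintype.card_fin]
        have : 2 * (k : ℝ) ≤ n := by nlinarith
        exact_mod_cast this)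
      (by
        rw [Fintype.card_fin]
        have hlog : Real.log ((n * n * Fintype.card F : ℕ) : ℝ) ≤ 2 * l := by
          have hF0 : (0 : ℝ) < Fintype.card F := by exact_mod_cast (by omega : 0 < Fintype.card F)
          have hF1 : (1 : ℝ) ≤ Fintype.card F := by exact_mod_cast (by omega : 1 ≤ Fintype.card F)
          have h2 : 2 * l = Real.log (((n : ℝ) * Fintype.card F) ^ 2) := by
            rw [Real.log_pow]; push_cast; rfl
          rw [h2]
          refine Real.log_le_log (by push_cast; positivity) ?_
          push_cast
          calc (n : ℝ) * n * Fintype.card F = n * n * Fintype.card F * 1 := (mul_one _).symm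
            _ ≤ n * n * Fintype.card F * Fintype.card F := by gcongr
            _ = _ := by ring
        calc 32 * (k : ℝ) * ((M : ℝ) + 1) * Real.log ((n * n * Fintype.card F : ℕ) : ℝ)
            ≤ 32 * (k : ℝ) * (5 * √n) * (2 * l) := by
              gcongr
              linarith
          _ = 320 * (k * l) * √n := by ring
          _ ≤ √n * √n := by gcongr
          _ = n := hsq)
      (by
        rw [Fintype.card_fin, _root_.one_div_pow, mul_one_div, div_le_div_iff₀ (by positivity)
          (by positivity)]
        have h1 : 16 * (n : ℝ) ≤ (M : ℝ) ^ 2 := by nlinarith [Real.sqrt_nonneg (n : ℝ)]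
        calc (n : ℝ) * (2 * ((M : ℝ) + 1)) ≤ n * (16 * M) :=
              mul_le_mul_of_nonneg_left (by linarith) hn0.le
          _ = 16 * n * M := by ring
          _ ≤ (M : ℝ) ^ 2 * M := by gcongr
          _ = 1 * (M : ℝ) ^ 3 := by ring)
    refine ⟨H, hH, lt_minrk fun A hA => ?_⟩
    by_contra hle
    obtain ⟨u, v, huv, hne⟩ := hmeet A hA.1 (not_lt.1 hle)
    exact hne (hA.2 u v huv.ne fun h => (H.compl_adj u v).1 h |>.2 huv)

/-- There are constants c₁, c₂ > 0 such that for every n ≥ 2 and finite field F: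
(i) some n-vertex graph G with triangle-free complement has minrk_F(G) ≥ c₁·√n / log(n·|F|);
(ii) every n-vertex graph G with triangle-free complement has minrk_F(G) ≤ c₂·√(n / log n). -/
theorem minrk_compl_triangle_free_bounds :
    ∃ c₁ c₂ : ℝ, 0 < c₁ ∧ 0 < c₂ ∧ ∀ n : ℕ, 2 ≤ n → ∀ (F : Type) [Field F] [Fintype F],
      (∃ G : SimpleGraph (Fin n), ¬ ContainsCopy (⊤ : SimpleGraph (Fin 3)) Gᶜ ∧
        c₁ * Real.sqrt n / Real.log ((n : ℝ) * (Fintype.card F : ℝ)) ≤ (minrk F G : ℝ)) ∧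
      (∀ G : SimpleGraph (Fin n), ¬ ContainsCopy (⊤ : SimpleGraph (Fin 3)) Gᶜ →
        (minrk F G : ℝ) ≤ c₂ * Real.sqrt ((n : ℝ) / Real.log n)) := by
  refine ⟨1 / 320, 260, by norm_num, by norm_num, fun n hn F _ _ => ⟨?_, fun G hG => ?_⟩⟩
  · obtain ⟨H, hH, hle⟩ := exists_triangleFree_minrk_compl_ge F hn
    exact ⟨Hᶜ, by rwa [compl_compl, not_containsCopy_triangle_iff], hle⟩
  · obtain ⟨r, hr, hle⟩ := colorable_of_triangleFree hn Gᶜ (not_containsCopy_triangle_iff.1 hG)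
    refine le_trans ?_ hle
    exact_mod_cast minrk_le_of_colorable_compl F G hr
end

section
/- Let F be a field and let M ∈ F^{n×n} be a matrix of rank k whose diagonal entries are all nonzero. Then the number of nonzero entries of M is at least n²/(4k). -/
open Matrix

/-- The sparsity of a matrix: the number of its nonzero entries. -/
noncomputable def sparsity {F : Type*} [Zero F] {m n : Type*} (M : Matrix m n F) : ℕ :=
  {p : m × n | M p.1 p.2 ≠ 0}.ncard

open Classical in
/-- A greedy, one-sided Caro–Wei bound: choosing rows of minimal support one after another yields
many rows of a principal submatrix with nonzero diagonal that are linearly independent. -/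
theorem exists_independent_rows_of_diag_ne_zero {F ι : Type*} [Field F]
    (M : Matrix ι ι F) (hdiag : ∀ i, M i i ≠ 0) (S : Finset ι) :
    ∃ T ⊆ S, ∑ i ∈ S, ((S.filter fun j ↦ M i j ≠ 0).card : ℝ)⁻¹ ≤ T.card ∧
      ∀ c : ι → F, (∀ j ∈ S, ∑ i ∈ T, c i * M i j = 0) → ∀ i ∈ T, c i = 0 := by
  induction S using Finset.strongInduction with
  | H S ih =>
    obtain rfl | hS := S.eq_empty_or_nonempty
    · exact ⟨∅, by simp⟩
    obtain ⟨v, hv, hmin⟩ := S.exists_min_image (fun i ↦ (S.filter fun j ↦ M i j ≠ 0).card) hS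
    set N := S.filter fun j ↦ M v j ≠ 0 with hN
    have hNS : N ⊆ S := Finset.filter_subset _ _
    have hvN : v ∈ N := by simp [hN, hv, hdiag]
    obtain ⟨T, hTS, hcard, hT⟩ := ih (S \ N) (Finset.sdiff_ssubset hNS ⟨v, hvN⟩)
    have hvT : v ∉ T := fun h ↦ (Finset.mem_sdiff.mp (hTS h)).2 hvN
    refine ⟨insert v T, Finset.insert_subset hv (hTS.trans Finset.sdiff_subset), ?_, ?_⟩
    · have hNpos : (0 : ℝ) < N.card := by exact_mod_cast Finset.card_pos.mpr ⟨v, hvN⟩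
      have hlost : ∑ i ∈ N, ((S.filter fun j ↦ M i j ≠ 0).card : ℝ)⁻¹ ≤ 1 := by
        calc ∑ i ∈ N, ((S.filter fun j ↦ M i j ≠ 0).card : ℝ)⁻¹
            ≤ ∑ i ∈ N, (N.card : ℝ)⁻¹ := Finset.sum_le_sum fun i hi ↦
              inv_anti₀ hNpos (by exact_mod_cast hmin i (hNS hi))
          _ = 1 := by simp [hNpos.ne']
      have hkept : ∑ i ∈ S \ N, ((S.filter fun j ↦ M i j ≠ 0).card : ℝ)⁻¹ ≤
          ∑ i ∈ S \ N, (((S \ N).filter fun j ↦ M i j ≠ 0).card : ℝ)⁻¹ := by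
        refine Finset.sum_le_sum fun i hi ↦ inv_anti₀ ?_ ?_
        · exact_mod_cast Finset.card_pos.mpr ⟨i, Finset.mem_filter.mpr ⟨hi, hdiag i⟩⟩
        · exact_mod_cast Finset.card_le_card
            (Finset.filter_subset_filter _ Finset.sdiff_subset)
      rw [Finset.card_insert_of_notMem hvT, ← Finset.sum_sdiff hNS]
      push_cast
      linarith
    · intro c hc
      have hcT : ∀ i ∈ T, c i = 0 := hT c fun j hj ↦ by
        obtain ⟨hjS, hjN⟩ := Finset.mem_sdiff.mp hj
        have hvj : M v j = 0 := by
          by_contra h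
          exact hjN (Finset.mem_filter.mpr ⟨hjS, h⟩)
        simpa [Finset.sum_insert hvT, hvj] using hc j hjS
      have hcv := hc v hv
      rw [Finset.sum_insert hvT, Finset.sum_eq_zero fun i hi ↦ by rw [hcT i hi, zero_mul],
        add_zero] at hcv
      intro i hi
      obtain rfl | hi := Finset.mem_insert.mp hi
      · exact (mul_eq_zero.mp hcv).resolve_right (hdiag _)
      · exact hcT i hi

theorem card_le_rank_of_independent_rows {F ι κ : Type*} [Field F] [Fintype ι] [Fintype κ]
    (M : Matrix ι κ F) (T : Finset ι)
    (hT : ∀ c : ι → F, (∀ j, ∑ i ∈ T, c i * M i j = 0) → ∀ i ∈ T, c i = 0) :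
    T.card ≤ M.rank := by
  have hli : LinearIndepOn F M.row (T : Set ι) := by
    rw [linearIndepOn_finset_iff]
    refine fun c hc ↦ hT c fun j ↦ ?_
    simpa [Finset.sum_apply] using congrFun hc j
  rw [M.rank_eq_finrank_span_row, ← Fintype.card_coe T,
    ← finrank_span_eq_card (R := F) (b := fun i : T ↦ M.row i) hli]
  exact Submodule.finrank_mono (Submodule.span_mono (by rintro _ ⟨i, rfl⟩; exact ⟨i, rfl⟩))

open Classical in
theorem sparsity_eq_sum_card {F m n : Type*} [Zero F] [Fintype m] [Fintype n]
    (M : Matrix m n F) :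
    sparsity M = ∑ i, (Finset.univ.filter fun j ↦ M i j ≠ 0).card := by
  have h : {p : m × n | M p.1 p.2 ≠ 0} =
      ((Finset.univ.filter fun p : m × n ↦ M p.1 p.2 ≠ 0 : Finset (m × n)) : Set (m × n)) := by
    ext; simp
  rw [sparsity, h, Set.ncard_coe_finset]
  simp only [Finset.card_filter, Fintype.sum_prod_type]

/-- If M ∈ F^{n×n} has rank k and all diagonal entries nonzero, then M has at
least n²/(4k) nonzero entries. -/
theorem sparsity_ge_of_diag_ne_zero {F : Type*} [Field F] {n : ℕ}
    (M : Matrix (Fin n) (Fin n) F) (hdiag : ∀ i, M i i ≠ 0) :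
    ((n : ℝ) ^ 2) / (4 * (M.rank : ℝ)) ≤ (sparsity M : ℝ) := by
  classical
  obtain ⟨T, -, hsum, hT⟩ := exists_independent_rows_of_diag_ne_zero M hdiag Finset.univ
  have hrank : (T.card : ℝ) ≤ M.rank := by
    exact_mod_cast card_le_rank_of_independent_rows M T fun c hc ↦ hT c fun j _ ↦ hc j
  set r : Fin n → ℝ := fun i ↦ (Finset.univ.filter fun j ↦ M i j ≠ 0).card
  have hrpos : ∀ i, 0 < r i := fun i ↦
    Nat.cast_pos.mpr (Finset.card_pos.mpr ⟨i, by simp [hdiag]⟩)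
  have hs : (sparsity M : ℝ) = ∑ i, r i := by
    rw [sparsity_eq_sum_card, Nat.cast_sum]
  have hcs : (n : ℝ) ^ 2 ≤ (∑ i, (r i)⁻¹) * ∑ i, r i := by
    have := Finset.sum_sq_le_sum_mul_sum_of_sq_le_mul Finset.univ (r := fun _ ↦ (1 : ℝ))
      (f := fun i ↦ (r i)⁻¹) (g := r) (fun i _ ↦ (inv_pos.mpr (hrpos i)).le)
      (fun i _ ↦ (hrpos i).le) (fun i _ ↦ by simp [(hrpos i).ne'])
    simpa using this
  have hbound : (n : ℝ) ^ 2 ≤ M.rank * sparsity M :=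
    hcs.trans (hs ▸ mul_le_mul_of_nonneg_right (hsum.trans hrank) (by positivity))
  refine div_le_of_le_mul₀ (by positivity) (by positivity) ?_
  have : (0 : ℝ) ≤ M.rank * sparsity M := by positivity
  linarith
end

section
/- Let F be a finite field and let n, k, ℓ be positive integers. The number of matrices M ∈ F^{n×n} of rank k that contain both an ℓ-sparse column basis and an ℓ-sparse row basis is at most (n · |F|)^{6ℓ}. -/
open Matrix

/-- A square matrix `M` contains an `l`-sparse column basis if there are `M.rank` linearly
independent columns of `M` with a total of at most `l` nonzero entries. -/
def HasSparseColBasis {F : Type*} [Field F] {n : ℕ} (M : Matrix (Fin n) (Fin n) F)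
    (l : ℝ) : Prop :=
  ∃ s : Finset (Fin n), s.card = M.rank ∧
    LinearIndependent F (fun j : s => Mᵀ (j : Fin n)) ∧
    ({p : Fin n × Fin n | p.2 ∈ s ∧ M p.1 p.2 ≠ 0}.ncard : ℝ) ≤ l

/-- A square matrix `M` contains an `l`-sparse row basis if there are `M.rank` linearly
independent rows of `M` with a total of at most `l` nonzero entries. -/
def HasSparseRowBasis {F : Type*} [Field F] {n : ℕ} (M : Matrix (Fin n) (Fin n) F)
    (l : ℝ) : Prop :=
  ∃ s : Finset (Fin n), s.card = M.rank ∧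
    LinearIndependent F (fun i : s => M (i : Fin n)) ∧
    ({p : Fin n × Fin n | p.1 ∈ s ∧ M p.1 p.2 ≠ 0}.ncard : ℝ) ≤ l

/-- The nonzero entries of the vectors `v i`, `i ∈ s`, together with their positions. -/
def entryGraph {F ι κ : Type*} [Zero F] (v : ι → κ → F) (s : Set ι) : Set ((ι × κ) × F) :=
  {p | p.1.1 ∈ s ∧ v p.1.1 p.1.2 ≠ 0 ∧ p.2 = v p.1.1 p.1.2}

theorem subset_of_entryGraph_subset {F ι κ : Type*} [Zero F] {v w : ι → κ → F} {s t : Set ι}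
    (hv : ∀ i ∈ s, v i ≠ 0) (h : entryGraph v s ⊆ entryGraph w t) : s ⊆ t := by
  intro i hi
  obtain ⟨j, hj⟩ := Function.ne_iff.mp (hv i hi)
  have hmem : ((i, j), v i j) ∈ entryGraph v s := ⟨hi, hj, rfl⟩
  exact (h hmem).1

theorem eq_on_of_entryGraph_eq {F ι κ : Type*} [Zero F] {v w : ι → κ → F} {s t : Set ι}
    (hv : ∀ i ∈ s, v i ≠ 0) (h : entryGraph v s = entryGraph w t) {i : ι} (hi : i ∈ s) :
    v i = w i := by
  have hit := subset_of_entryGraph_subset hv h.subset hi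
  funext j
  by_cases hvj : v i j = 0
  · by_contra hne
    have hmem : ((i, j), w i j) ∈ entryGraph w t := ⟨hit, fun h0 => hne (hvj.trans h0.symm), rfl⟩
    rw [← h] at hmem
    exact hmem.2.1 hvj
  · have hmem : ((i, j), v i j) ∈ entryGraph v s := ⟨hi, hvj, rfl⟩
    rw [h] at hmem
    exact hmem.2.2

theorem entryGraph_nonempty {F ι κ : Type*} [Zero F] {v : ι → κ → F} {s : Set ι}
    (hs : s.Nonempty) (hv : ∀ i ∈ s, v i ≠ 0) : (entryGraph v s).Nonempty := by
  obtain ⟨i, hi⟩ := hs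
  obtain ⟨j, hj⟩ := Function.ne_iff.mp (hv i hi)
  exact ⟨((i, j), v i j), hi, hj, rfl⟩

theorem ncard_entryGraph {F ι κ : Type*} [Zero F] (v : ι → κ → F) (s : Set ι) :
    (entryGraph v s).ncard = {p : ι × κ | p.1 ∈ s ∧ v p.1 p.2 ≠ 0}.ncard := by
  rw [← Set.ncard_image_of_injective _
    (f := fun p : ι × κ => (p, v p.1 p.2)) fun p q h => congrArg Prod.fst h]
  congr 1
  ext ⟨p, x⟩
  simp only [entryGraph, Set.mem_ofPred_eq, Set.mem_image, Prod.mk.injEq]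
  constructor
  · rintro ⟨h1, h2, rfl⟩
    exact ⟨p, ⟨h1, h2⟩, rfl, rfl⟩
  · rintro ⟨q, ⟨h1, h2⟩, rfl, rfl⟩
    exact ⟨h1, h2, rfl⟩

theorem Set.exists_range_fin_eq {α : Type*} {A : Set α} (hfin : A.Finite) (hA : A.Nonempty)
    {l : ℕ} (hl : A.ncard ≤ l) : ∃ f : Fin l → α, Set.range f = A := by
  have := hfin.fintype
  have := hA.to_subtype
  rw [← Nat.card_coe_set_eq, Nat.card_eq_fintype_card] at hl
  obtain ⟨e⟩ : Nonempty (A ↪ Fin l) :=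
    Function.Embedding.nonempty_of_card_le (by simpa using hl)
  refine ⟨fun a => (Function.invFun e a : A), ?_⟩
  rw [Set.range_comp' Subtype.val, (Function.invFun_surjective e.injective).range_eq,
    Set.image_univ, Subtype.range_coe]

theorem span_image_eq_span_range_of_card_eq_finrank {F V ι : Type*} [Field F] [AddCommGroup V]
    [Module F V] [FiniteDimensional F V] {v : ι → V} {s : Finset ι}
    (hv : LinearIndependent F (fun i : s => v i))
    (hs : s.card = Module.finrank F (Submodule.span F (Set.range v))) :
    Submodule.span F (v '' s) = Submodule.span F (Set.range v) := by
  refine Submodule.eq_of_le_of_finrank_eq (Submodule.span_mono (Set.image_subset_range v s)) ?_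
  have h := finrank_span_eq_card hv
  have hrange : Set.range (fun i : s => v i) = v '' s := by
    ext x
    simp
  rw [hrange, Fintype.card_coe] at h
  rw [h, hs]

/-- A vector of the row space vanishing on columns that span the column space is zero. -/
theorem eq_zero_of_mem_span_row_of_span_col {F m n : Type*} [Field F] [Fintype m]
    {M : Matrix m n F} {t : Set n}
    (ht : Submodule.span F (Mᵀ '' t) = Submodule.span F (Set.range Mᵀ)) {x : n → F}
    (hx : x ∈ Submodule.span F (Set.range M)) (hxt : ∀ j ∈ t, x j = 0) : x = 0 := by
  have hrange := range_vecMulLinear M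
  change _ = Submodule.span F (Set.range M) at hrange
  rw [← hrange] at hx
  obtain ⟨w, rfl⟩ := hx
  have hker : Submodule.span F (Mᵀ '' t) ≤ LinearMap.ker (dotProductBilin F F w) := by
    rw [Submodule.span_le]
    rintro _ ⟨j, hj, rfl⟩
    exact hxt j hj
  rw [ht] at hker
  funext j
  exact hker (Submodule.subset_span ⟨j, rfl⟩)

/-- A matrix is determined by rows spanning its row space and columns spanning its column
space. -/
theorem Matrix.eq_of_eq_on_spanning_rows_cols {F m n : Type*} [Field F] [Fintype m]
    {M N : Matrix m n F} {s : Set m} {t : Set n}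
    (hN : Submodule.span F (N '' s) = Submodule.span F (Set.range N))
    (hM : Submodule.span F (Mᵀ '' t) = Submodule.span F (Set.range Mᵀ))
    (hs : ∀ i ∈ s, M i = N i) (ht : ∀ j ∈ t, Mᵀ j = Nᵀ j) : M = N := by
  have hle : Submodule.span F (Set.range N) ≤ Submodule.span F (Set.range M) := by
    rw [← hN, ← Set.image_congr hs]
    exact Submodule.span_mono (Set.image_subset_range M s)
  funext i
  refine sub_eq_zero.mp (eq_zero_of_mem_span_row_of_span_col hM (Submodule.sub_mem _
    (Submodule.subset_span ⟨i, rfl⟩) (hle (Submodule.subset_span ⟨i, rfl⟩))) fun j hj => ?_)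
  exact sub_eq_zero.mpr (congrFun (ht j hj) i)

/-- The nonzero entries of the rows of some row basis of `M` are listed by `f`. -/
def IsRowBasisCode {F : Type*} [Field F] {n l : ℕ} (M : Matrix (Fin n) (Fin n) F)
    (f : Fin l → (Fin n × Fin n) × F) : Prop :=
  ∃ s : Finset (Fin n), (∀ i ∈ (s : Set (Fin n)), M i ≠ 0) ∧
    Submodule.span F (M '' s) = Submodule.span F (Set.range M) ∧
    Set.range f = entryGraph M s

theorem HasSparseRowBasis.exists_code {F : Type*} [Field F] {n l : ℕ}
    {M : Matrix (Fin n) (Fin n) F} (h : HasSparseRowBasis M (l : ℝ)) (hM : 0 < M.rank) :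
    ∃ f : Fin l → (Fin n × Fin n) × F, IsRowBasisCode M f := by
  obtain ⟨s, hcard, hli, hsp⟩ := h
  have hne : ∀ i ∈ (s : Set (Fin n)), M i ≠ 0 := fun i hi => hli.ne_zero ⟨i, hi⟩
  have hs : (s : Set (Fin n)).Nonempty := Finset.card_pos.mp (hcard ▸ hM)
  have hfin : (entryGraph M (s : Set (Fin n))).Finite :=
    (Set.finite_range fun p : Fin n × Fin n => (p, M p.1 p.2)).subset
      fun p hp => ⟨p.1, Prod.ext rfl hp.2.2.symm⟩
  obtain ⟨f, hf⟩ := Set.exists_range_fin_eq hfin (entryGraph_nonempty hs hne)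
    (l := l) ((ncard_entryGraph M s).trans_le (by exact_mod_cast hsp))
  exact ⟨f, s, hne, span_image_eq_span_range_of_card_eq_finrank hli
    (hcard.trans M.rank_eq_finrank_span_row), hf⟩

theorem HasSparseColBasis.transpose {F : Type*} [Field F] {n : ℕ}
    {M : Matrix (Fin n) (Fin n) F} {l : ℝ} (h : HasSparseColBasis M l) :
    HasSparseRowBasis Mᵀ l := by
  obtain ⟨s, hcard, hli, hsp⟩ := h
  refine ⟨s, hcard.trans M.rank_transpose.symm, hli, ?_⟩
  rw [← Set.ncard_image_of_injective _ Prod.swap_injective, Set.image_swap_eq_preimage_swap] at hsp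
  exact hsp

theorem IsRowBasisCode.eq {F : Type*} [Field F] {n l : ℕ} {M N : Matrix (Fin n) (Fin n) F}
    {f g : Fin l → (Fin n × Fin n) × F} (hMf : IsRowBasisCode M f) (hNf : IsRowBasisCode N f)
    (hMg : IsRowBasisCode Mᵀ g) (hNg : IsRowBasisCode Nᵀ g) : M = N := by
  obtain ⟨s, -, -, hs⟩ := hMf
  obtain ⟨s', hs'0, hs'span, hs'⟩ := hNf
  obtain ⟨t, ht0, htspan, ht⟩ := hMg
  obtain ⟨t', -, -, ht'⟩ := hNg
  exact Matrix.eq_of_eq_on_spanning_rows_cols hs'span htspan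
    (fun i hi => (eq_on_of_entryGraph_eq hs'0 (hs'.symm.trans hs) hi).symm)
    (fun j hj => eq_on_of_entryGraph_eq ht0 (ht.symm.trans ht') hj)

/-- Over a finite field F, the number of n×n matrices of rank k containing both an
ℓ-sparse column basis and an ℓ-sparse row basis is at most (n·|F|)^{6ℓ}. -/
theorem card_sparse_basis_matrices_le (F : Type) [Field F] [Fintype F] (n k l : ℕ)
    (hn : 0 < n) (hk : 0 < k) (hl : 0 < l) :
    { M : Matrix (Fin n) (Fin n) F | M.rank = k ∧
        HasSparseColBasis M (l : ℝ) ∧ HasSparseRowBasis M (l : ℝ) }.ncard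
      ≤ (n * Fintype.card F) ^ (6 * l) := by
  classical
  set S := { M : Matrix (Fin n) (Fin n) F | M.rank = k ∧
    HasSparseColBasis M (l : ℝ) ∧ HasSparseRowBasis M (l : ℝ) }
  have hrow (M : S) : ∃ f : Fin l → (Fin n × Fin n) × F, IsRowBasisCode M.1 f :=
    M.2.2.2.exists_code (M.2.1.symm ▸ hk)
  have hcol (M : S) : ∃ f : Fin l → (Fin n × Fin n) × F, IsRowBasisCode M.1ᵀ f :=
    M.2.2.1.transpose.exists_code (by rw [Matrix.rank_transpose, M.2.1]; exact hk)
  choose f hf using hrow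
  choose g hg using hcol
  have hinj : Function.Injective fun M => (f M, g M) := by
    intro M N h
    obtain ⟨h1, h2⟩ := Prod.mk.inj h
    exact Subtype.ext ((hf M).eq (h1 ▸ hf N) (hg M) (h2 ▸ hg N))
  have hcardF : 0 < Fintype.card F := Fintype.card_pos
  calc S.ncard = Nat.card S := (Nat.card_coe_set_eq S).symm
    _ ≤ Nat.card ((Fin l → (Fin n × Fin n) × F) × (Fin l → (Fin n × Fin n) × F)) :=
      Nat.card_le_card_of_injective _ hinj
    _ = n ^ (4 * l) * Fintype.card F ^ (2 * l) := by
      simp only [Nat.card_eq_fintype_card, Fintype.card_prod, Fintype.card_fun, Fintype.card_fin]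
      ring
    _ ≤ n ^ (6 * l) * Fintype.card F ^ (6 * l) := by
      gcongr <;> omega
    _ = (n * Fintype.card F) ^ (6 * l) := (mul_pow _ _ _).symm
end

section
/- Let F be a field and let M ∈ F^{n×n} be a matrix of rank at most k whose diagonal entries are all nonzero. Then there exist integers n' ∈ {1,...,n}, k' ∈ {1,...,k} with k'/n' ≤ k/n, an integer s', and a subset S ⊆ {1,...,n} of size n' such that the principal submatrix of M with rows and columns indexed by S has rank k', sparsity s', nonzero diagonal entries, and contains a (2s'k'/n')-sparse column basis and a (2s'k'/n')-sparse row basis. -/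
open Matrix

lemma LinearIndepOn.finrank_span_image {F V ι : Type*} [Field F] [AddCommGroup V] [Module F V]
    {v : ι → V} {B : Finset ι} (hB : LinearIndepOn F v (B : Set ι)) :
    Module.finrank F (Submodule.span F (v '' (B : Set ι))) = B.card := by
  rw [Set.image_eq_range]
  exact (finrank_span_eq_card hB).trans (Fintype.card_coe B)

open Module Submodule in
/-- A greedy basis of a finite family of vectors, added in order of increasing weight. If every
subfamily `T` has rank at least `k * #T / m`, then the weight of the greedy basis is at most a
fraction `k / m` of the total weight, up to a correction that vanishes once the basis has exactly
`k * #T / m` elements. -/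
lemma exists_linearIndepOn_weight_le {F V ι : Type*} [Field F] [AddCommGroup V] [Module F V]
    [DecidableEq ι] (v : ι → V) (w : ι → ℕ) (m k : ℕ)
    (h : ∀ T : Finset ι, k * T.card ≤ m * finrank F (span F (v '' (T : Set ι))))
    (T : Finset ι) :
    ∃ B ⊆ T, LinearIndepOn F v (B : Set ι) ∧
      B.card = finrank F (span F (v '' (T : Set ι))) ∧
      ∀ c : ℕ, (∀ x ∈ T, w x ≤ c) →
        (m : ℤ) * ∑ j ∈ B, (w j : ℤ) + c * (k * T.card - m * B.card)
          ≤ k * ∑ j ∈ T, (w j : ℤ) := by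
  suffices H : ∃ B ⊆ T, LinearIndepOn F v (B : Set ι) ∧
      span F (v '' (B : Set ι)) = span F (v '' (T : Set ι)) ∧
      ∀ c : ℕ, (∀ x ∈ T, w x ≤ c) →
        (m : ℤ) * ∑ j ∈ B, (w j : ℤ) + c * (k * T.card - m * B.card)
          ≤ k * ∑ j ∈ T, (w j : ℤ) by
    obtain ⟨B, hBT, hB, hspan, hw⟩ := H
    refine ⟨B, hBT, hB, ?_, hw⟩
    rw [← hspan, hB.finrank_span_image]
  induction T using Finset.induction_on_max_value w with
  | empty => exact ⟨∅, by simp⟩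
  | insert a s ha hmax ih =>
    obtain ⟨B, hBs, hB, hspan, hw⟩ := ih
    have key : ∃ B' ⊆ insert a s, LinearIndepOn F v (B' : Set ι) ∧
        span F (v '' (B' : Set ι)) = span F (v '' ((insert a s : Finset ι) : Set ι)) ∧
        (m : ℤ) * ∑ j ∈ B', (w j : ℤ) + w a * (k * (insert a s).card - m * B'.card)
          ≤ k * ∑ j ∈ insert a s, (w j : ℤ) := by
      have hwa := hw (w a) hmax
      by_cases hv : v a ∈ span F (v '' (B : Set ι))
      · refine ⟨B, hBs.trans (Finset.subset_insert a s), hB, ?_, ?_⟩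
        · rw [Finset.coe_insert, Set.image_insert_eq, span_insert, ← hspan, eq_comm, sup_eq_right,
            span_singleton_le_iff_mem]
          exact hv
        · rw [Finset.sum_insert ha, Finset.card_insert_of_notMem ha]
          push_cast
          linarith
      · have haB : a ∉ B := fun hB' => ha (hBs hB')
        refine ⟨insert a B, Finset.insert_subset_insert a hBs, ?_, ?_, ?_⟩
        · rw [Finset.coe_insert]
          exact hB.insert hv
        · simp only [Finset.coe_insert, Set.image_insert_eq, span_insert, hspan]
        · rw [Finset.sum_insert ha, Finset.sum_insert haB, Finset.card_insert_of_notMem ha,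
            Finset.card_insert_of_notMem haB]
          push_cast
          linarith
    obtain ⟨B', hB's, hB', hspan', hw'⟩ := key
    refine ⟨B', hB's, hB', hspan', fun c hc => ?_⟩
    have hcard : B'.card = finrank F (span F (v '' ((insert a s : Finset ι) : Set ι))) := by
      rw [← hspan', hB'.finrank_span_image]
    have hT : (k : ℤ) * (insert a s).card ≤ m * B'.card := by
      rw [hcard]
      exact_mod_cast h (insert a s)
    have hac : (w a : ℤ) ≤ c := by exact_mod_cast hc a (Finset.mem_insert_self a s)
    nlinarith [mul_nonneg (sub_nonneg.2 hac) (sub_nonneg.2 hT)]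

lemma ncard_support_cols {F m n : Type*} [Zero F] [Fintype m] (A : Matrix m n F) (s : Finset n) :
    {p : m × n | p.2 ∈ s ∧ A p.1 p.2 ≠ 0}.ncard = ∑ j ∈ s, {i | A i j ≠ 0}.ncard := by
  classical
  have h : {p : m × n | p.2 ∈ s ∧ A p.1 p.2 ≠ 0} =
      ((Finset.univ ×ˢ s).filter fun p : m × n => A p.1 p.2 ≠ 0 : Finset (m × n)) := by
    ext p
    simp
  rw [h, Set.ncard_coe_finset, Finset.card_filter, Finset.sum_product_right]
  refine Finset.sum_congr rfl fun j _ => ?_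
  rw [← Finset.card_filter, ← Set.ncard_coe_finset]
  simp

lemma sparsity_eq_sum {F m n : Type*} [Zero F] [Fintype m] [Fintype n] (A : Matrix m n F) :
    sparsity A = ∑ j, {i | A i j ≠ 0}.ncard := by
  simpa [sparsity] using ncard_support_cols A Finset.univ

lemma sparsity_transpose {F m n : Type*} [Zero F] (A : Matrix m n F) :
    sparsity Aᵀ = sparsity A :=
  Set.ncard_congr (fun p _ => p.swap) (fun _ hp => hp) (fun _ _ _ _ h => Prod.swap_injective h)
    fun p hp => ⟨p.swap, hp, p.swap_swap⟩

lemma HasSparseColBasis.hasSparseRowBasis {F : Type*} [Field F] {n : ℕ}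
    {A : Matrix (Fin n) (Fin n) F} {l : ℝ} (h : HasSparseColBasis Aᵀ l) :
    HasSparseRowBasis A l := by
  obtain ⟨s, hs, hli, hl⟩ := h
  refine ⟨s, hs.trans A.rank_transpose, hli, le_of_eq_of_le ?_ hl⟩
  congr 1
  exact Set.ncard_congr (fun p _ => p.swap) (fun _ hp => hp)
    (fun _ _ _ _ h => Prod.swap_injective h) fun p hp => ⟨p.swap, hp, p.swap_swap⟩

lemma rank_submatrix_le_finrank_span_image {F m m₀ n : Type*} [Field F] [Fintype n]
    (A : Matrix m n F) (f : m₀ → m) (T : Finset n) :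
    (A.submatrix f ((↑) : T → n)).rank ≤
      Module.finrank F (Submodule.span F (A.col '' (T : Set n))) := by
  rw [Set.image_eq_range]
  have h := rank_submatrix_le (A.submatrix id ((↑) : T → n)) f id
  rw [submatrix_submatrix, Function.id_comp, Function.comp_id] at h
  exact h.trans_eq (rank_eq_finrank_span_cols _)

/-- If no principal submatrix of `A` has a smaller ratio of rank to size than `A`, then `A` has
a column basis that is no denser than the average column of `A`. -/
lemma hasSparseColBasis_of_rank_mul_card_le {F : Type*} [Field F] {m : ℕ}
    (A : Matrix (Fin m) (Fin m) F)
    (h : ∀ T : Finset (Fin m),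
      A.rank * T.card ≤ m * (A.submatrix ((↑) : T → Fin m) ((↑) : T → Fin m)).rank) :
    HasSparseColBasis A (sparsity A * A.rank / m) := by
  obtain ⟨B, -, hB, hcard, hw⟩ := exists_linearIndepOn_weight_le (F := F) A.col
    (fun j => {i | A i j ≠ 0}.ncard) m A.rank
    (fun T => (h T).trans (Nat.mul_le_mul_left m (rank_submatrix_le_finrank_span_image A _ T)))
    Finset.univ
  rw [Finset.coe_univ, Set.image_univ, ← rank_eq_finrank_span_cols] at hcard
  refine ⟨B, hcard, hB, ?_⟩
  obtain rfl | hm := m.eq_zero_or_pos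
  · simp [Set.eq_empty_of_isEmpty]
  have hsum := hw (∑ j, {i | A i j ≠ 0}.ncard) fun x hx =>
    Finset.single_le_sum (f := fun j => {i | A i j ≠ 0}.ncard) (fun _ _ => Nat.zero_le _) hx
  rw [hcard, Finset.card_univ, Fintype.card_fin, mul_comm (m : ℤ) A.rank, sub_self, mul_zero,
    add_zero] at hsum
  rw [ncard_support_cols, sparsity_eq_sum, le_div_iff₀ (by exact_mod_cast hm), mul_comm,
    mul_comm _ (A.rank : ℝ)]
  exact_mod_cast hsum

/-- If M ∈ F^{n×n} has rank at most k and nonzero diagonal entries, then there are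
n' ∈ {1,...,n}, k' ∈ {1,...,k} with k'/n' ≤ k/n, an integer s', and a set S of n' indices such
that the principal submatrix of M indexed by S has rank k', sparsity s', nonzero diagonal
entries, and contains (2s'k'/n')-sparse column and row bases. -/
theorem exists_principal_submatrix_sparse_bases {F : Type*} [Field F] {n k : ℕ} (hn : 0 < n)
    (M : Matrix (Fin n) (Fin n) F) (hrk : M.rank ≤ k) (hdiag : ∀ i, M i i ≠ 0) :
    ∃ (n' k' s' : ℕ) (hn' : 1 ≤ n' ∧ n' ≤ n) (hk' : 1 ≤ k' ∧ k' ≤ k)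
      (hratio : (k' : ℝ) / (n' : ℝ) ≤ (k : ℝ) / (n : ℝ))
      (S : Finset (Fin n)) (hS : S.card = n'),
      let M' := M.submatrix (fun i => ((S.orderIsoOfFin hS i : Fin n)))
        (fun j => ((S.orderIsoOfFin hS j : Fin n)))
      M'.rank = k' ∧ sparsity M' = s' ∧ (∀ i, M' i i ≠ 0) ∧
        HasSparseColBasis M' ((2 * s' * k' : ℝ) / (n' : ℝ)) ∧
        HasSparseRowBasis M' ((2 * s' * k' : ℝ) / (n' : ℝ)) := by
  let r (S : Finset (Fin n)) : ℕ := (M.submatrix ((↑) : S → Fin n) ((↑) : S → Fin n)).rank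
  have hne : ((Finset.univ : Finset (Finset (Fin n))).filter Finset.Nonempty).Nonempty :=
    ⟨Finset.univ, by simpa using ⟨⟨0, hn⟩, Finset.mem_univ _⟩⟩
  obtain ⟨S, hS, hmin⟩ := Finset.exists_min_image _ (fun S => (r S : ℝ) / S.card) hne
  simp only [Finset.mem_filter, Finset.mem_univ, true_and] at hS hmin
  have hSpos : 0 < S.card := hS.card_pos
  have hle (T : Finset (Fin n)) : r S * T.card ≤ S.card * r T := by
    obtain rfl | hT := T.eq_empty_or_nonempty
    · simp
    have := hmin T hT
    rw [div_le_div_iff₀ (by exact_mod_cast hSpos) (by exact_mod_cast hT.card_pos)] at this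
    rw [mul_comm S.card]
    exact_mod_cast this
  have hr_univ : r Finset.univ ≤ k := (rank_submatrix_le M _ _).trans hrk
  have hr_pos : 1 ≤ r S := by
    obtain ⟨i, hi⟩ := hS
    simp only [r]
    rw [rank_eq_finrank_span_cols, Submodule.one_le_finrank_iff, Ne, Submodule.span_eq_bot]
    exact fun h => hdiag i (congrFun (h _ ⟨⟨i, hi⟩, rfl⟩) ⟨i, hi⟩)
  let e : Fin S.card ≃ S := (S.orderIsoOfFin rfl).toEquiv
  let M' : Matrix (Fin S.card) (Fin S.card) F :=
    M.submatrix (fun i => (e i : Fin n)) (fun j => (e j : Fin n))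
  have hrank : M'.rank = r S :=
    rank_submatrix (M.submatrix ((↑) : S → Fin n) ((↑) : S → Fin n)) e e
  have hM' (T : Finset (Fin S.card)) : M'.rank * T.card ≤
      S.card * (M'.submatrix ((↑) : T → Fin S.card) ((↑) : T → Fin S.card)).rank := by
    let f : Fin S.card ↪ Fin n := e.toEmbedding.trans (Function.Embedding.subtype _)
    have hT : (M'.submatrix ((↑) : T → Fin S.card) ((↑) : T → Fin S.card)).rank = r (T.map f) := by
      simp only [r]
      rw [← rank_submatrix (M.submatrix ((↑) : T.map f → Fin n) ((↑) : T.map f → Fin n))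
        (T.equivMap f) (T.equivMap f)]
      congr 1
    rw [hrank, hT, ← Finset.card_map f]
    exact hle _
  have hbound : (sparsity M' * M'.rank / S.card : ℝ) ≤ 2 * sparsity M' * r S / S.card := by
    rw [hrank]
    gcongr
    have : (0 : ℝ) ≤ sparsity M' := Nat.cast_nonneg _
    linarith
  refine ⟨S.card, r S, sparsity M', ⟨hSpos, S.card_le_univ.trans_eq (Fintype.card_fin n)⟩,
    ⟨hr_pos, (rank_submatrix_le M _ _).trans hrk⟩, ?_, S, rfl, hrank, rfl,
    fun i => hdiag _, ?_, ?_⟩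
  · refine (hmin Finset.univ ⟨⟨0, hn⟩, Finset.mem_univ _⟩).trans ?_
    rw [Finset.card_univ, Fintype.card_fin]
    gcongr
  · obtain ⟨s, hs, hli, hl⟩ := hasSparseColBasis_of_rank_mul_card_le M' hM'
    exact ⟨s, hs, hli, hl.trans hbound⟩
  · have hcol : HasSparseColBasis M'ᵀ (sparsity M'ᵀ * M'ᵀ.rank / S.card) :=
      hasSparseColBasis_of_rank_mul_card_le M'ᵀ fun T => by
        rw [rank_transpose, ← transpose_submatrix, rank_transpose]
        exact hM' T
    rw [sparsity_transpose, rank_transpose] at hcol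
    obtain ⟨s, hs, hli, hl⟩ := hcol.hasSparseRowBasis
    exact ⟨s, hs, hli, hl.trans hbound⟩
end

section
/- Let d be an even positive integer and m a positive integer, and let A_1, A_2, ..., A_{2t+1} be subsets of {1,...,d}, each of size d/2, such that |A_j ∩ A_{j+1}| < m for every 1 ≤ j ≤ 2t. Then |A_1 ∩ A_{2t+1}| ≥ d/2 − 2t·m; moreover, if t ≥ 1, then |A_1 ∩ A_{2t}| ≤ (2t−1)·m. -/
/-- A triangle inequality for the set difference: `X ∩ Z` is covered by `X \ Y` and `Y ∩ Z`. -/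
theorem card_inter_add_card_inter_le {α : Type*} [DecidableEq α] (X Y Z : Finset α) :
    (X ∩ Z).card + (X ∩ Y).card ≤ X.card + (Y ∩ Z).card := by
  have hsub : X ∩ Z ⊆ (X \ Y) ∪ (Y ∩ Z) := by
    intro x
    simp only [Finset.mem_inter, Finset.mem_union, Finset.mem_sdiff]
    tauto
  have h₁ := (Finset.card_le_card hsub).trans (Finset.card_union_le _ _)
  have h₂ := Finset.card_sdiff_add_card_inter X Y
  omega

/-- If `Y` and `Z` have total size that of the whole type, then the part of `X` outside `Y ∪ Z`
has at most `|Y ∩ Z|` elements. -/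
theorem card_le_card_inter_add_card_inter {α : Type*} [DecidableEq α] [Fintype α]
    (X Y Z : Finset α) (hYZ : Y.card + Z.card = Fintype.card α) :
    X.card ≤ (X ∩ Y).card + (X ∩ Z).card + (Y ∩ Z).card := by
  have hsub : X ⊆ ((X ∩ Y) ∪ (X ∩ Z)) ∪ (Y ∪ Z)ᶜ := by
    intro x
    simp only [Finset.mem_inter, Finset.mem_union, Finset.mem_compl]
    tauto
  have h₁ := (Finset.card_le_card hsub).trans (Finset.card_union_le _ _)
  have h₂ := Finset.card_union_le (X ∩ Y) (X ∩ Z)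
  have h₃ := Finset.card_union_add_card_inter Y Z
  have h₄ := Finset.card_add_card_compl (Y ∪ Z)
  omega

/-- Let d be even and positive, m > 0, and let A_1, ..., A_{2t+1} be subsets of
{1,...,d} of size d/2 with |A_j ∩ A_{j+1}| < m for 1 ≤ j ≤ 2t. Then
|A_1 ∩ A_{2t+1}| ≥ d/2 - 2t·m, and if t ≥ 1 then |A_1 ∩ A_{2t}| ≤ (2t-1)·m. -/
theorem inter_card_bounds_of_alternating {d m t : ℕ} (hd : Even d) (hd0 : 0 < d) (hm0 : 0 < m)
    (A : ℕ → Finset (Fin d))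
    (hcard : ∀ j, 1 ≤ j → j ≤ 2 * t + 1 → (A j).card = d / 2)
    (hadj : ∀ j, 1 ≤ j → j ≤ 2 * t → ((A j) ∩ (A (j + 1))).card < m) :
    ((d : ℝ) / 2 - 2 * (t : ℝ) * (m : ℝ) ≤ ((A 1 ∩ A (2 * t + 1)).card : ℝ)) ∧
      (1 ≤ t → ((A 1 ∩ A (2 * t)).card : ℝ) ≤ (2 * (t : ℝ) - 1) * (m : ℝ)) := by
  obtain ⟨h, rfl⟩ := hd
  have hhalf : (h + h) / 2 = h := by omega
  rw [hhalf] at hcard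
  have even_bound : ∀ s, s < t → h ≤ (A 1 ∩ A (2 * s + 1)).card + 2 * s * m →
      (A 1 ∩ A (2 * s + 2)).card ≤ (2 * s + 1) * m := by
    intro s hs ih
    have h₁ := card_inter_add_card_inter_le (A 1) (A (2 * s + 1)) (A (2 * s + 2))
    have h₂ : (A (2 * s + 1) ∩ A (2 * s + 2)).card < m := hadj _ (by omega) (by omega)
    rw [hcard 1 (by omega) (by omega)] at h₁
    rw [add_mul, one_mul]
    omega
  have odd_bound : ∀ s, s ≤ t → h ≤ (A 1 ∩ A (2 * s + 1)).card + 2 * s * m := by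
    intro s
    induction s with
    | zero =>
      intro _
      simp [hcard 1 (by omega) (by omega)]
    | succ s ih =>
      intro hs
      have h₁ := even_bound s hs (ih (by omega))
      have h₂ : (A (2 * s + 2) ∩ A (2 * s + 3)).card < m := hadj _ (by omega) (by omega)
      have h₃ := card_le_card_inter_add_card_inter (A 1) (A (2 * s + 2)) (A (2 * s + 3)) (by
        rw [hcard _ (by omega) (by omega), hcard _ (by omega) (by omega), Fintype.card_fin])
      rw [hcard 1 (by omega) (by omega)] at h₃
      have h₄ : 2 * (s + 1) * m = (2 * s + 1) * m + m := by ring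
      rw [h₄, show 2 * (s + 1) + 1 = 2 * s + 3 by ring]
      omega
  constructor
  · have hodd : (h : ℝ) ≤ (A 1 ∩ A (2 * t + 1)).card + 2 * t * m := by
      exact_mod_cast odd_bound t le_rfl
    push_cast
    linarith
  · intro ht
    obtain ⟨s, rfl⟩ := Nat.exists_eq_add_of_le' ht
    have heven : ((A 1 ∩ A (2 * s + 2)).card : ℝ) ≤ (2 * s + 1) * m := by
      exact_mod_cast even_bound s (by omega) (odd_bound s (by omega))
    rw [show 2 * (s + 1) = 2 * s + 2 by ring]
    push_cast
    linarith
end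

section
/- For every odd integer ℓ ≥ 3 there exists δ = δ(ℓ) > 0 such that for every sufficiently large integer n there exists a graph G on n vertices containing no cycle of odd length at most ℓ with minrk_ℝ(G) ≤ n^{1−δ}. -/
open Matrix

/-- The graph on `V` in which two vertices are adjacent when the sets attached to them by `f` meet
in fewer than `m` points. -/
def smallInterGraph {V α : Type*} [DecidableEq α] (f : V → Finset α) (m : ℕ) : SimpleGraph V where
  Adj u v := u ≠ v ∧ (f u ∩ f v).card < m
  symm := ⟨fun u v h => ⟨h.1.symm, by rw [Finset.inter_comm]; exact h.2⟩⟩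
  loopless := ⟨fun _ h => h.1 rfl⟩

theorem smallInterGraph_walk_bound {V α : Type*} [Fintype α] [DecidableEq α] {f : V → Finset α}
    {m s : ℕ} (hα : Fintype.card α = 2 * s) (hf : ∀ v, (f v).card = s) {u v : V}
    (w : (smallInterGraph f m).Walk u v) :
    (Even w.length → (f v \ f u).card ≤ w.length * (m - 1)) ∧
      (Odd w.length → (f v ∩ f u).card ≤ w.length * (m - 1)) := by
  induction w with
  | nil => simp
  | @cons a b c h p ih =>
    have hab : (f a ∩ f b).card ≤ m - 1 := Nat.le_pred_of_lt h.2
    rw [SimpleGraph.Walk.length_cons, add_mul, one_mul]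
    refine ⟨fun he => ?_, fun ho => ?_⟩
    · have hp := ih.2 (by rwa [Nat.even_add_one, Nat.not_even_iff_odd] at he)
      have hsub : f c \ f a ⊆ (f c ∩ f b) ∪ (f a ∪ f b)ᶜ := by
        intro x; simp only [Finset.mem_sdiff, Finset.mem_union, Finset.mem_inter,
          Finset.mem_compl]; tauto
      have h1 := (Finset.card_le_card hsub).trans (Finset.card_union_le _ _)
      have h2 := Finset.card_union_add_card_inter (f a) (f b)
      have h3 := Finset.card_compl_add_card (f a ∪ f b)
      rw [hf, hf] at h2
      omega
    · have hp := ih.1 (by rwa [Nat.odd_add_one, Nat.not_odd_iff_even] at ho)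
      have hsub : f c ∩ f a ⊆ (f c \ f b) ∪ (f a ∩ f b) := by
        intro x; simp only [Finset.mem_sdiff, Finset.mem_union, Finset.mem_inter]; tauto
      have h1 := (Finset.card_le_card hsub).trans (Finset.card_union_le _ _)
      omega

theorem sum_choose_mul_ring_choose (t m k : ℕ) :
    ∑ j ∈ Finset.range (k + 1), (t.choose j : ℤ) * Ring.choose (-(m : ℤ)) (k - j) =
      Ring.choose ((t : ℤ) - m) k := by
  rw [sub_eq_add_neg, Ring.add_choose_eq k (Commute.all _ _),
    Finset.Nat.sum_antidiagonal_eq_sum_range_succ_mk]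
  simp [Ring.choose_natCast]

theorem sum_card_le_subset {α R : Type*} [Fintype α] [DecidableEq α] [CommRing R] (c : ℕ → R)
    (k : ℕ) (X : Finset α) :
    ∑ T : {T : Finset α // T.card ≤ k}, (if T.1 ⊆ X then c T.1.card else 0) =
      ∑ j ∈ Finset.range (k + 1), (X.card.choose j : R) * c j := by
  rw [← Finset.sum_subtype (Finset.univ.filter fun T : Finset α => T.card ≤ k) (by simp)
      (fun T => if T ⊆ X then c T.card else 0),
    ← Finset.sum_fiberwise_of_maps_to (t := Finset.range (k + 1)) (g := Finset.card)
      (by simp)]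
  refine Finset.sum_congr rfl fun j hj => ?_
  rw [← Finset.sum_filter, Finset.sum_congr rfl (g := fun _ => c j), Finset.sum_const, nsmul_eq_mul,
    ← Finset.card_powersetCard]
  · congr 3
    ext T
    simp only [Finset.mem_filter, Finset.mem_univ, true_and, Finset.mem_powersetCard]
    have := Finset.mem_range.1 hj
    constructor
    · tauto
    · rintro ⟨h1, h2⟩; exact ⟨⟨by omega, h2⟩, h1⟩
  · intro T hT
    rw [(Finset.mem_filter.1 (Finset.mem_filter.1 hT).1).2]

theorem minrk_smallInterGraph_le {V α : Type*} [Fintype V] [Fintype α] [DecidableEq α]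
    {f : V → Finset α} (hinj : Function.Injective f) {m s : ℕ} (hms : m ≤ s)
    (hf : ∀ v, (f v).card = s) :
    minrk ℝ (smallInterGraph f m) ≤ Fintype.card {T : Finset α // T.card ≤ s - m} := by
  let A : Matrix V {T : Finset α // T.card ≤ s - m} ℝ := fun u T =>
    if T.1 ⊆ f u then ((Ring.choose (-(m : ℤ)) (s - m - T.1.card) : ℤ) : ℝ) else 0
  let B : Matrix {T : Finset α // T.card ≤ s - m} V ℝ := fun T v => if T.1 ⊆ f v then 1 else 0
  have hM : ∀ u v, (A * B) u v =
      ((Ring.choose (((f u ∩ f v).card : ℤ) - m) (s - m) : ℤ) : ℝ) := by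
    intro u v
    rw [← sum_choose_mul_ring_choose]
    push_cast
    rw [← sum_card_le_subset
      (fun j => ((Ring.choose (-(m : ℤ)) (s - m - j) : ℤ) : ℝ)), Matrix.mul_apply]
    refine Finset.sum_congr rfl fun T _ => ?_
    simp only [A, B, Finset.subset_inter_iff]
    split_ifs <;> simp_all
  refine le_trans (Nat.sInf_le ⟨A * B, ⟨fun v => ?_, fun u v huv hadj => ?_⟩, rfl⟩)
    ((Matrix.rank_mul_le_left A B).trans (Matrix.rank_le_card_width A))
  · rw [hM, Finset.inter_self, hf, ← Nat.cast_sub hms, Ring.choose_natCast]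
    simp
  · have hle : m ≤ (f u ∩ f v).card := by
      by_contra h
      exact hadj ⟨huv, not_le.1 h⟩
    have hlt : (f u ∩ f v).card < s := by
      rw [← hf u]
      refine Finset.card_lt_card (Finset.inter_subset_left.ssubset_of_ne fun h => huv (hinj ?_))
      exact Finset.eq_of_subset_of_card_le (Finset.inter_eq_left.1 h) (by rw [hf, hf])
    rw [hM, ← Nat.cast_sub hle, Ring.choose_natCast, Nat.choose_eq_zero_of_lt (by omega)]
    simp

theorem card_card_le_mul_pow_le {α : Type*} [Fintype α] (k : ℕ) {x : ℝ} (hx0 : 0 < x)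
    (hx1 : x ≤ 1) :
    (Fintype.card {T : Finset α // T.card ≤ k} : ℝ) * x ^ k ≤ (1 + x) ^ Fintype.card α := by
  classical
  rw [add_comm, ← Fintype.sum_pow_mul_eq_add_pow α x 1, Fintype.card_subtype, ← nsmul_eq_mul]
  refine (Finset.card_nsmul_le_sum _ (fun T : Finset α => x ^ T.card) _ fun T hT =>
    pow_le_pow_of_le_one hx0.le hx1 (Finset.mem_filter.1 hT).2).trans ?_
  simp only [one_pow, mul_one]
  exact Finset.sum_le_sum_of_subset_of_nonneg (Finset.subset_univ _) fun _ _ _ => by positivity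

theorem exists_one_add_pow_lt {ℓ : ℕ} (hl : 2 ≤ ℓ) :
    ∃ x : ℝ, 0 < x ∧ x ≤ 1 ∧ (1 + x) ^ (2 * ℓ) < 4 ^ ℓ * x ^ (ℓ - 1) := by
  have hl' : (2 : ℝ) ≤ ℓ := by exact_mod_cast hl
  have hl1 : (0 : ℝ) < ℓ - 1 := by linarith
  have hx0 : (0 : ℝ) < 1 - 1 / ℓ := by
    rw [sub_pos, div_lt_one (by linarith)]; linarith
  refine ⟨1 - 1 / ℓ, hx0, by simp, ?_⟩
  set x : ℝ := 1 - 1 / ℓ with hx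
  have hsq : (1 + x) ^ 2 = 4 * x * (1 + 1 / (4 * ℓ * (ℓ - 1))) := by
    rw [hx]; field_simp; ring
  have hexp : (1 + 1 / (4 * ℓ * (ℓ - 1)) : ℝ) ^ ℓ * x < 1 := by
    calc (1 + 1 / (4 * ℓ * (ℓ - 1)) : ℝ) ^ ℓ * x
        ≤ Real.exp (1 / (4 * ℓ * (ℓ - 1))) ^ ℓ * Real.exp (-(1 / ℓ)) := by
          gcongr
          · rw [add_comm]; exact Real.add_one_le_exp _
          · rw [hx, sub_eq_neg_add]; exact Real.add_one_le_exp _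
      _ = Real.exp (1 / (4 * (ℓ - 1)) - 1 / ℓ) := by
          rw [← Real.exp_nat_mul, ← Real.exp_add]
          congr 1
          field_simp
          ring
      _ < 1 := by
          rw [Real.exp_lt_one_iff, sub_neg]
          exact one_div_lt_one_div_of_lt (by linarith) (by linarith)
  calc (1 + x) ^ (2 * ℓ) = 4 ^ ℓ * x ^ (ℓ - 1) *
        ((1 + 1 / (4 * ℓ * (ℓ - 1)) : ℝ) ^ ℓ * x) := by
        rw [pow_mul, hsq, mul_pow, mul_pow]
        conv_lhs => rw [← Nat.sub_add_cancel (show 1 ≤ ℓ by omega), pow_succ x]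
        rw [Nat.sub_add_cancel (show 1 ≤ ℓ by omega)]
        ring
    _ < 4 ^ ℓ * x ^ (ℓ - 1) := mul_lt_of_lt_one_right (by positivity) hexp

theorem eventually_pow_succ_le_centralBinom {ℓ : ℕ} (hl : 0 < ℓ) {P : ℝ} (hP0 : 0 < P)
    (hP : P < 4 ^ ℓ) : ∀ᶠ m : ℕ in Filter.atTop, P ^ (m + 1) ≤ Nat.centralBinom (ℓ * m) := by
  have hlim := tendsto_pow_const_mul_const_pow_of_abs_lt_one 1 (r := P / 4 ^ ℓ)
    (by rw [abs_of_pos (by positivity), div_lt_one (by positivity)]; exact hP)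
  have hpos : (0 : ℝ) < 1 / (2 * ℓ * P) := by positivity
  filter_upwards [hlim.eventually (gt_mem_nhds hpos), Filter.eventually_gt_atTop 0] with m hm hm0
  have hcb : (4 : ℝ) ^ (ℓ * m) ≤ 2 * (ℓ * m) * Nat.centralBinom (ℓ * m) := by
    exact_mod_cast Nat.four_pow_le_two_mul_self_mul_centralBinom (ℓ * m) (Nat.mul_pos hl hm0)
  have hm0' : (0 : ℝ) < m := by exact_mod_cast hm0
  have hl' : (0 : ℝ) < ℓ := by exact_mod_cast hl
  rw [pow_one, div_pow, ← pow_mul, mul_div_assoc', div_lt_div_iff₀ (by positivity) (by positivity)]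
    at hm
  have : (2 * (ℓ * m)) * P ^ (m + 1) ≤ 2 * (ℓ * m) * (Nat.centralBinom (ℓ * m) : ℝ) := by
    refine le_trans (le_of_eq_of_le ?_ hm.le) ((one_mul _).le.trans hcb)
    ring
  exact le_of_mul_le_mul_left this (by positivity)

theorem exists_graph_of_le_centralBinom {ℓ m n : ℕ} (hm : 0 < m)
    (hn : n ≤ Nat.centralBinom (ℓ * m)) (hl : 0 < ℓ) {x : ℝ} (hx0 : 0 < x) (hx1 : x ≤ 1) :
    ∃ G : SimpleGraph (Fin n),
      (∀ (v : Fin n) (w : G.Walk v v), Odd w.length → ℓ < w.length) ∧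
      (minrk ℝ G : ℝ) ≤ ((1 + x) ^ (2 * ℓ) / x ^ (ℓ - 1)) ^ m := by
  obtain ⟨e⟩ : Nonempty (Fin n ↪
      (Finset.univ : Finset (Fin (2 * (ℓ * m)))).powersetCard (ℓ * m)) := by
    apply Function.Embedding.nonempty_of_card_le
    simpa [Nat.centralBinom] using hn
  let f : Fin n → Finset (Fin (2 * (ℓ * m))) := fun i => (e i).1
  have hf : ∀ i, (f i).card = ℓ * m := fun i => (Finset.mem_powersetCard.1 (e i).2).2
  refine ⟨smallInterGraph f m, fun v w hw => ?_, ?_⟩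
  · have h := (smallInterGraph_walk_bound (by simp) hf w).2 hw
    rw [Finset.inter_self, hf] at h
    by_contra! hle
    have h2 := Nat.mul_le_mul_right (m - 1) hle
    have h3 : ℓ * (m - 1) < ℓ * m := Nat.mul_lt_mul_of_pos_left (by omega) hl
    omega
  · have h1 := minrk_smallInterGraph_le (f := f) (Subtype.val_injective.comp e.injective)
      (Nat.le_mul_of_pos_left m hl) hf
    have h2 := card_card_le_mul_pow_le (α := Fin (2 * (ℓ * m))) (ℓ * m - m) hx0 hx1
    rw [Fintype.card_fin] at h2
    refine (Nat.cast_le.2 h1).trans ?_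
    rw [div_pow, le_div_iff₀ (by positivity), ← pow_mul, ← pow_mul, Nat.sub_mul, one_mul, mul_assoc]
    exact h2

/-- For every odd ℓ ≥ 3 there is δ > 0 such that for all sufficiently large n
there is an n-vertex graph G with no cycle of odd length at most ℓ and minrk_ℝ(G) ≤ n^{1-δ}. -/
theorem exists_no_short_odd_cycle_small_minrk (ℓ : ℕ) (hl3 : 3 ≤ ℓ) (hlodd : Odd ℓ) :
    ∃ δ : ℝ, 0 < δ ∧ ∃ N : ℕ, ∀ n : ℕ, N ≤ n →
      ∃ G : SimpleGraph (Fin n),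
        (∀ (v : Fin n) (w : G.Walk v v), w.IsCycle → Odd w.length → ¬ w.length ≤ ℓ) ∧
        (minrk ℝ G : ℝ) ≤ (n : ℝ) ^ ((1 : ℝ) - δ) := by
  obtain ⟨x, hx0, hx1, hx⟩ := exists_one_add_pow_lt (show 2 ≤ ℓ by omega)
  set Q : ℝ := (1 + x) ^ (2 * ℓ) / x ^ (ℓ - 1) with hQ
  have hQ1 : 1 ≤ Q := by
    rw [hQ, one_le_div (by positivity)]
    exact (pow_le_one₀ hx0.le hx1).trans (one_le_pow₀ (by linarith))
  obtain ⟨P, hQP, hP⟩ : ∃ P, Q < P ∧ P < (4 : ℝ) ^ ℓ :=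
    exists_between ((div_lt_iff₀ (by positivity)).2 hx)
  have hP0 : 0 < P := by linarith
  have hlogP : 0 < Real.log P := Real.log_pos (by linarith)
  obtain ⟨m₀, hm₀⟩ := Filter.eventually_atTop.1
    (eventually_pow_succ_le_centralBinom (show 0 < ℓ by omega) hP0 hP)
  refine ⟨1 - Real.log Q / Real.log P, ?_, Nat.centralBinom (ℓ * m₀) + 1, fun n hn => ?_⟩
  · rw [sub_pos, div_lt_one hlogP]
    exact Real.log_lt_log (by linarith) hQP
  have hmono : ∀ a b, a ≤ b → Nat.centralBinom (ℓ * a) ≤ Nat.centralBinom (ℓ * b) := fun a b h =>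
    Nat.centralBinom_strictMono.monotone (Nat.mul_le_mul_left ℓ h)
  have hex : ∃ m, n ≤ Nat.centralBinom (ℓ * m) :=
    ⟨n, (Nat.le_mul_of_pos_left n (by omega)).trans Nat.centralBinom_strictMono.le_apply⟩
  obtain ⟨m, hlt, hle⟩ : ∃ m, Nat.centralBinom (ℓ * m) < n ∧
      n ≤ Nat.centralBinom (ℓ * (m + 1)) := by
    have hne : Nat.find hex ≠ 0 := fun h => by
      have h1 := Nat.find_spec hex
      rw [h] at h1
      have := hmono 0 m₀ (Nat.zero_le _)
      omega
    obtain ⟨m, hm⟩ := Nat.exists_eq_succ_of_ne_zero hne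
    exact ⟨m, not_le.1 (Nat.find_min hex (by omega)), by
      rw [← Nat.succ_eq_add_one, ← hm]; exact Nat.find_spec hex⟩
  have hmm : m₀ ≤ m := by
    by_contra! h
    have := hmono (m + 1) m₀ h
    omega
  obtain ⟨G, hG, hrk⟩ := exists_graph_of_le_centralBinom m.succ_pos hle
    (show 0 < ℓ by omega) hx0 hx1
  refine ⟨G, fun v w _ hodd => not_le.2 (hG v w hodd), hrk.trans ?_⟩
  have hPn : P ^ (m + 1) ≤ (n : ℝ) := (hm₀ m hmm).trans (Nat.cast_le.2 hlt.le)
  have hPQ : P ^ (Real.log Q / Real.log P) = Q := by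
    rw [Real.rpow_def_of_pos hP0, mul_div_cancel₀ _ hlogP.ne', Real.exp_log (by linarith)]
  rw [sub_sub_cancel]
  calc Q ^ (m + 1) = (P ^ (m + 1)) ^ (Real.log Q / Real.log P) := by
        rw [← Real.rpow_natCast P, ← Real.rpow_mul hP0.le, mul_comm, Real.rpow_mul hP0.le, hPQ,
          Real.rpow_natCast]
    _ ≤ (n : ℝ) ^ (Real.log Q / Real.log P) :=
        Real.rpow_le_rpow (by positivity) hPn (div_nonneg (Real.log_nonneg hQ1) hlogP.le)
end

section
/- For every non-bipartite graph H there exists δ = δ(H) > 0 such that for every sufficiently large integer n there exists an H-free graph G on n vertices with minrk_ℝ(G) ≤ n^{1−δ}. -/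
open Matrix

open Finset in
/-- The coefficients of `t ↦ choose (t - m) k` in the basis `t ↦ choose t i`, summed over the
subsets of a set `X` of size `t`. -/
lemma sum_subset_choose_neg {α : Type*} [Fintype α] [DecidableEq α] (X : Finset α) (m k : ℕ)
    (hm : m ≤ #X) :
    ∑ S : {S : Finset α // #S ≤ k}, (if S.1 ⊆ X then Ring.choose (-(m : ℤ)) (k - #S.1) else 0) =
      ((#X - m).choose k : ℤ) := by
  have hchoose : ((#X - m).choose k : ℤ) =
      ∑ i ∈ range (k + 1), ((#X).choose i : ℤ) * Ring.choose (-(m : ℤ)) (k - i) := by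
    rw [← Ring.choose_natCast, Nat.cast_sub hm, sub_eq_add_neg,
      Ring.add_choose_eq k (Commute.all _ _),
      Finset.Nat.sum_antidiagonal_eq_sum_range_succ
        (fun i j => Ring.choose (#X : ℤ) i * Ring.choose (-(m : ℤ)) j)]
    simp [Ring.choose_natCast]
  rw [hchoose, ← Finset.sum_subtype (univ.filter fun S : Finset α => #S ≤ k) (by simp)
    (fun S => if S ⊆ X then Ring.choose (-(m : ℤ)) (k - #S) else 0), ← Finset.sum_filter,
    ← Finset.sum_fiberwise_of_maps_to (g := fun S => #S) (t := range (k + 1))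
      (by intro S hS; simp at hS ⊢; omega)]
  refine Finset.sum_congr rfl fun i hi => ?_
  have hfilter : (filter (fun S => #S = i) (filter (fun S => S ⊆ X)
      (filter (fun S : Finset α => #S ≤ k) univ))) = powersetCard i X := by
    ext S
    simp only [mem_filter, mem_univ, true_and, mem_powersetCard, mem_range] at hi ⊢
    constructor
    · rintro ⟨⟨-, h1⟩, h2⟩
      exact ⟨h1, h2⟩
    · rintro ⟨h1, h2⟩
      exact ⟨⟨by omega, h1⟩, h2⟩
  rw [hfilter, Finset.sum_congr rfl (g := fun _ => Ring.choose (-(m : ℤ)) (k - i))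
    (fun S hS => by rw [(mem_powersetCard.1 hS).2])]
  simp

open Finset in
/-- The graph on the index set of a family of finite sets in which two indices are adjacent when
their sets meet in fewer than `m` points (a generalized Kneser graph). -/
def smallIntersectionGraph {V α : Type*} [DecidableEq α] (e : V → Finset α) (m : ℕ) :
    SimpleGraph V where
  Adj u v := u ≠ v ∧ #(e u ∩ e v) < m
  symm := ⟨fun _ _ h => ⟨h.1.symm, by rw [inter_comm]; exact h.2⟩⟩
  loopless := ⟨fun _ h => h.1 rfl⟩

lemma minrk_le_of_represents {F V : Type*} [Field F] [Fintype V] {G : SimpleGraph V}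
    {M : Matrix V V F} (hM : Represents M G) : minrk F G ≤ M.rank :=
  Nat.sInf_le ⟨M, hM, rfl⟩

open Finset in
lemma minrk_smallIntersectionGraph_le {V α : Type*} [Fintype V] [Fintype α] [DecidableEq α]
    {e : V → Finset α} (he : Function.Injective e) {s m : ℕ} (hs : ∀ v, #(e v) = s)
    (hm : m ≤ s) :
    minrk ℝ (smallIntersectionGraph e m) ≤ Fintype.card {S : Finset α // #S ≤ s - m} := by
  let P : Matrix V {S : Finset α // #S ≤ s - m} ℝ := fun u S =>
    if S.1 ⊆ e u then ((Ring.choose (-(m : ℤ)) (s - m - #S.1) : ℤ) : ℝ) else 0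
  let Q : Matrix {S : Finset α // #S ≤ s - m} V ℝ := fun S v => if S.1 ⊆ e v then 1 else 0
  have hPQ : ∀ u v, m ≤ #(e u ∩ e v) →
      (P * Q) u v = ((#(e u ∩ e v) - m).choose (s - m) : ℝ) := by
    intro u v huv
    have h := congrArg (Int.cast : ℤ → ℝ) (sum_subset_choose_neg (e u ∩ e v) m (s - m) huv)
    push_cast at h
    rw [← h, Matrix.mul_apply]
    refine Finset.sum_congr rfl fun S _ => ?_
    simp only [P, Q, subset_inter_iff]
    by_cases h1 : S.1 ⊆ e u <;> by_cases h2 : S.1 ⊆ e v <;> simp [h1, h2]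
  have hrep : Represents (P * Q) (smallIntersectionGraph e m) := by
    refine ⟨fun v => ?_, fun u v huv hadj => ?_⟩
    · rw [hPQ v v (by simpa [hs] using hm)]
      simp [hs]
    · have hmi : m ≤ #(e u ∩ e v) := by
        by_contra hlt
        exact hadj ⟨huv, not_le.1 hlt⟩
      rw [hPQ u v hmi]
      have hlt : #(e u ∩ e v) < s := by
        refine lt_of_le_of_ne ((card_le_card inter_subset_left).trans (hs u).le) fun heq => ?_
        have h1 := eq_of_subset_of_card_le (inter_subset_left : e u ∩ e v ⊆ e u)
          (by rw [hs, heq])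
        have h2 := eq_of_subset_of_card_le (inter_subset_right : e u ∩ e v ⊆ e v)
          (by rw [hs, heq])
        exact huv (he (h1.symm.trans h2))
      rw [Nat.choose_eq_zero_of_lt (by omega), Nat.cast_zero]
  exact (minrk_le_of_represents hrep).trans
    ((Matrix.rank_mul_le_left P Q).trans (Matrix.rank_le_card_width P))

open Finset in
/-- Along a walk in the graph of nearly disjoint `s`-subsets of a `2s`-set, the sets alternate
between being nearly contained in the first set and being nearly disjoint from it. -/
lemma card_le_of_walk_smallIntersectionGraph {V α : Type*} [Fintype α] [DecidableEq α]
    {e : V → Finset α} {s m : ℕ} (hs : ∀ v, #(e v) = s) (hα : Fintype.card α = 2 * s)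
    {u v : V} (w : (smallIntersectionGraph e (m + 1)).Walk u v) :
    (Even w.length → #(e u \ e v) ≤ w.length * m) ∧
      (Odd w.length → #(e u ∩ e v) ≤ w.length * m) := by
  induction w with
  | nil => simp
  | @cons a b c hab w ih =>
    have hlt : #(e a ∩ e b) ≤ m := Nat.lt_succ_iff.1 hab.2
    have hlen : (w.length + 1) * m = w.length * m + m := by ring
    rw [SimpleGraph.Walk.length_cons, hlen]
    constructor
    · intro hev
      have hodd : Odd w.length := by
        rcases Nat.even_or_odd w.length with h | h
        · exact absurd hev (by simpa [Nat.even_add_one] using h)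
        · exact h
      have hi := ih.2 hodd
      have hsub : e a \ e c ⊆ (e a ∩ e b) ∪ (e b ∪ e c)ᶜ := by
        intro x
        simp only [mem_sdiff, mem_union, mem_inter, mem_compl]
        tauto
      have h1 := (card_le_card hsub).trans (card_union_le _ _)
      have h2 := card_union_add_card_inter (e b) (e c)
      have h3 := card_compl_add_card (e b ∪ e c)
      rw [hs, hs] at h2
      omega
    · intro hodd
      have hev : Even w.length := by
        rcases Nat.even_or_odd w.length with h | h
        · exact h
        · exact absurd hodd (by simpa [Nat.odd_add_one] using h)
      have hi := ih.1 hev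
      have hsub : e a ∩ e c ⊆ (e a ∩ e b) ∪ (e c \ e b) := by
        intro x
        simp only [mem_sdiff, mem_union, mem_inter]
        tauto
      have h1 := (card_le_card hsub).trans (card_union_le _ _)
      have h2 := card_sdiff_comm ((hs b).trans (hs c).symm)
      omega

open Finset in
/-- Chernoff-type bound on the number of subsets of size at most `k`. -/
lemma card_subsets_card_le_le {α : Type*} [Fintype α] (k : ℕ) {x : ℝ} (hx : 0 < x)
    (hx1 : x ≤ 1) :
    (Fintype.card {S : Finset α // #S ≤ k} : ℝ) ≤ (1 + x) ^ Fintype.card α / x ^ k := by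
  classical
  rw [le_div_iff₀ (pow_pos hx k), Fintype.card_subtype, ← nsmul_eq_mul, ← Finset.sum_const]
  calc ∑ S : Finset α with #S ≤ k, x ^ k ≤ ∑ S : Finset α with #S ≤ k, x ^ #S := by
        refine Finset.sum_le_sum fun S hS => ?_
        exact pow_le_pow_of_le_one hx.le hx1 (mem_filter.1 hS).2
    _ ≤ ∑ S : Finset α, x ^ #S :=
        Finset.sum_le_sum_of_subset_of_nonneg (filter_subset _ _) fun _ _ _ => by positivity
    _ = (1 + x) ^ Fintype.card α := by
        have h := Fintype.sum_pow_mul_eq_add_pow α x 1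
        simpa [add_comm] using h

/-- The base of the rank bound can be made smaller than `4 ^ (l + 1)`. -/
lemma exists_chernoff_base_lt (l : ℕ) :
    ∃ x : ℝ, 0 < x ∧ x ≤ 1 ∧ (1 + x) ^ (2 * (l + 1)) / x ^ l < 4 ^ (l + 1) := by
  let t : ℝ := 1 / (2 * ((l : ℝ) + 1))
  have ht0 : 0 < t := by positivity
  have hlt : ((l : ℝ) + 1) * t = 1 / 2 := by
    simp only [t]
    field_simp
  have ht1 : t ≤ 1 / 2 := by
    have : (0 : ℝ) ≤ l * t := by positivity
    nlinarith
  have hx0 : 0 < 1 - t := by linarith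
  refine ⟨1 - t, hx0, by linarith, ?_⟩
  have hbase : (1 + (1 - t)) ^ 2 ≤ 4 * (1 - t) * Real.exp (t ^ 2 / 2) := by
    have h1 : 1 + t ^ 2 / 2 ≤ Real.exp (t ^ 2 / 2) := by
      linarith [Real.add_one_le_exp (t ^ 2 / 2)]
    have h2 : 4 * (1 - t) * (1 + t ^ 2 / 2) ≤ 4 * (1 - t) * Real.exp (t ^ 2 / 2) := by gcongr
    refine le_trans ?_ h2
    nlinarith [mul_nonneg (sq_nonneg t) (sub_nonneg.2 ht1)]
  have hpow : (1 + (1 - t)) ^ (2 * (l + 1)) ≤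
      4 ^ (l + 1) * (1 - t) ^ (l + 1) * Real.exp (t / 4) := by
    rw [pow_mul]
    refine (pow_le_pow_left₀ (by positivity) hbase (l + 1)).trans_eq ?_
    rw [mul_pow, mul_pow, ← Real.exp_nat_mul]
    congr 2
    push_cast
    linear_combination (t / 2) * hlt
  have hexp : (1 - t) * Real.exp (t / 4) < 1 := by
    have h1 : 1 - t ≤ Real.exp (-t) := by linarith [Real.add_one_le_exp (-t)]
    calc (1 - t) * Real.exp (t / 4) ≤ Real.exp (-t) * Real.exp (t / 4) := by gcongr
      _ = Real.exp (-t + t / 4) := (Real.exp_add _ _).symm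
      _ < 1 := by
        rw [Real.exp_lt_one_iff]
        linarith
  rw [div_lt_iff₀ (pow_pos hx0 l)]
  calc (1 + (1 - t)) ^ (2 * (l + 1)) ≤ 4 ^ (l + 1) * (1 - t) ^ (l + 1) * Real.exp (t / 4) := hpow
    _ = 4 ^ (l + 1) * (1 - t) ^ l * ((1 - t) * Real.exp (t / 4)) := by ring
    _ < 4 ^ (l + 1) * (1 - t) ^ l * 1 := by gcongr
    _ = 4 ^ (l + 1) * (1 - t) ^ l := mul_one _

/-- Central binomial coefficients `centralBinom (L * m)` eventually exceed `b ^ (m + 1)` for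
every `b < 4 ^ L`. -/
lemma eventually_pow_succ_le_centralBinom_s15 {L : ℕ} (hL : 0 < L) {b : ℝ} (hb : 0 < b)
    (hbL : b < 4 ^ L) :
    ∀ᶠ m : ℕ in Filter.atTop, b ^ (m + 1) ≤ ((L * m).centralBinom : ℝ) := by
  have hr : b / 4 ^ L < 1 := (div_lt_one (by positivity)).2 hbL
  have ht := (tendsto_self_mul_const_pow_of_lt_one (by positivity) hr).const_mul (2 * L * b)
  rw [mul_zero] at ht
  filter_upwards [ht.eventually_lt_const one_pos, Filter.eventually_gt_atTop 0] with m hm hm0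
  have h4 : ((4 : ℝ) ^ L) ^ m ≤ 2 * (L * m) * (L * m).centralBinom := by
    rw [← pow_mul]
    exact_mod_cast Nat.four_pow_le_two_mul_self_mul_centralBinom (L * m) (Nat.mul_pos hL hm0)
  have hpos : (0 : ℝ) < 2 * (L * m) := by positivity
  rw [div_pow, mul_div_assoc', mul_div_assoc', div_lt_one (by positivity)] at hm
  refine le_of_mul_le_mul_left ?_ hpos
  calc 2 * (L * m) * b ^ (m + 1) = 2 * L * b * (m * b ^ m) := by ring
    _ ≤ _ := hm.le.trans h4

lemma exists_centralBinom_lt_le {L : ℕ} (hL : 0 < L) (k n : ℕ)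
    (hn : (L * k).centralBinom < n) :
    ∃ m, k ≤ m ∧ (L * m).centralBinom < n ∧ n ≤ (L * (m + 1)).centralBinom := by
  classical
  have hex : ∃ j, n ≤ (L * (k + j)).centralBinom := by
    refine ⟨n, ?_⟩
    have h1 : n ≤ L * (k + n) := by nlinarith
    rw [Nat.centralBinom]
    rcases Nat.eq_zero_or_pos n with rfl | hn0
    · exact Nat.zero_le _
    · have h2 := Nat.choose_le_centralBinom 1 (L * (k + n))
      rw [Nat.choose_one_right] at h2
      exact le_trans (by omega) h2
  obtain ⟨j, hj⟩ : ∃ j, Nat.find hex = j + 1 := by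
    refine Nat.exists_eq_succ_of_ne_zero fun h0 => ?_
    have h := Nat.find_spec hex
    rw [h0, add_zero] at h
    omega
  refine ⟨k + j, Nat.le_add_right _ _, ?_, ?_⟩
  · exact not_le.1 (Nat.find_min hex (by omega))
  · have h := Nat.find_spec hex
    rw [hj] at h
    exact h

open Finset in
lemma exists_injective_card_eq {n s d : ℕ} (hn : n ≤ d.choose s) :
    ∃ e : Fin n → Finset (Fin d), Function.Injective e ∧ ∀ v, #(e v) = s := by
  have hcard : Fintype.card (Fin n) ≤ Fintype.card {S : Finset (Fin d) // #S = s} := by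
    simpa using hn
  obtain ⟨f⟩ := Function.Embedding.nonempty_of_card_le hcard
  exact ⟨fun v => (f v).1, Subtype.val_injective.comp f.injective, fun v => (f v).2⟩

/-- For every non-bipartite graph H there is δ > 0 such that for all sufficiently
large n there is an H-free n-vertex graph G with minrk_ℝ(G) ≤ n^{1-δ}. -/
theorem exists_H_free_small_minrk {h : ℕ} (H : SimpleGraph (Fin h))
    (hH : ¬ H.Colorable 2) :
    ∃ δ : ℝ, 0 < δ ∧ ∃ N : ℕ, ∀ n : ℕ, N ≤ n →
      ∃ G : SimpleGraph (Fin n), ¬ ContainsCopy H G ∧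
        (minrk ℝ G : ℝ) ≤ (n : ℝ) ^ ((1 : ℝ) - δ) := by
  rw [SimpleGraph.two_colorable_iff_forall_loop_even] at hH
  push Not at hH
  obtain ⟨a, w, hw⟩ := hH
  have hwodd : Odd w.length := Nat.not_even_iff_odd.1 hw
  obtain ⟨l, hl⟩ : ∃ l, w.length = l + 1 :=
    Nat.exists_eq_succ_of_ne_zero fun h0 => hw (by simp [h0])
  obtain ⟨x, hx0, hx1, hc⟩ := exists_chernoff_base_lt l
  set c : ℝ := (1 + x) ^ (2 * (l + 1)) / x ^ l with hcdef
  have hc1 : 1 < c := by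
    rw [hcdef, one_lt_div (by positivity)]
    exact (pow_le_one₀ hx0.le hx1).trans_lt (one_lt_pow₀ (by linarith) (by omega))
  obtain ⟨b, hcb, hb4⟩ := exists_between hc
  have hlogc : 0 < Real.log c := Real.log_pos hc1
  have hlogcb : Real.log c < Real.log b := Real.log_lt_log (by linarith) hcb
  have hlogb : 0 < Real.log b := hlogc.trans hlogcb
  refine ⟨1 - Real.log c / Real.log b, sub_pos.2 ((div_lt_one hlogb).2 hlogcb), ?_⟩
  obtain ⟨k, hk⟩ := Filter.eventually_atTop.1
    (eventually_pow_succ_le_centralBinom_s15 l.succ_pos (by linarith) hb4)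
  refine ⟨((l + 1) * k).centralBinom + 1, fun n hn => ?_⟩
  obtain ⟨m, hkm, hmn, hnm⟩ := exists_centralBinom_lt_le l.succ_pos k n hn
  obtain ⟨e, he, hes⟩ := exists_injective_card_eq (s := (l + 1) * (m + 1)) hnm
  refine ⟨smallIntersectionGraph e (m + 1), ?_, ?_⟩
  · rintro ⟨f, -, hf⟩
    let φ : H →g smallIntersectionGraph e (m + 1) := ⟨f, fun {a b} hab => hf a b hab⟩
    have hwalk := (card_le_of_walk_smallIntersectionGraph hes (by simp) (w.map φ)).2
      (by simpa using hwodd)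
    rw [Finset.inter_self, hes, SimpleGraph.Walk.length_map, hl] at hwalk
    nlinarith
  · have hrank := minrk_smallIntersectionGraph_le he hes (Nat.le_mul_of_pos_left (m + 1) l.succ_pos)
    have hsub : (l + 1) * (m + 1) - (m + 1) = l * (m + 1) := by
      rw [Nat.succ_mul, Nat.add_sub_cancel]
    rw [hsub] at hrank
    have hrpow : c = b ^ (Real.log c / Real.log b) := by
      rw [Real.rpow_def_of_pos (by linarith), mul_div_cancel₀ _ hlogb.ne',
        Real.exp_log (by linarith)]
    calc (minrk ℝ (smallIntersectionGraph e (m + 1)) : ℝ)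
        ≤ (1 + x) ^ (2 * ((l + 1) * (m + 1))) / x ^ (l * (m + 1)) := by
          have hT := card_subsets_card_le_le (α := Fin (2 * ((l + 1) * (m + 1))))
            (l * (m + 1)) hx0 hx1
          rw [Fintype.card_fin] at hT
          exact le_trans (by exact_mod_cast hrank) hT
      _ = c ^ (m + 1) := by
          rw [hcdef, div_pow, ← pow_mul, ← pow_mul, mul_assoc]
      _ = (b ^ (m + 1)) ^ (Real.log c / Real.log b) := by
          rw [← Real.rpow_pow_comm (by linarith), ← hrpow]
      _ ≤ (n : ℝ) ^ (Real.log c / Real.log b) := by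
          refine Real.rpow_le_rpow (pow_nonneg (by linarith) _) ?_ (by positivity)
          exact (hk m hkm).trans (by exact_mod_cast hmn.le)
      _ = (n : ℝ) ^ ((1 : ℝ) - (1 - Real.log c / Real.log b)) := by
          rw [sub_sub_cancel]
end

section
/- For every non-bipartite graph H there exists δ = δ(H) > 0 such that for every sufficiently large integer n there exists a graph G on n vertices whose complement is H-free and which satisfies minrk_ℝ(G) ≥ n^{δ}. -/
open Matrix

theorem Matrix.rank_add_le_rank_add_rank {F m n : Type*} [Field F] [Fintype m] [Fintype n]
    (A B : Matrix m n F) :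
    (A + B).rank ≤ A.rank + B.rank := by
  unfold Matrix.rank
  rw [mulVecLin_add]
  refine (Submodule.finrank_mono (t := LinearMap.range A.mulVecLin ⊔ LinearMap.range B.mulVecLin)
    ?_).trans (Submodule.finrank_add_le_finrank_add_finrank _ _)
  rintro _ ⟨v, rfl⟩
  exact Submodule.add_mem_sup ⟨v, rfl⟩ ⟨v, rfl⟩

/-- If the Hadamard product of `M` with a sum of `#T` rank-one matrices is diagonal with nonzero
diagonal entries, then `M` has rank at least `card V / #T`. -/
theorem card_le_card_mul_rank {F V ι : Type*} [Field F] [Fintype V] [DecidableEq V]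
    (M : Matrix V V F) (T : Finset ι) (u v : ι → V → F)
    (hdiag : ∀ i, M i i * ∑ s ∈ T, u s i * v s i ≠ 0)
    (hoff : ∀ i j, i ≠ j → M i j * ∑ s ∈ T, u s i * v s j = 0) :
    Fintype.card V ≤ T.card * M.rank := by
  have hrank : ∀ S : Finset ι,
      (∑ s ∈ S, diagonal (u s) * M * diagonal (v s)).rank ≤ S.card * M.rank := by
    classical
    intro S
    induction S using Finset.induction_on with
    | empty => simp
    | insert a S ha ih =>
      rw [Finset.sum_insert ha, Finset.card_insert_of_notMem ha, add_mul, one_mul, add_comm]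
      refine (rank_add_le_rank_add_rank _ _).trans (add_le_add ih ?_)
      exact (rank_mul_le_left _ _).trans (rank_mul_le_right _ _)
  have hsum : ∑ s ∈ T, diagonal (u s) * M * diagonal (v s) =
      diagonal fun i => M i i * ∑ s ∈ T, u s i * v s i := by
    ext i j
    have hentry : (∑ s ∈ T, diagonal (u s) * M * diagonal (v s)) i j =
        M i j * ∑ s ∈ T, u s i * v s j := by
      rw [Matrix.sum_apply, Finset.mul_sum]
      refine Finset.sum_congr rfl fun s _ => ?_
      rw [mul_diagonal, diagonal_mul]
      ring
    rw [hentry]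
    by_cases hij : i = j
    · subst hij
      simp
    · rw [hoff i j hij, diagonal_apply_ne _ hij]
  classical
  have h := hrank T
  rw [hsum, rank_diagonal] at h
  refine le_trans (le_of_eq ?_) h
  exact (Fintype.card_congr (Equiv.subtypeUnivEquiv hdiag)).symm

theorem prod_symmDiff_singleton {ι R : Type*} [DecidableEq ι] [CommMonoid R] (z : ι → R) (i : ι)
    (hz : z i * z i = 1) (S : Finset ι) :
    ∏ j ∈ symmDiff S {i}, z j = z i * ∏ j ∈ S, z j := by
  by_cases hi : i ∈ S
  · have hS : symmDiff S {i} = S.erase i := by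
      ext j
      by_cases hj : j = i <;> simp [Finset.mem_symmDiff, hj, hi]
    rw [hS, ← Finset.mul_prod_erase S z hi, ← mul_assoc, hz, one_mul]
  · have hS : symmDiff S {i} = insert i S := by
      ext j
      by_cases hj : j = i <;> simp [Finset.mem_symmDiff, hj, hi]
    rw [hS, Finset.prod_insert hi]

/-- A product of `k` affine functions of `∑ i, z i` is, on vectors with entries `±1`, a multilinear
polynomial of degree at most `k`. -/
theorem exists_multilinear_prod {ι : Type*} [Fintype ι] [DecidableEq ι] (a : ℕ → ℝ) (b : ℝ)
    (k : ℕ) :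
    ∃ c : Finset ι → ℝ, (∀ S, k < S.card → c S = 0) ∧ ∀ z : ι → ℝ, (∀ i, z i * z i = 1) →
      ∏ j ∈ Finset.range k, (a j + b * ∑ i, z i) = ∑ S, c S * ∏ i ∈ S, z i := by
  induction k with
  | zero =>
    refine ⟨fun S => if S = ∅ then 1 else 0, fun S hS => ?_, fun z _ => ?_⟩
    · refine if_neg ?_
      rintro rfl
      simp at hS
    · simp
  | succ k ih =>
    obtain ⟨c, hc, hprod⟩ := ih
    refine ⟨fun S => a k * c S + b * ∑ i, c (symmDiff S {i}), fun S hS => ?_, fun z hz => ?_⟩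
    · have hzero : ∀ i, c (symmDiff S {i}) = 0 := by
        intro i
        apply hc
        have hsub : S ⊆ insert i (symmDiff S {i}) := by
          intro j hj
          by_cases hji : j = i <;> simp [Finset.mem_symmDiff, hj, hji]
        have := (Finset.card_le_card hsub).trans (Finset.card_insert_le _ _)
        omega
      simp [hc S (by omega), hzero]
    · have hshift : ∀ i, ∑ S, c (symmDiff S {i}) * ∏ j ∈ S, z j =
          z i * ∑ S, c S * ∏ j ∈ S, z j := by
        intro i
        have hinv : Function.Involutive fun S : Finset ι => symmDiff S {i} :=
          fun S => symmDiff_symmDiff_cancel_right _ _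
        rw [Finset.mul_sum]
        refine Fintype.sum_equiv hinv.toPerm _ _ fun S => ?_
        change _ = z i * (c (symmDiff S {i}) * ∏ j ∈ symmDiff S {i}, z j)
        rw [prod_symmDiff_singleton z i (hz i)]
        linear_combination (-(c (symmDiff S {i}) * ∏ j ∈ S, z j)) * hz i
      rw [Finset.prod_range_succ, hprod z hz]
      have hexpand : ∀ S, (a k * c S + b * ∑ i, c (symmDiff S {i})) * ∏ j ∈ S, z j =
          a k * (c S * ∏ j ∈ S, z j) + b * ∑ i, c (symmDiff S {i}) * ∏ j ∈ S, z j := by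
        intro S
        rw [← Finset.sum_mul]
        ring
      simp_rw [hexpand]
      rw [Finset.sum_add_distrib, ← Finset.mul_sum, ← Finset.mul_sum, Finset.sum_comm]
      simp_rw [hshift]
      rw [← Finset.sum_mul]
      ring

/-- A Chernoff-type bound for the number of subsets of size at most `k`. -/
theorem card_filter_card_le_mul_pow_le {ι : Type*} [Fintype ι] (x : ℝ) (hx0 : 0 ≤ x)
    (hx1 : x ≤ 1) (k : ℕ) :
    ((Finset.univ.filter fun S : Finset ι => S.card ≤ k).card : ℝ) * x ^ k ≤
      (1 + x) ^ Fintype.card ι := by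
  rw [add_comm, ← Fintype.sum_pow_mul_eq_add_pow ι x 1, ← nsmul_eq_mul, ← Finset.sum_const]
  calc _ ≤ ∑ S : Finset ι with S.card ≤ k, x ^ S.card * 1 ^ (Fintype.card ι - S.card) := by
        refine Finset.sum_le_sum fun S hS => ?_
        rw [one_pow, mul_one]
        exact pow_le_pow_of_le_one hx0 hx1 (Finset.mem_filter.1 hS).2
    _ ≤ _ := by
        refine Finset.sum_le_sum_of_subset_of_nonneg (Finset.subset_univ _) fun S _ _ => ?_
        positivity

theorem exists_pow_lt_two_pow_mul_pow (q : ℕ) (hq : 1 ≤ q) :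
    ∃ x : ℝ, 0 < x ∧ x ≤ 1 ∧ (1 + x) ^ (2 * q + 1) < 2 ^ (2 * q + 1) * x ^ q := by
  have hq' : (1 : ℝ) ≤ q := by exact_mod_cast hq
  set x : ℝ := q / (q + 1) with hx
  have hx0 : 0 < x := by positivity
  set y : ℝ := (2 * q + 1) / (2 * (q + 1)) with hy
  have hy0 : 0 < y := by positivity
  have hxy : 1 + x = 2 * y := by rw [hx, hy]; field_simp; ring
  have hw : x = y ^ 2 * (1 + -(1 / (2 * q + 1)) ^ 2) := by
    rw [hx, hy]; field_simp; ring
  have hbern := one_add_mul_le_pow (a := -(1 / (2 * (q : ℝ) + 1)) ^ 2) (by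
    have : (1 / (2 * (q : ℝ) + 1)) ^ 2 ≤ 1 := by
      apply pow_le_one₀ (by positivity)
      rw [div_le_one (by positivity)]
      linarith
    linarith) q
  have hlt : y < 1 + q * -(1 / (2 * (q : ℝ) + 1)) ^ 2 := by
    rw [hy, ← sub_pos]
    have : 1 + q * -(1 / (2 * (q : ℝ) + 1)) ^ 2 - (2 * q + 1) / (2 * (q + 1)) =
        (2 * q ^ 2 + 2 * q + 1) / ((2 * q + 1) ^ 2 * (2 * (q + 1))) := by
      field_simp; ring
    rw [this]
    positivity
  refine ⟨x, hx0, (div_le_one (by positivity)).2 (by linarith), ?_⟩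
  rw [hxy, mul_pow]
  refine mul_lt_mul_of_pos_left ?_ (by positivity)
  rw [pow_succ, pow_mul, hw, mul_pow]
  exact mul_lt_mul_of_pos_left (hlt.trans_le hbern) (by positivity)

theorem card_symmDiff_le_add {ι : Type*} [DecidableEq ι] (A B C : Finset ι) :
    (symmDiff A C).card ≤ (symmDiff A B).card + (symmDiff B C).card :=
  (Finset.card_le_card (symmDiff_triangle A B C)).trans (Finset.card_union_le _ _)

theorem card_symmDiff_perimeter_le {ι : Type*} [Fintype ι] [DecidableEq ι] (A B C : Finset ι) :
    (symmDiff A B).card + (symmDiff B C).card + (symmDiff A C).card ≤ 2 * Fintype.card ι := by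
  have h := card_symmDiff_le_add A Bᶜ C
  have h1 : symmDiff A Bᶜ = (symmDiff A B)ᶜ := by
    ext j; simp only [Finset.mem_symmDiff, Finset.mem_compl]; tauto
  have h2 : symmDiff Bᶜ C = (symmDiff B C)ᶜ := by
    ext j; simp only [Finset.mem_symmDiff, Finset.mem_compl]; tauto
  rw [h1, h2, Finset.card_compl, Finset.card_compl] at h
  have := Finset.card_le_univ (symmDiff A B)
  have := Finset.card_le_univ (symmDiff B C)
  omega

/-- If the endpoints of every edge are mapped to nearly complementary sets, then endpoints of even
walks are mapped to close sets, and endpoints of odd walks to nearly complementary sets. -/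
theorem walk_card_symmDiff {W ι : Type*} [Fintype ι] [DecidableEq ι] {H : SimpleGraph W}
    (A : W → Finset ι) (s : ℕ)
    (hA : ∀ a b, H.Adj a b → Fintype.card ι ≤ (symmDiff (A a) (A b)).card + s)
    {u v : W} (p : H.Walk u v) :
    (Even p.length → (symmDiff (A u) (A v)).card ≤ p.length * s) ∧
      (Odd p.length → Fintype.card ι ≤ (symmDiff (A u) (A v)).card + p.length * s) := by
  induction p with
  | nil => simp
  | @cons u w v huw p ih =>
    have huw' := hA u w huw
    have h1 := card_symmDiff_le_add (A u) (A v) (A w)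
    have h2 := card_symmDiff_perimeter_le (A u) (A w) (A v)
    rw [symmDiff_comm (A v) (A w)] at h1
    rw [SimpleGraph.Walk.length_cons, add_mul, one_mul]
    constructor
    · intro h
      have := ih.2 (by grind)
      omega
    · intro h
      have := ih.1 (by grind)
      omega

theorem even_card_symmDiff {ι : Type*} [DecidableEq ι] {A B : Finset ι} (hA : Even A.card)
    (hB : Even B.card) : Even (symmDiff A B).card := by
  have h1 := Finset.card_sdiff_add_card_inter A B
  have h2 := Finset.card_sdiff_add_card_inter B A
  rw [Finset.inter_comm] at h2
  have h3 : (symmDiff A B).card = (A \ B).card + (B \ A).card :=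
    Finset.card_union_of_disjoint disjoint_sdiff_sdiff
  rw [h3]
  grind

/-- Any `2 ^ m` points embed into the even-size subsets of a set of size `m + 1`. -/
theorem exists_injective_even_card {n m : ℕ} (hn : n ≤ 2 ^ m) :
    ∃ e : Fin n → Finset (Option (Fin m)), Function.Injective e ∧ ∀ i, Even (e i).card := by
  obtain ⟨f⟩ : Nonempty (Fin n ↪ Finset (Fin m)) :=
    Function.Embedding.nonempty_of_card_le (by simpa using hn)
  let g : Finset (Fin m) → Finset (Option (Fin m)) := fun A =>
    if Even A.card then A.map Function.Embedding.some else A.insertNone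
  have hg : ∀ A, (g A).eraseNone = A := by
    intro A
    by_cases hA : Even A.card <;> simp [g, hA]
  refine ⟨fun i => g (f i), fun i j hij => f.injective ?_, fun i => ?_⟩
  · rw [← hg (f i), ← hg (f j)]
    exact congrArg _ hij
  · by_cases hA : Even (f i).card
    · simp [g, hA]
    · simp [g, hA, Nat.even_add_one]

/-- If the sets `e i` have even size and `M i j` vanishes whenever the symmetric difference of
`e i` and `e j` has more than `2 * k` elements, then the rank of `M` is large. -/
theorem le_card_filter_mul_rank {V ι : Type*} [Fintype V] [Fintype ι] [DecidableEq ι]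
    (e : V → Finset ι) (he : Function.Injective e) (heven : ∀ i, Even (e i).card) (k : ℕ)
    (M : Matrix V V ℝ) (hdiag : ∀ i, M i i ≠ 0)
    (hoff : ∀ i j, 2 * k < (symmDiff (e i) (e j)).card → M i j = 0) :
    Fintype.card V ≤ (Finset.univ.filter fun S : Finset ι => S.card ≤ k).card * M.rank := by
  classical
  obtain ⟨c, hc, hprod⟩ := exists_multilinear_prod (ι := ι)
    (fun j => (Fintype.card ι : ℝ) / 2 - (2 * j + 2)) (-1 / 2) k
  let ε : ι → V → ℝ := fun i v => if i ∈ e v then -1 else 1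
  have hε : ∀ i v, ε i v * ε i v = 1 := by
    intro i v
    by_cases h : i ∈ e v <;> simp [ε, h]
  have hdist : ∀ v w, ∑ i, ε i v * ε i w =
      Fintype.card ι - 2 * ((symmDiff (e v) (e w)).card : ℝ) := by
    intro v w
    have : ∀ i, ε i v * ε i w = 1 - 2 * if i ∈ symmDiff (e v) (e w) then (1 : ℝ) else 0 := by
      intro i
      by_cases h : i ∈ e v <;> by_cases h' : i ∈ e w <;>
        simp [ε, h, h', Finset.mem_symmDiff] <;> norm_num
    simp_rw [this]
    simp [mul_comm]
  have hpoly : ∀ v w, ∑ S : Finset ι with S.card ≤ k,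
      (c S * ∏ i ∈ S, ε i v) * ∏ i ∈ S, ε i w =
      ∏ j ∈ Finset.range k, (((symmDiff (e v) (e w)).card : ℝ) - (2 * j + 2)) := by
    intro v w
    have h := hprod (fun i => ε i v * ε i w) fun i => by
      rw [mul_mul_mul_comm, hε, hε, one_mul]
    rw [hdist] at h
    calc _ = ∑ S, c S * ∏ i ∈ S, ε i v * ε i w := by
          rw [Finset.sum_filter]
          refine Finset.sum_congr rfl fun S _ => ?_
          split_ifs with hS
          · rw [Finset.prod_mul_distrib, mul_assoc]
          · rw [hc S (not_le.1 hS), zero_mul]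
      _ = _ := by
          rw [← h]
          refine Finset.prod_congr rfl fun j _ => ?_
          ring
  refine card_le_card_mul_rank M _ (fun S v => c S * ∏ i ∈ S, ε i v)
    (fun S v => ∏ i ∈ S, ε i v) (fun v => mul_ne_zero (hdiag v) ?_) fun v w hvw => ?_
  · rw [hpoly, Finset.prod_ne_zero_iff]
    intro j _
    rw [symmDiff_self, Finset.bot_eq_empty, Finset.card_empty, Nat.cast_zero, zero_sub, neg_ne_zero]
    positivity
  · rw [hpoly]
    by_cases hk : 2 * k < (symmDiff (e v) (e w)).card
    · rw [hoff v w hk, zero_mul]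
    · obtain ⟨r, hr⟩ := even_card_symmDiff (heven v) (heven w)
      have hpos : 0 < (symmDiff (e v) (e w)).card := by
        rw [Finset.card_pos, Finset.nonempty_iff_ne_empty, ← Finset.bot_eq_empty, Ne,
          symmDiff_eq_bot]
        exact fun h => hvw (he h)
      rw [Finset.prod_eq_zero (i := r - 1), mul_zero]
      · rw [Finset.mem_range]
        omega
      · rw [hr, Nat.cast_sub (by omega)]
        push_cast
        ring

theorem exists_represents_rank_eq_minrk (F : Type*) [Field F] {V : Type*} [Fintype V]
    (G : SimpleGraph V) : ∃ M : Matrix V V F, Represents M G ∧ M.rank = minrk F G := by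
  classical
  refine Nat.sInf_mem (s := {r : ℕ | ∃ M : Matrix V V F, Represents M G ∧ M.rank = r})
    ⟨_, 1, ⟨fun v => ?_, fun u v huv _ => ?_⟩, rfl⟩
  · simp
  · exact one_apply_ne huv

/-- If `H` has a closed walk of length `2 * q + 1`, then there are graphs with `H`-free complement
and large minrank. -/
theorem exists_graph_le_mul_minrk {h : ℕ} (H : SimpleGraph (Fin h)) (q t n : ℕ) (ht : 1 ≤ t)
    {u : Fin h} (p : H.Walk u u) (hp : p.length = 2 * q + 1)
    (hn : n ≤ 2 ^ ((2 * q + 1) * t - 1)) (x : ℝ) (hx0 : 0 < x) (hx1 : x ≤ 1) :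
    ∃ G : SimpleGraph (Fin n), ¬ ContainsCopy H Gᶜ ∧
      (n : ℝ) * (x ^ q) ^ t ≤ ((1 + x) ^ (2 * q + 1)) ^ t * minrk ℝ G := by
  obtain ⟨e, he, heven⟩ := exists_injective_even_card hn
  have hcard : Fintype.card (Option (Fin ((2 * q + 1) * t - 1))) = (2 * q + 1) * t := by
    have : 0 < (2 * q + 1) * t := by positivity
    rw [Fintype.card_option, Fintype.card_fin]
    omega
  have hexp : (2 * q + 1) * t = 2 * (q * t) + t := by ring
  let G : SimpleGraph (Fin n) :=
    { Adj := fun i j => i ≠ j ∧ (symmDiff (e i) (e j)).card ≤ 2 * (q * t)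
      symm := ⟨fun i j hij => ⟨hij.1.symm, by rw [symmDiff_comm]; exact hij.2⟩⟩
      loopless := ⟨fun i hi => hi.1 rfl⟩ }
  refine ⟨G, ?_, ?_⟩
  · rintro ⟨f, -, hf⟩
    have hwalk := (walk_card_symmDiff (fun a => e (f a)) (t - 1) (fun a b hab => by
      have hadj := (G.compl_adj _ _).1 (hf a b hab)
      have : ¬ (symmDiff (e (f a)) (e (f b))).card ≤ 2 * (q * t) :=
        fun hle => hadj.2 ⟨hadj.1, hle⟩
      rw [hcard]
      omega) p).2 (hp ▸ odd_two_mul_add_one q)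
    rw [symmDiff_self, Finset.bot_eq_empty, Finset.card_empty, zero_add, hcard, hp] at hwalk
    have := Nat.le_of_mul_le_mul_left hwalk (by positivity)
    omega
  · obtain ⟨M, hM, hrank⟩ := exists_represents_rank_eq_minrk ℝ G
    have hle := le_card_filter_mul_rank e he heven (q * t) M hM.1 fun i j hij =>
      hM.2 i j (by rintro rfl; simp at hij) fun hadj => (not_le.2 hij) hadj.2
    rw [hrank, Fintype.card_fin] at hle
    have hchernoff := card_filter_card_le_mul_pow_le
      (ι := Option (Fin ((2 * q + 1) * t - 1))) x hx0.le hx1 (q * t)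
    rw [hcard] at hchernoff
    rw [← pow_mul, ← pow_mul]
    have hle' := (Nat.cast_le (α := ℝ)).2 hle
    rw [Nat.cast_mul] at hle'
    calc _ ≤ _ := mul_le_mul_of_nonneg_right hle' (by positivity)
      _ = _ := mul_right_comm _ _ _
      _ ≤ _ := mul_le_mul_of_nonneg_right hchernoff (by positivity)

/-- For every non-bipartite graph H there is δ > 0 such that for all sufficiently
large n there is an n-vertex graph G whose complement is H-free with minrk_ℝ(G) ≥ n^δ. -/
theorem exists_compl_H_free_large_minrk {h : ℕ} (H : SimpleGraph (Fin h))
    (hH : ¬ H.Colorable 2) :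
    ∃ δ : ℝ, 0 < δ ∧ ∃ N : ℕ, ∀ n : ℕ, N ≤ n →
      ∃ G : SimpleGraph (Fin n), ¬ ContainsCopy H Gᶜ ∧
        (n : ℝ) ^ δ ≤ (minrk ℝ G : ℝ) := by
  obtain ⟨u, p, hp⟩ : ∃ (u : Fin h) (p : H.Walk u u), Odd p.length := by
    by_contra! hcon
    exact hH (SimpleGraph.two_colorable_iff_forall_loop_even.2 fun u p =>
      Nat.not_odd_iff_even.1 (hcon u p))
  obtain ⟨q, hq⟩ := hp
  have hq1 : 1 ≤ q := by
    rcases Nat.eq_zero_or_pos q with rfl | hq0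
    · exact absurd (SimpleGraph.Walk.adj_of_length_eq_one (by simpa using hq)) (H.irrefl)
    · exact hq0
  obtain ⟨x, hx0, hx1, hx⟩ := exists_pow_lt_two_pow_mul_pow q hq1
  set Q : ℕ := 2 ^ (2 * q + 1) with hQ
  have hQ2 : 2 ≤ Q := by
    rw [hQ]
    exact Nat.le_self_pow (by omega) 2
  have hQ2' : (2 : ℝ) ≤ Q := by exact_mod_cast hQ2
  have hQcast : (2 : ℝ) ^ (2 * q + 1) = Q := by rw [hQ]; push_cast; rfl
  rw [hQcast] at hx
  set a : ℝ := (1 + x) ^ (2 * q + 1)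
  set b : ℝ := x ^ q
  have ha : 0 < a := by positivity
  have hb : 0 < b := by positivity
  set δ : ℝ := Real.logb Q (Q * b / a) / 2 with hδ
  have hδ0 : 0 < δ := by
    have : 0 < Real.logb Q (Q * b / a) :=
      Real.logb_pos (by linarith) ((one_lt_div ha).2 hx)
    positivity
  have hδQ : (Q : ℝ) ^ (2 * δ) = Q * b / a := by
    rw [hδ, mul_div_cancel₀ _ two_ne_zero,
      Real.rpow_logb (by positivity) (by linarith) (by positivity)]
  have hlarge := (tendsto_rpow_atTop hδ0).comp (tendsto_natCast_atTop_atTop (R := ℝ))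
  obtain ⟨N, hN⟩ := Filter.eventually_atTop.1 (hlarge.eventually_ge_atTop ((Q : ℝ) ^ 2))
  refine ⟨δ, hδ0, max N 1, fun n hn => ?_⟩
  have hn1 : 1 ≤ n := (le_max_right _ _).trans hn
  have hn1' : (0 : ℝ) < n := by exact_mod_cast hn1
  have hnN : (Q : ℝ) ^ 2 ≤ (n : ℝ) ^ δ := hN n ((le_max_left _ _).trans hn)
  set t := Nat.log Q n + 2 with ht
  have hlow : n < Q ^ (t - 1) := Nat.lt_pow_succ_log_self (by omega) n
  have hhigh : Q ^ t ≤ Q ^ 2 * n := by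
    rw [ht, pow_add, mul_comm]
    exact Nat.mul_le_mul_left _ (Nat.pow_log_le_self Q (by omega))
  have hnt : n ≤ 2 ^ ((2 * q + 1) * t - 1) := by
    refine hlow.le.trans ?_
    rw [hQ, ← pow_mul]
    refine Nat.pow_le_pow_right (by norm_num) ?_
    rw [Nat.mul_sub]
    omega
  obtain ⟨G, hG, hle⟩ := exists_graph_le_mul_minrk H q t n (by omega) p hq hnt x hx0 hx1
  refine ⟨G, hG, ?_⟩
  have hpow : (n : ℝ) ^ (2 * δ) ≤ (Q * b / a) ^ t := by
    rw [← hδQ, ← Real.rpow_mul_natCast (by positivity), mul_comm (2 * δ),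
      Real.rpow_natCast_mul (by positivity)]
    refine Real.rpow_le_rpow hn1'.le ?_ (by positivity)
    exact_mod_cast hlow.le.trans (Nat.pow_le_pow_right (by omega) (by omega))
  have hhigh' : (Q : ℝ) ^ t ≤ Q ^ 2 * n := by exact_mod_cast hhigh
  have hsq : (n : ℝ) ^ (2 * δ) ≤ Q ^ 2 * minrk ℝ G := by
    rw [div_pow, mul_pow, le_div_iff₀ (by positivity)] at hpow
    have h1 : (n : ℝ) ^ (2 * δ) * a ^ t * n ≤ Q ^ 2 * minrk ℝ G * (a ^ t * n) :=
      calc _ ≤ (Q : ℝ) ^ t * b ^ t * n := mul_le_mul_of_nonneg_right hpow hn1'.le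
        _ = Q ^ t * (n * b ^ t) := by ring
        _ ≤ Q ^ 2 * n * (a ^ t * minrk ℝ G) := by gcongr
        _ = _ := by ring
    rw [mul_assoc] at h1
    exact le_of_mul_le_mul_right h1 (by positivity)
  rw [two_mul, Real.rpow_add hn1'] at hsq
  have hfin : (Q : ℝ) ^ 2 * (n : ℝ) ^ δ ≤ Q ^ 2 * minrk ℝ G :=
    (mul_le_mul_of_nonneg_right hnN (by positivity)).trans hsq
  exact le_of_mul_le_mul_left hfin (by positivity)
end

section
/- For every field F and every simple graph G on n vertices, minrk_F(G) · minrk_F(Ḡ) ≥ n, where Ḡ denotes the complement of G. -/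
open Matrix

/-- Rank factorization: a matrix of rank `r` factors through `Fin r`. -/
theorem Matrix.exists_eq_mul_of_rank {F m n : Type*} [Field F] [Fintype n]
    (A : Matrix m n F) :
    ∃ (C : Matrix m (Fin A.rank) F) (R : Matrix (Fin A.rank) n F), A = C * R := by
  classical
  let b : Module.Basis (Fin A.rank) F (LinearMap.range A.mulVecLin) :=
    Module.finBasisOfFinrankEq F _ rfl
  let c (j : n) : LinearMap.range A.mulVecLin := ⟨A.mulVecLin (Pi.single j 1), _, rfl⟩
  refine ⟨.of fun i k => (b k : m → F) i, .of fun k j => b.repr (c j) k, ?_⟩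
  ext i j
  have h := congrArg (fun x : LinearMap.range A.mulVecLin => (x : m → F) i) (b.sum_repr (c j))
  have hc : (c j : m → F) i = A i j := by simp [c]
  simp only [Submodule.coe_sum, Finset.sum_apply, Submodule.coe_smul, Pi.smul_apply,
    smul_eq_mul, hc] at h
  simp only [Matrix.mul_apply, Matrix.of_apply, ← h, mul_comm]

/-- Rank is submultiplicative under the Hadamard product. -/
theorem Matrix.rank_hadamard_le {F m n : Type*} [Field F] [Fintype n]
    (A B : Matrix m n F) : (A ⊙ B).rank ≤ A.rank * B.rank := by
  obtain ⟨C, R, hA⟩ := A.exists_eq_mul_of_rank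
  obtain ⟨D, S, hB⟩ := B.exists_eq_mul_of_rank
  let P : Matrix m (Fin A.rank × Fin B.rank) F := .of fun i k => C i k.1 * D i k.2
  let Q : Matrix (Fin A.rank × Fin B.rank) n F := .of fun k j => R k.1 j * S k.2 j
  have h : A ⊙ B = P * Q := by
    ext i j
    have hA' : A i j = ∑ k, C i k * R k j := congrFun (congrFun hA i) j
    have hB' : B i j = ∑ k, D i k * S k j := congrFun (congrFun hB i) j
    rw [Matrix.hadamard_apply, hA', hB', Finset.sum_mul_sum, Matrix.mul_apply,
      Fintype.sum_prod_type]
    simp only [P, Q, Matrix.of_apply, mul_mul_mul_comm]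
  calc (A ⊙ B).rank = (P * Q).rank := by rw [h]
    _ ≤ P.rank := Matrix.rank_mul_le_left P Q
    _ ≤ Fintype.card (Fin A.rank × Fin B.rank) := P.rank_le_card_width
    _ = A.rank * B.rank := by simp

/-- The Hadamard product of matrices representing a graph and its complement has full rank. -/
theorem Represents.rank_hadamard_compl {F V : Type*} [Field F] [Fintype V]
    {G : SimpleGraph V} {A B : Matrix V V F} (hA : Represents A G) (hB : Represents B Gᶜ) :
    (A ⊙ B).rank = Fintype.card V := by
  classical
  have h : A ⊙ B = Matrix.diagonal fun v => A v v * B v v := by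
    ext u v
    by_cases huv : u = v
    · subst huv
      simp
    · rw [Matrix.hadamard_apply, Matrix.diagonal_apply_ne _ huv]
      by_cases hG : G.Adj u v
      · rw [hB.2 u v huv (by simp [hG]), mul_zero]
      · rw [hA.2 u v huv hG, zero_mul]
  rw [h]
  refine Matrix.rank_of_isUnit _ (Matrix.isUnit_diagonal.mpr ?_)
  exact Pi.isUnit_iff.mpr fun v => (mul_ne_zero (hA.1 v) (hB.1 v)).isUnit

/-- For every field F and every n-vertex graph G,
minrk_F(G) · minrk_F(Ḡ) ≥ n. -/
theorem minrk_mul_minrk_compl_ge (F : Type*) [Field F] {n : ℕ} (G : SimpleGraph (Fin n)) :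
    n ≤ minrk F G * minrk F Gᶜ := by
  obtain ⟨A, hA, hAr⟩ := exists_represents_rank_eq_minrk F G
  obtain ⟨B, hB, hBr⟩ := exists_represents_rank_eq_minrk F Gᶜ
  have h := Matrix.rank_hadamard_le A B
  rwa [hA.rank_hadamard_compl hB, hAr, hBr, Fintype.card_fin] at h
end
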